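/- arXiv:1805.05174 — 4 statements merged into one kernel-verified Lean document; each statement's English description precedes it below -/
import Mathlib

section
/- Let k be an algebraically closed field and K = k((w)) the field of formal Laurent series over k. Let D be a finite-dimensional K-algebra that is simple (its only two-sided ideals are 0 and D) and central over K (the center of D is exactly K·1). Then there exists a positive integer t and a K-algebra isomorphism D ≅ Mat_t(K), the algebra of t×t matrices over K. -/
open Polynomial WithZero

namespace LaurentSeries
variable {k : Type*} [Field k]

/-- Over the complete field `k((w))`, a monic irreducible polynomial with integral constant
coefficient has integral coefficients. -/
theorem valuation_coeff_le_one_of_irreducible {f : (LaurentSeries k)[X]} (hf : f.Monic)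
    (hirr : Irreducible f) (h0 : Valued.v (f.coeff 0) ≤ (1 : ℤᵐ⁰)) (n : ℕ) :
    Valued.v (f.coeff n) ≤ (1 : ℤᵐ⁰) := by
  let v : Valuation (LaurentSeries k) ℤᵐ⁰ := Valued.v
  have hnt : v.IsNontrivial := by
    refine ⟨⟨HahnSeries.single 1 1, ?_, ?_⟩⟩ <;>
    · change Valued.v _ ≠ _
      rw [valuation_single_zpow]
      decide +revert
  obtain ⟨hv⟩ : Nonempty v.RankOne :=
    Valuation.nonempty_rankOne_iff_mulArchimedean.2 inferInstance
  let := Valued.toNontriviallyNormedField (LaurentSeries k) ℤᵐ⁰ (hv := hv)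
  have : IsUltrametricDist (LaurentSeries k) :=
    Valued.instIsUltrametricDist (LaurentSeries k) ℤᵐ⁰ (hv := hv)
  have : CompleteSpace (LaurentSeries k) := instLaurentSeriesComplete
  have : Fact (Irreducible f) := ⟨hirr⟩
  have : FiniteDimensional (LaurentSeries k) (AdjoinRoot f) := hf.finite_adjoinRoot
  have hmin : minpoly (LaurentSeries k) (AdjoinRoot.root f) = f := by
    rw [AdjoinRoot.minpoly_root hf.ne_zero, hf.leadingCoeff]; simp
  have hs := spectralNorm.spectralNorm_eq_norm_coeff_zero_rpow (LaurentSeries k) (AdjoinRoot f)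
    (AdjoinRoot.root f)
  have h1 : spectralValue f ≤ 1 := by
    rw [spectralNorm, hmin] at hs
    rw [hs]
    exact Real.rpow_le_one (norm_nonneg _) (Valued.toNormedField.norm_le_one_iff.2 h0)
      (by positivity)
  exact Valued.toNormedField.norm_le_one_iff.1 ((spectralValue_le_one_iff hf).1 h1 n)

end LaurentSeries

/-- The characteristic polynomial divides a power of any annihilating polynomial. -/
theorem Matrix.charpoly_dvd_pow_of_aeval_eq_zero {R n : Type*} [CommRing R] [Fintype n]
    [DecidableEq n] (M : Matrix n n R) {f : R[X]} (hf : aeval M f = 0) :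
    M.charpoly ∣ f ^ Fintype.card n := by
  let φ : Matrix n n R →ₐ[R] Matrix n n R[X] := (Algebra.ofId R R[X]).mapMatrix
  let ψ : R[X] →ₐ[R] Matrix n n R[X] := (Algebra.ofId R[X] (Matrix n n R[X])).restrictScalars R
  have hdvd : M.charmatrix ∣ Matrix.scalar n f := by
    have h1 : aeval (ψ X) f - aeval (φ M) f = Matrix.scalar n f := by
      rw [aeval_algHom_apply, aeval_algHom_apply, hf, aeval_X_left_apply]
      simp [ψ, Algebra.ofId_apply, Matrix.algebraMap_eq_diagonal]
    rw [← h1, aeval_eq_sum_range, aeval_eq_sum_range, ← Finset.sum_sub_distrib]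
    refine Finset.dvd_sum fun i _ ↦ ?_
    rw [← smul_sub]
    refine dvd_smul_of_dvd _ ?_
    exact Commute.sub_dvd_pow_sub_pow (Algebra.commutes (X : R[X]) (φ M)) i
  obtain ⟨N, hN⟩ := hdvd
  refine ⟨N.det, ?_⟩
  rw [Matrix.charpoly, ← Matrix.det_mul, ← hN]
  simp

section DivisionRing
variable {K D ι : Type*} [Field K] [DivisionRing D] [Algebra K D] [Fintype ι] [DecidableEq ι]

theorem Algebra.exists_charpoly_leftMulMatrix_eq_pow (b : Module.Basis ι K D) (x : D) :
    ∃ r ≠ 0, (Algebra.leftMulMatrix b x).charpoly = minpoly K x ^ r := by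
  have := Module.Finite.of_basis b
  have hx : IsIntegral K x := Algebra.IsIntegral.isIntegral x
  have h0 : aeval (Algebra.leftMulMatrix b x) (minpoly K x) = 0 := by
    rw [aeval_algHom_apply, minpoly.aeval, map_zero]
  obtain ⟨r, -, hr⟩ := (dvd_prime_pow (minpoly.irreducible hx).prime _).1
    (Matrix.charpoly_dvd_pow_of_aeval_eq_zero _ h0)
  have hr' := eq_of_monic_of_associated (Matrix.charpoly_monic _) ((minpoly.monic hx).pow r) hr
  refine ⟨r, ?_, hr'⟩
  rintro rfl
  have hd := congrArg natDegree hr'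
  rw [Matrix.charpoly_natDegree_eq_dim, pow_zero, natDegree_one] at hd
  have := b.index_nonempty
  exact Fintype.card_ne_zero hd

theorem Algebra.norm_algebraMap_sub_eq_eval_charpoly (b : Module.Basis ι K D) (c : K) (x : D) :
    Algebra.norm K (algebraMap K D c - x) = (Algebra.leftMulMatrix b x).charpoly.eval c := by
  rw [Algebra.norm_eq_matrix_det b, Matrix.eval_charpoly, map_sub, AlgHom.commutes]
  rfl

end DivisionRing

namespace LaurentSeries
variable {k D : Type*} [Field k] [DivisionRing D] [Algebra (LaurentSeries k) D]
  [FiniteDimensional (LaurentSeries k) D]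

/-- If `x` has integral norm, then the characteristic polynomial of multiplication by `x` lifts to
a polynomial over `k⟦w⟧`. -/
theorem exists_monic_eval_eq_norm_sub {x : D}
    (hx : Valued.v (Algebra.norm (LaurentSeries k) x) ≤ (1 : ℤᵐ⁰)) :
    ∃ P : (PowerSeries k)[X], P.Monic ∧ P.natDegree ≠ 0 ∧ ∀ c : PowerSeries k,
      Algebra.norm (LaurentSeries k) (algebraMap (LaurentSeries k) D c - x) =
        (P.eval c : PowerSeries k) := by
  let b := Module.finBasis (LaurentSeries k) D
  obtain ⟨r, hr0, hr⟩ := Algebra.exists_charpoly_leftMulMatrix_eq_pow b x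
  have hint : IsIntegral (LaurentSeries k) x := Algebra.IsIntegral.isIntegral x
  have hv0 : Valued.v ((minpoly (LaurentSeries k) x).coeff 0) ≤ (1 : ℤᵐ⁰) := by
    have h1 : Valued.v (Algebra.norm (LaurentSeries k) x) =
        (Valued.v ((minpoly (LaurentSeries k) x).coeff 0) : ℤᵐ⁰) ^ r := by
      rw [Algebra.norm_eq_matrix_det b, Matrix.det_eq_sign_charpoly_coeff, hr, map_mul,
        coeff_zero_eq_eval_zero, eval_pow, ← coeff_zero_eq_eval_zero, map_pow, map_pow,
        Valuation.map_neg, map_one, one_pow, one_mul]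
    rw [h1] at hx
    exact (pow_le_one_iff hr0).1 hx
  have hlift : minpoly (LaurentSeries k) x ∈
      lifts (algebraMap (PowerSeries k) (LaurentSeries k)) := by
    rw [lifts_iff_coeff_lifts]
    intro n
    obtain ⟨F, hF⟩ := (val_le_one_iff_eq_coe k _).1 (valuation_coeff_le_one_of_irreducible
      (minpoly.monic hint) (minpoly.irreducible hint) hv0 n)
    exact ⟨F, hF⟩
  obtain ⟨p, hp, hpd, hpm⟩ := lifts_and_natDegree_eq_and_monic hlift (minpoly.monic hint)
  refine ⟨p ^ r, hpm.pow r, ?_, fun c ↦ ?_⟩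
  · rw [hpm.natDegree_pow, hpd]
    exact mul_ne_zero hr0 (minpoly.natDegree_pos hint).ne'
  · rw [Algebra.norm_algebraMap_sub_eq_eval_charpoly b, hr, ← hp, ← Polynomial.map_pow]
    exact eval_map_apply _ _

theorem valuation_coe_le_one (F : PowerSeries k) :
    Valued.v (F : LaurentSeries k) ≤ (1 : ℤᵐ⁰) :=
  (val_le_one_iff_eq_coe k _).2 ⟨F, rfl⟩

variable (k D) in
/-- The extension of the `w`-adic valuation to a finite-dimensional division algebra over
`k((w))`, normalised as the valuation of the norm. -/
noncomputable def normValuation : Valuation D ℤᵐ⁰ where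
  toFun x := Valued.v (Algebra.norm (LaurentSeries k) x)
  map_zero' := by simp
  map_one' := by simp
  map_mul' x y := by simp
  map_add_le_max' := by
    have key (x : D) (hx : Valued.v (Algebra.norm (LaurentSeries k) x) ≤ (1 : ℤᵐ⁰)) :
        Valued.v (Algebra.norm (LaurentSeries k) (1 + x)) ≤ (1 : ℤᵐ⁰) := by
      obtain ⟨P, -, -, hP⟩ := exists_monic_eval_eq_norm_sub hx
      have h := hP (-1)
      have h2 : algebraMap (LaurentSeries k) D ((-1 : PowerSeries k) : LaurentSeries k) - x =
          -1 * (1 + x) := by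
        simp [map_neg]; abel
      have h3 : (Valued.v (Algebra.norm (LaurentSeries k) (-1 : D)) : ℤᵐ⁰) = 1 := by
        rw [← pow_eq_one_iff_of_nonneg zero_le two_ne_zero, ← map_pow, ← map_pow]
        simp
      calc _ = Valued.v (Algebra.norm (LaurentSeries k) (-1 * (1 + x))) := by
            rw [map_mul, map_mul, h3, one_mul]
        _ ≤ (1 : ℤᵐ⁰) := by
            rw [← h2, h]
            exact valuation_coe_le_one _
    have aux (x y : D) (hy : y ≠ 0)
        (hxy : Valued.v (Algebra.norm (LaurentSeries k) x) ≤
          (Valued.v (Algebra.norm (LaurentSeries k) y) : ℤᵐ⁰)) :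
        Valued.v (Algebra.norm (LaurentSeries k) (x + y)) ≤
          (Valued.v (Algebra.norm (LaurentSeries k) y) : ℤᵐ⁰) := by
      have hs : x + y = y * (1 + y⁻¹ * x) := by
        rw [mul_add, mul_inv_cancel_left₀ hy, mul_one, add_comm]
      have hu : (Valued.v (Algebra.norm (LaurentSeries k) y) : ℤᵐ⁰) *
          Valued.v (Algebra.norm (LaurentSeries k) (y⁻¹ * x)) =
          Valued.v (Algebra.norm (LaurentSeries k) x) := by
        rw [← map_mul, ← map_mul, mul_inv_cancel_left₀ hy]
      rw [hs, map_mul, map_mul]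
      refine mul_le_of_le_one_right' (key _ ?_)
      have hy' : (0 : ℤᵐ⁰) < Valued.v (Algebra.norm (LaurentSeries k) y) := by
        rw [zero_lt_iff, Valuation.ne_zero_iff]
        exact Algebra.norm_ne_zero_iff.2 hy
      rw [← hu] at hxy
      exact le_of_mul_le_mul_left (by simpa using hxy) hy'
    intro x y
    rcases eq_or_ne x 0 with rfl | hx
    · simp
    rcases eq_or_ne y 0 with rfl | hy
    · simp
    rcases le_total (Valued.v (Algebra.norm (LaurentSeries k) x) : ℤᵐ⁰)
      (Valued.v (Algebra.norm (LaurentSeries k) y)) with h | h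
    · exact (aux x y hy h).trans (le_max_right _ _)
    · rw [add_comm]
      exact (aux y x hx h).trans (le_max_left _ _)

theorem normValuation_apply (x : D) :
    normValuation k D x = Valued.v (Algebra.norm (LaurentSeries k) x) := rfl

theorem normValuation_algebraMap (c : LaurentSeries k) :
    normValuation k D (algebraMap _ D c) =
      (Valued.v c : ℤᵐ⁰) ^ Module.finrank (LaurentSeries k) D := by
  rw [normValuation_apply, Algebra.norm_algebraMap, map_pow]

theorem normValuation_coe_le_one (F : PowerSeries k) :
    normValuation k D (algebraMap (LaurentSeries k) D F) ≤ 1 := by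
  rw [normValuation_algebraMap]
  exact pow_le_one' (valuation_coe_le_one F) _

theorem normValuation_X_lt_one :
    normValuation k D (algebraMap (LaurentSeries k) D (PowerSeries.X : PowerSeries k)) < 1 := by
  rw [normValuation_algebraMap]
  refine pow_lt_one' ?_ Module.finrank_pos.ne'
  have := valuation_X_pow k 1
  rw [pow_one] at this
  rw [this]
  decide +revert

/-- The residue division algebra of `D` is `k`. -/
theorem exists_normValuation_sub_lt_one [IsAlgClosed k] {x : D} (hx : normValuation k D x ≤ 1) :
    ∃ c : k, normValuation k D
      (x - algebraMap (LaurentSeries k) D (PowerSeries.C c : PowerSeries k)) < 1 := by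
  obtain ⟨P, hPm, hPd, hP⟩ := exists_monic_eval_eq_norm_sub hx
  obtain ⟨c, hc⟩ := IsAlgClosed.exists_root (P.map PowerSeries.constantCoeff) (by
    rw [hPm.degree_map, degree_eq_natDegree hPm.ne_zero]
    exact_mod_cast hPd)
  refine ⟨c, ?_⟩
  rw [Valuation.map_sub_swap, normValuation_apply, hP]
  have h0 : PowerSeries.constantCoeff (P.eval (PowerSeries.C c)) = 0 := by
    rw [← eval_map_apply, PowerSeries.constantCoeff_C]
    exact hc
  obtain ⟨F, hF⟩ := PowerSeries.X_dvd_iff.2 h0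
  have hX := valuation_X_pow k 1
  rw [pow_one] at hX
  rw [hF, PowerSeries.coe_mul, map_mul, hX]
  refine (mul_le_of_le_one_right' (valuation_coe_le_one F)).trans_lt ?_
  decide +revert


variable (k D) in
theorem exists_uniformizer_normValuation : ∃ π : D, π ≠ 0 ∧ normValuation k D π < 1 ∧
    ∀ x, normValuation k D x < 1 → normValuation k D x ≤ normValuation k D π := by
  obtain ⟨m, ⟨π, hπ0, hπm, hm⟩, hmax⟩ := Int.exists_greatest_of_bdd
    (P := fun m ↦ ∃ π : D, π ≠ 0 ∧ normValuation k D π = exp m ∧ m < 0)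
    ⟨0, fun m ⟨_, _, _, hm⟩ ↦ hm.le⟩ (by
      have hX := normValuation_X_lt_one (k := k) (D := D)
      have hX0 : algebraMap (LaurentSeries k) D (PowerSeries.X : PowerSeries k) ≠ 0 := by
        simp
      refine ⟨log _, _, hX0, (exp_log ((Valuation.ne_zero_iff _).2 hX0)).symm, ?_⟩
      rwa [← log_one, log_lt_log ((Valuation.ne_zero_iff _).2 hX0) one_ne_zero])
  refine ⟨π, hπ0, ?_, fun x hx ↦ ?_⟩
  · rw [hπm, ← exp_zero, exp_lt_exp]
    exact hm
  · rcases eq_or_ne x 0 with rfl | hx0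
    · simp
    have hx0' := (Valuation.ne_zero_iff (normValuation k D)).2 hx0
    rw [hπm, ← exp_log hx0', exp_le_exp]
    refine hmax _ ⟨x, hx0, (exp_log hx0').symm, ?_⟩
    rwa [← log_one, log_lt_log hx0' one_ne_zero]

theorem exists_eq_sum_add_pow_mul [IsAlgClosed k] {π : D} (hπ0 : π ≠ 0)
    (hmax : ∀ x, normValuation k D x < 1 → normValuation k D x ≤ normValuation k D π) (n : ℕ)
    {x : D} (hx : normValuation k D x ≤ 1) :
    ∃ (c : ℕ → k) (z : D), normValuation k D z ≤ 1 ∧ x = ∑ i ∈ Finset.range n,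
      algebraMap (LaurentSeries k) D (PowerSeries.C (c i) : PowerSeries k) * π ^ i + π ^ n * z := by
  induction n with
  | zero => exact ⟨0, x, hx, by simp⟩
  | succ n ih =>
    obtain ⟨c, z, hz, hxz⟩ := ih
    obtain ⟨a, ha⟩ := exists_normValuation_sub_lt_one hz
    refine ⟨Function.update c n a,
      π⁻¹ * (z - algebraMap (LaurentSeries k) D (PowerSeries.C a : PowerSeries k)), ?_, ?_⟩
    · rw [map_mul, map_inv₀, ← div_eq_inv_mul]
      exact div_le_one_of_le₀ (hmax _ ha) zero_le
    · have hsum : ∑ i ∈ Finset.range n, algebraMap (LaurentSeries k) D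
            (PowerSeries.C (Function.update c n a i) : PowerSeries k) * π ^ i =
          ∑ i ∈ Finset.range n,
            algebraMap (LaurentSeries k) D (PowerSeries.C (c i) : PowerSeries k) * π ^ i := by
        refine Finset.sum_congr rfl fun i hi ↦ ?_
        rw [Function.update_of_ne (Finset.mem_range.1 hi).ne]
      rw [Finset.sum_range_succ, hsum, Function.update_self, pow_succ, mul_assoc,
        mul_inv_cancel_left₀ hπ0, mul_sub, Algebra.commutes, add_assoc, add_sub_cancel]
      exact hxz

/-- Every element of the valuation ring of `D` is a polynomial in a uniformizer. -/
theorem mem_adjoin_of_normValuation_le_one [IsAlgClosed k] {π : D} (hπ0 : π ≠ 0)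
    (hπ1 : normValuation k D π < 1)
    (hmax : ∀ x, normValuation k D x < 1 → normValuation k D x ≤ normValuation k D π)
    {x : D} (hx : normValuation k D x ≤ 1) : x ∈ Algebra.adjoin (LaurentSeries k) {π} := by
  set w := normValuation k D with hw
  set t : D := algebraMap (LaurentSeries k) D (PowerSeries.X : PowerSeries k) with ht
  have ht0 : t ≠ 0 := by simp [ht]
  have hwt0 : w t ≠ 0 := (Valuation.ne_zero_iff _).2 ht0
  have ht1 : w t < 1 := normValuation_X_lt_one
  obtain ⟨n, hn⟩ := exists_pow_lt₀ hπ1 (Units.mk0 _ hwt0)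
  have step (x : w.integer) : ∃ (c : ℕ → k) (z : w.integer),
      (x : D) = ∑ i ∈ Finset.range n,
        algebraMap (LaurentSeries k) D (PowerSeries.C (c i) : PowerSeries k) * π ^ i + t * z := by
    obtain ⟨c, z, hz, hxz⟩ := exists_eq_sum_add_pow_mul hπ0 hmax n x.2
    refine ⟨c, ⟨t⁻¹ * (π ^ n * z), ?_⟩, ?_⟩
    · rw [Valuation.mem_integer_iff, map_mul, map_inv₀, ← div_eq_inv_mul, map_mul, map_pow]
      refine div_le_one_of_le₀ ((mul_le_of_le_one_right' hz).trans ?_) zero_le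
      exact hn.le
    · rw [mul_inv_cancel_left₀ ht0]
      exact hxz
  choose c z hcz using step
  let f (x : w.integer) (i : ℕ) : PowerSeries k := PowerSeries.mk fun j ↦ c (z^[j] x) i
  have hf (x : w.integer) (i : ℕ) :
      f x i = PowerSeries.C (c x i) + PowerSeries.X * f (z x) i := by
    ext j
    cases j with
    | zero => simp [f]
    | succ j => simp [f, PowerSeries.coeff_succ_X_mul]
  let y (x : w.integer) : D :=
    ∑ i ∈ Finset.range n, algebraMap (LaurentSeries k) D (f x i) * π ^ i
  have hy (x : w.integer) : w (y x) ≤ 1 := by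
    refine w.map_sum_le fun i _ ↦ ?_
    rw [map_mul, map_pow]
    exact mul_le_one' (normValuation_coe_le_one _) (pow_le_one' hπ1.le _)
  have hxy (x : w.integer) : (x : D) - y x = t * (z x - y (z x)) := by
    have : y x = ∑ i ∈ Finset.range n,
        algebraMap (LaurentSeries k) D (PowerSeries.C (c x i) : PowerSeries k) * π ^ i +
          t * y (z x) := by
      simp only [y]
      rw [Finset.mul_sum, ← Finset.sum_add_distrib]
      refine Finset.sum_congr rfl fun i _ ↦ ?_
      rw [hf x i, PowerSeries.coe_add, PowerSeries.coe_mul, map_add, map_mul, add_mul, mul_assoc]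
    rw [this, mul_sub]
    nth_rw 1 [hcz x]
    abel
  have hle (j : ℕ) : ∀ x : w.integer, w (x - y x) ≤ w t ^ j := by
    induction j with
    | zero =>
      intro x
      rw [pow_zero]
      exact w.map_sub_le x.2 (hy x)
    | succ j ih =>
      intro x
      rw [hxy, map_mul, pow_succ']
      exact mul_le_mul_right (ih _) _
  have hzero : x - y ⟨x, hx⟩ = 0 := by
    by_contra hne
    obtain ⟨j, hj⟩ := exists_pow_lt₀ ht1 (Units.mk0 _ ((Valuation.ne_zero_iff w).2 hne))
    exact (hle j ⟨x, hx⟩).not_gt hj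
  rw [sub_eq_zero.1 hzero]
  refine sum_mem fun i _ ↦ mul_mem (Subalgebra.algebraMap_mem _ _) (pow_mem ?_ _)
  exact Algebra.self_mem_adjoin_singleton _ _

variable (k) in
/-- A finite-dimensional division algebra over `k((w))` is commutative. -/
theorem mul_comm_of_divisionRing [IsAlgClosed k] (x y : D) : x * y = y * x := by
  obtain ⟨π, hπ0, hπ1, hmax⟩ := exists_uniformizer_normValuation k D
  have key {a b : D} (ha : normValuation k D a ≤ 1) (hb : normValuation k D b ≤ 1) :
      Commute a b :=
    setLike_mul_comm (mem_adjoin_of_normValuation_le_one hπ0 hπ1 hmax ha)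
      (mem_adjoin_of_normValuation_le_one hπ0 hπ1 hmax hb)
  have hinv {a : D} (ha : 1 ≤ normValuation k D a) : normValuation k D a⁻¹ ≤ 1 := by
    rw [map_inv₀]
    exact inv_le_one_of_one_le₀ ha
  rcases le_total (normValuation k D x) 1 with hx | hx <;>
    rcases le_total (normValuation k D y) 1 with hy | hy
  · exact key hx hy
  · exact Commute.inv_right_iff₀.1 (key hx (hinv hy))
  · exact Commute.inv_left_iff₀.1 (key (hinv hx) hy)
  · exact Commute.inv_left_iff₀.1 (Commute.inv_right_iff₀.1 (key (hinv hx) (hinv hy)))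

end LaurentSeries

theorem Algebra.IsCentral.algebraMap_bijective_of_algEquiv_matrix {K A D n : Type*} [Field K]
    [Ring A] [Algebra K A] [Algebra.IsCentral K A] [DivisionRing D] [Algebra K D] [Fintype n]
    [DecidableEq n] [Nonempty n] (e : A ≃ₐ[K] Matrix n n D) (hD : ∀ x y : D, x * y = y * x) :
    Function.Bijective (algebraMap K D) := by
  refine ⟨(algebraMap K D).injective, fun d ↦ ?_⟩
  have hc : e.symm (Matrix.scalar n d) ∈ Subalgebra.center K A := by
    refine Subalgebra.mem_center_iff.2 fun a ↦ e.injective ?_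
    rw [map_mul, map_mul, AlgEquiv.apply_symm_apply]
    exact ((Matrix.scalar_commute d (fun _ ↦ hD _ _) (e a)).eq).symm
  obtain ⟨a, ha⟩ := (Algebra.IsCentral.mem_center_iff K).1 hc
  refine ⟨a, ?_⟩
  have h := congrArg e ha
  rw [AlgEquiv.apply_symm_apply] at h
  obtain ⟨i⟩ := ‹Nonempty n›
  simpa [Matrix.algebraMap_matrix_apply] using (congrFun (congrFun h i) i).symm

/-- Over `K = k((w))`, the field of formal Laurent series over an algebraically
closed field `k`, every finite-dimensional central simple `K`-algebra is isomorphic to a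
matrix algebra `Mat_t(K)` for some `t ≥ 1` (the Brauer group of `k((w))` is trivial). -/
theorem statement1 {k : Type*} [Field k] [IsAlgClosed k]
    (D : Type*) [Ring D] [Algebra (LaurentSeries k) D]
    [FiniteDimensional (LaurentSeries k) D]
    [IsSimpleRing D] [Algebra.IsCentral (LaurentSeries k) D] :
    ∃ t : ℕ, 0 < t ∧
      Nonempty (D ≃ₐ[LaurentSeries k] Matrix (Fin t) (Fin t) (LaurentSeries k)) := by
  have := IsArtinianRing.of_finite (LaurentSeries k) D
  obtain ⟨t, ht, E, _, _, _, ⟨e⟩⟩ :=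
    IsSimpleRing.exists_algEquiv_matrix_divisionRing_finite (LaurentSeries k) D
  exact ⟨t, Nat.pos_of_neZero t, ⟨e.trans <| .mapMatrix <| .symm <|
    .ofBijective (Algebra.ofId (LaurentSeries k) E)
      (Algebra.IsCentral.algebraMap_bijective_of_algEquiv_matrix e
        (LaurentSeries.mul_comm_of_divisionRing k))⟩⟩
end

section
/- Let k be an algebraically closed field and let K be a field that is a finite extension of the rational function field k(t) in one variable over k (i.e. K is the function field of an algebraic curve over k). Let D be a finite-dimensional K-algebra that is simple and central over K (its center equals K·1). Then there exists a positive integer t and a K-algebra isomorphism D ≅ Mat_t(K). -/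
section LinearGrowth

open Polynomial

/-- Linear growth of the span of polynomial multiples of a finite family in a finite extension of
`k(t)`. -/
lemma RatFunc.exists_submodule_finrank_le {k K ι : Type*} [Field k] [Field K]
    [Algebra (RatFunc k) K] [FiniteDimensional (RatFunc k) K] [Algebra k K]
    [IsScalarTower k (RatFunc k) K] [Finite ι] (s : ι → K) :
    ∃ c : ℕ, ∀ N : ℕ, ∃ W : Submodule k K, FiniteDimensional k W ∧
      Module.finrank k W ≤ Module.finrank (RatFunc k) K * (N + c + 1) ∧
      ∀ (i : ι) (p : k[X]), p.natDegree ≤ N → algebraMap k[X] (RatFunc k) p • s i ∈ W := by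
  have := Fintype.ofFinite ι
  let u := Module.finBasis (RatFunc k) K
  obtain ⟨⟨Q, hQ⟩, hQs⟩ := IsLocalization.exist_integer_multiples_of_finite (nonZeroDivisors k[X])
    (fun j : ι × Fin (Module.finrank (RatFunc k) K) ↦ u.repr (s j.1) j.2)
  choose p hp using hQs
  have hQ0 : algebraMap k[X] (RatFunc k) Q ≠ 0 := by
    simpa using nonZeroDivisors.ne_zero hQ
  let c := Finset.univ.sup fun j ↦ (p j).natDegree
  refine ⟨c, fun N ↦ ?_⟩
  let Ψ : (Fin (Module.finrank (RatFunc k) K) → degreeLT k (N + c + 1)) →ₗ[k] K :=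
    ∑ l, (((LinearMap.toSpanSingleton (RatFunc k) K
      ((algebraMap k[X] (RatFunc k) Q)⁻¹ • u l)).restrictScalars k ∘ₗ
        (IsScalarTower.toAlgHom k k[X] (RatFunc k)).toLinearMap ∘ₗ (degreeLT k (N + c + 1)).subtype)
        ∘ₗ LinearMap.proj l)
  have hΨ (g) : Ψ g = ∑ l, algebraMap k[X] (RatFunc k) (g l : k[X]) •
      (algebraMap k[X] (RatFunc k) Q)⁻¹ • u l := by
    simp [Ψ, LinearMap.sum_apply]
  let e := degreeLTEquiv k (N + c + 1)
  have : FiniteDimensional k (degreeLT k (N + c + 1)) := Module.Finite.equiv e.symm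
  refine ⟨LinearMap.range Ψ, inferInstance, ?_, fun i q hq ↦ ?_⟩
  · refine (LinearMap.finrank_range_le Ψ).trans ?_
    rw [Module.finrank_pi_fintype]
    simp [e.finrank_eq]
  · refine ⟨fun l ↦ ⟨q * p (i, l), ?_⟩, ?_⟩
    · rw [mem_degreeLT]
      refine lt_of_le_of_lt degree_le_natDegree (Nat.cast_lt.2 ?_)
      have h1 : (p (i, l)).natDegree ≤ c :=
        Finset.le_sup (f := fun j ↦ (p j).natDegree) (Finset.mem_univ _)
      have h2 := natDegree_mul_le (p := q) (q := p (i, l))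
      omega
    · rw [hΨ]
      conv_rhs => rw [← u.sum_repr (s i), Finset.smul_sum]
      refine Finset.sum_congr rfl fun l _ ↦ ?_
      have := hp (i, l)
      simp only [Algebra.smul_def] at this
      rw [map_mul, this, smul_smul, smul_smul]
      congr 1
      field_simp

end LinearGrowth

section Tsen

open MvPolynomial
open scoped Polynomial

lemma MvPolynomial.card_le_height_vanishingIdeal_zero (k : Type*) [Field k] (s : ℕ) :
    (s : ℕ∞) ≤ (vanishingIdeal k {(0 : Fin s → k)}).height := by
  let f (i : ℕ) : MvPolynomial (Fin s) k →ₐ[k] MvPolynomial (Fin s) k :=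
    aeval fun j ↦ if (j : ℕ) < i then 0 else X j
  have hf (i : ℕ) (j : Fin s) : f i (X j) = if (j : ℕ) < i then 0 else X j := aeval_X _ _
  have hprime (i : ℕ) : (RingHom.ker (f i)).IsPrime := RingHom.ker_isPrime _
  have hcomp (i : ℕ) : (f (i + 1)).comp (f i) = f (i + 1) := by
    ext1 j
    rw [AlgHom.comp_apply, hf i]
    split_ifs with h
    · rw [map_zero, hf, if_pos (h.trans (Nat.lt_succ_self i))]
    · rfl
  have hlt (i : ℕ) (hi : i < s) : RingHom.ker (f i) < RingHom.ker (f (i + 1)) := by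
    refine lt_of_le_not_ge (fun p hp ↦ ?_) fun h ↦ ?_
    · rw [RingHom.mem_ker] at hp ⊢
      rw [← hcomp, AlgHom.comp_apply, hp, map_zero]
    · have h1 : X (⟨i, hi⟩ : Fin s) ∈ RingHom.ker (f (i + 1)) := by simp [hf]
      have h2 := h h1
      simp [hf] at h2
  have hle (i : ℕ) (hi : i ≤ s) : (i : ℕ∞) ≤ (RingHom.ker (f i)).height := by
    induction i with
    | zero => simp
    | succ i ih =>
      push_cast
      have := Ideal.height_add_one_le_of_lt_of_isPrime (hlt i hi)
      exact (add_le_add_left (ih (by omega)) 1).trans this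
  refine (hle s le_rfl).trans (Ideal.height_mono fun p hp ↦ ?_)
  have h0 : f s = (Algebra.ofId k _).comp (aeval (0 : Fin s → k)) := by
    ext1 j
    simp [hf]
  rw [RingHom.mem_ker, h0] at hp
  rw [mem_vanishingIdeal_singleton_iff]
  simpa [Algebra.ofId_apply] using hp

lemma MvPolynomial.exists_ne_zero_forall_eval_eq_zero_fin {k ι : Type*} [Field k] [IsAlgClosed k]
    [Finite ι] {s : ℕ} (f : ι → MvPolynomial (Fin s) k) (h0 : ∀ i, eval 0 (f i) = 0)
    (hcard : Nat.card ι < s) : ∃ x : Fin s → k, x ≠ 0 ∧ ∀ i, eval x (f i) = 0 := by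
  by_contra! hcon
  let I := Ideal.span (Set.range f)
  let m := vanishingIdeal k {(0 : Fin s → k)}
  have hIm : I ≤ m := by
    rw [Ideal.span_le]
    rintro _ ⟨i, rfl⟩
    exact (mem_vanishingIdeal_singleton_iff _ _).2 (by simpa [aeval_eq_eval] using h0 i)
  have hZ : zeroLocus k I ⊆ {0} := by
    intro x hx
    by_contra hx0
    obtain ⟨i, hi⟩ := hcon x hx0
    exact hi (by simpa [aeval_eq_eval] using hx (f i) (Ideal.subset_span ⟨i, rfl⟩))
  have hrad : m ≤ I.radical := by
    rw [← vanishingIdeal_zeroLocus_eq_radical (K := k)]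
    exact vanishingIdeal_anti_mono hZ
  have hmin : m ∈ I.minimalPrimes :=
    ⟨⟨inferInstance, hIm⟩, fun q hq _ ↦ hrad.trans (hq.1.radical_le_iff.2 hq.2)⟩
  have h1 := Ideal.height_le_card_of_mem_minimalPrimes_span (Set.finite_range f) hmin
  have h2 := (card_le_height_vanishingIdeal_zero k s).trans h1
  have h3 : (Set.range f).ncard ≤ Nat.card ι := by
    rw [← Set.image_univ, ← Set.ncard_univ]
    exact Set.ncard_image_le
  have h4 : s ≤ (Set.range f).ncard := by exact_mod_cast h2
  omega

/-- Over an algebraically closed field, a system of polynomial equations with fewer equations than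
unknowns that admits the zero solution also admits a nonzero one. -/
theorem MvPolynomial.exists_ne_zero_forall_eval_eq_zero {k ι σ : Type*} [Field k] [IsAlgClosed k]
    [Finite ι] [Finite σ] (f : ι → MvPolynomial σ k) (h0 : ∀ i, eval 0 (f i) = 0)
    (hcard : Nat.card ι < Nat.card σ) : ∃ x : σ → k, x ≠ 0 ∧ ∀ i, eval x (f i) = 0 := by
  let e := Finite.equivFin σ
  obtain ⟨x, hx, hfx⟩ := exists_ne_zero_forall_eval_eq_zero_fin (fun i ↦ rename e (f i))
    (fun i ↦ by rw [eval_rename]; exact h0 i) hcard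
  refine ⟨x ∘ e, fun h ↦ hx ?_, fun i ↦ by simpa [eval_rename] using hfx i⟩
  ext j
  simpa using congrFun h (e.symm j)

/-- Applying a linear functional to the coefficients of a polynomial. -/
lemma MvPolynomial.exists_eval_eq_linearMap_eval {R A σ : Type*} [CommRing R] [CommRing A]
    [Algebra R A] (l : A →ₗ[R] R) (P : MvPolynomial σ A) :
    ∃ Q : MvPolynomial σ R, Q.totalDegree ≤ P.totalDegree ∧
      ∀ q : σ → R, eval q Q = l (eval (fun i ↦ algebraMap R A (q i)) P) := by
  refine ⟨∑ m ∈ P.support, monomial m (l (coeff m P)), ?_, fun q ↦ ?_⟩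
  · refine totalDegree_finsetSum_le fun m hm ↦ (totalDegree_monomial_le _ _).trans ?_
    exact le_totalDegree hm
  · rw [eval_eq _ P, map_sum, map_sum]
    refine Finset.sum_congr rfl fun m _ ↦ ?_
    rw [eval_monomial, Finsupp.prod]
    simp_rw [← map_pow, ← map_prod]
    rw [mul_comm (coeff m P), ← Algebra.smul_def, map_smul, smul_eq_mul, mul_comm]

/-- A polynomial map from `k ^ σ` to a `k`-algebra which takes values in a subspace of dimension
less than that of the source and vanishes at the origin has a nontrivial zero. -/
lemma MvPolynomial.exists_ne_zero_eval_eq_zero_of_mem {k A σ : Type*} [Field k] [IsAlgClosed k]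
    [CommRing A] [Algebra k A] [Finite σ] (P : MvPolynomial σ A) (W : Submodule k A)
    [FiniteDimensional k W] (h0 : eval 0 P = 0)
    (hW : ∀ x : σ → k, eval (fun i ↦ algebraMap k A (x i)) P ∈ W)
    (hcard : Module.finrank k W < Nat.card σ) :
    ∃ x : σ → k, x ≠ 0 ∧ eval (fun i ↦ algebraMap k A (x i)) P = 0 := by
  let b := Module.finBasis k W
  choose l hl using fun i ↦ (b.coord i).exists_extend
  choose Q _ hQ using fun i ↦ exists_eval_eq_linearMap_eval (l i) P
  obtain ⟨x, hx, hxQ⟩ := exists_ne_zero_forall_eval_eq_zero Q (fun i ↦ by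
    rw [hQ]
    have : (fun j : σ ↦ algebraMap k A ((0 : σ → k) j)) = 0 := by ext; simp
    rw [this, h0, map_zero]) (by simpa using hcard)
  refine ⟨x, hx, ?_⟩
  suffices (⟨_, hW x⟩ : W) = 0 from congrArg Subtype.val this
  refine b.ext_elem fun i ↦ ?_
  have := hxQ i
  rw [hQ] at this
  have h2 := LinearMap.congr_fun (hl i) ⟨_, hW x⟩
  simp only [LinearMap.comp_apply, Submodule.subtype_apply, this, Module.Basis.coord_apply] at h2
  rw [← h2]
  simp

/-- A polynomial over a finite extension `K` of `k(t)` without constant term has a nontrivial zero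
over `k(t)` as soon as the number of variables exceeds `[K : k(t)]` times its degree. -/
theorem MvPolynomial.exists_ne_zero_eval_eq_zero_of_ratFunc {k K σ : Type*} [Field k]
    [IsAlgClosed k] [Field K] [Algebra (RatFunc k) K] [FiniteDimensional (RatFunc k) K] [Finite σ]
    (G : MvPolynomial σ K) {n : ℕ} (hG : G.totalDegree ≤ n) (h0 : eval 0 G = 0)
    (hcard : Module.finrank (RatFunc k) K * n < Nat.card σ) :
    ∃ q : σ → RatFunc k, q ≠ 0 ∧ eval (fun i ↦ algebraMap (RatFunc k) K (q i)) G = 0 := by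
  have := Fintype.ofFinite σ
  algebraize [(algebraMap (RatFunc k) K).comp (algebraMap k (RatFunc k))]
  let e := Module.finrank (RatFunc k) K
  obtain ⟨c, hc⟩ := RatFunc.exists_submodule_finrank_le (k := k) (K := K)
    (fun m : G.support ↦ coeff m.1 G)
  let d := e * (c + 1)
  obtain ⟨W, _, hWrank, hW⟩ := hc (n * d)
  let p (a : σ × Fin (d + 1) → k) (i : σ) : k[X] :=
    ∑ j, Polynomial.C (a (i, j)) * Polynomial.X ^ (j : ℕ)
  have hpdeg (a i) : (p a i).natDegree ≤ d :=
    Polynomial.natDegree_sum_le_of_forall_le _ _ fun j _ ↦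
      (Polynomial.natDegree_C_mul_X_pow_le _ _).trans (Nat.lt_succ_iff.1 j.2)
  have hpcoeff (a i) (j : Fin (d + 1)) : (p a i).coeff j = a (i, j) := by
    simp only [p, Polynomial.finsetSum_coeff, Polynomial.coeff_C_mul_X_pow]
    simp [Fin.val_inj]
  let t : K := algebraMap (RatFunc k) K RatFunc.X
  let P : MvPolynomial (σ × Fin (d + 1)) K :=
    bind₁ (fun i ↦ ∑ j : Fin (d + 1), X (i, j) * C (t ^ (j : ℕ))) G
  have hP (a : σ × Fin (d + 1) → k) : eval (fun i ↦ algebraMap k K (a i)) P =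
      eval (fun i ↦ algebraMap (RatFunc k) K (algebraMap k[X] (RatFunc k) (p a i))) G := by
    simp only [P, eval, eval₂Hom_bind₁]
    congr 2
    ext i
    simp [p, t, IsScalarTower.algebraMap_apply k (RatFunc k) K, RatFunc.algebraMap_eq_C]
  have hP0 : eval 0 P = 0 := by
    have hp0 (i) : p 0 i = 0 := by simp [p]
    have := hP 0
    simp only [Pi.zero_apply, map_zero, hp0] at this
    exact this.trans h0
  have hPW (a : σ × Fin (d + 1) → k) : eval (fun i ↦ algebraMap k K (a i)) P ∈ W := by
    rw [hP, eval_eq]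
    refine W.sum_mem fun m hm ↦ ?_
    have := hW ⟨m, hm⟩ (∏ i ∈ m.support, p a i ^ m i) ?_
    · rw [Algebra.smul_def, mul_comm, map_prod, map_prod] at this
      simp_rw [map_pow] at this
      exact this
    · refine (Polynomial.natDegree_prod_le _ _).trans ?_
      calc _ ≤ ∑ i ∈ m.support, m i * d := Finset.sum_le_sum fun i _ ↦
            Polynomial.natDegree_pow_le_of_le _ (hpdeg a i)
        _ = (∑ i ∈ m.support, m i) * d := by rw [Finset.sum_mul]
        _ ≤ n * d := Nat.mul_le_mul_right _ ((le_totalDegree hm).trans hG)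
  have hWcard : Module.finrank k W < Nat.card (σ × Fin (d + 1)) := by
    refine hWrank.trans_lt ?_
    rw [Nat.card_prod, Nat.card_fin]
    change e * n + 1 ≤ _ at hcard
    calc e * (n * d + c + 1) = e * n * d + d := by ring
      _ < (e * n + 1) * (d + 1) := by nlinarith
      _ ≤ _ := Nat.mul_le_mul_right _ hcard
  obtain ⟨a, ha, haP⟩ := exists_ne_zero_eval_eq_zero_of_mem P W hP0 hPW hWcard
  refine ⟨fun i ↦ algebraMap k[X] (RatFunc k) (p a i), fun h ↦ ha ?_, by rw [← hP, haP]⟩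
  ext ⟨i, j⟩
  have : p a i = 0 := by simpa using congrFun h i
  rw [← hpcoeff a, this]
  simp

end Tsen

section CentralDivisionAlgebra

open scoped TensorProduct

section TensorProductCentralSimple

variable {K L E ι : Type*} [Field K] [CommRing L] [Algebra K L] [Ring E] [Algebra K E]

lemma TensorProduct.equivFinsuppOfBasisLeft_one_tmul_mul [DecidableEq ι]
    (b : Module.Basis ι K L) (x : E) (z : L ⊗[K] E) (i : ι) :
    equivFinsuppOfBasisLeft b ((1 ⊗ₜ x) * z) i = x * equivFinsuppOfBasisLeft b z i := by
  induction z with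
  | zero => simp
  | add y z hy hz => simp [mul_add, hy, hz]
  | tmul l e => simp

lemma TensorProduct.equivFinsuppOfBasisLeft_mul_one_tmul [DecidableEq ι]
    (b : Module.Basis ι K L) (x : E) (z : L ⊗[K] E) (i : ι) :
    equivFinsuppOfBasisLeft b (z * (1 ⊗ₜ x)) i = equivFinsuppOfBasisLeft b z i * x := by
  induction z with
  | zero => simp
  | add y z hy hz => simp [add_mul, hy, hz]
  | tmul l e => simp

lemma Algebra.IsCentral.exists_eq_tmul_one [Algebra.IsCentral K E] {z : L ⊗[K] E}
    (hz : ∀ x : E, (1 ⊗ₜ x) * z = z * (1 ⊗ₜ x)) : ∃ l : L, z = l ⊗ₜ 1 := by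
  classical
  let b := Module.Basis.ofVectorSpace K L
  have hc (i) : ∃ c : K, TensorProduct.equivFinsuppOfBasisLeft b z i = algebraMap K E c := by
    rw [← Algebra.IsCentral.mem_center_iff, Subalgebra.mem_center_iff]
    intro x
    rw [← TensorProduct.equivFinsuppOfBasisLeft_one_tmul_mul, hz,
      TensorProduct.equivFinsuppOfBasisLeft_mul_one_tmul]
  choose c hc using hc
  let w := TensorProduct.equivFinsuppOfBasisLeft b z
  refine ⟨∑ i ∈ w.support, c i • b i, ?_⟩
  rw [← (TensorProduct.equivFinsuppOfBasisLeft b).symm_apply_apply z,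
    TensorProduct.equivFinsuppOfBasisLeft_symm_apply, TensorProduct.sum_tmul, Finsupp.sum]
  refine Finset.sum_congr rfl fun i _ ↦ ?_
  rw [hc, Algebra.algebraMap_eq_smul_one, TensorProduct.smul_tmul]

instance Algebra.IsCentral.tensorProduct_left [Algebra.IsCentral K E] :
    Algebra.IsCentral L (L ⊗[K] E) where
  out z hz := by
    obtain ⟨l, rfl⟩ := exists_eq_tmul_one fun x ↦ (Subalgebra.mem_center_iff.1 hz (1 ⊗ₜ x))
    exact Algebra.mem_bot.2 ⟨l, rfl⟩

end TensorProductCentralSimple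

/-- The base change of a central division algebra to a field extension is simple. -/
theorem IsSimpleRing.tensorProduct_of_isCentral {K L E : Type*} [Field K] [Field L] [Algebra K L]
    [DivisionRing E] [Algebra K E] [Algebra.IsCentral K E] : IsSimpleRing (L ⊗[K] E) := by
  classical
  let b := Module.Basis.ofVectorSpace K L
  let Φ := TensorProduct.equivFinsuppOfBasisLeft (N := E) b
  have hΦl (x : E) (z) (i) : Φ ((1 ⊗ₜ x) * z) i = x * Φ z i :=
    TensorProduct.equivFinsuppOfBasisLeft_one_tmul_mul b x z i
  have hΦr (x : E) (z) (i) : Φ (z * (1 ⊗ₜ x)) i = Φ z i * x :=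
    TensorProduct.equivFinsuppOfBasisLeft_mul_one_tmul b x z i
  refine of_eq_bot_or_eq_top fun J ↦ or_iff_not_imp_left.2 fun hJ ↦ ?_
  have hex : ∃ n, ∃ z ∈ J, z ≠ 0 ∧ (Φ z).support.card = n := by
    by_contra! h
    refine hJ (le_bot_iff.1 fun z hz ↦ ?_)
    rw [TwoSidedIdeal.mem_bot]
    by_contra h0
    exact h _ z hz h0 rfl
  obtain ⟨z, hzJ, hz0, hzn⟩ := Nat.find_spec hex
  have hmin (y) (hy : y ∈ J) (hlt : (Φ y).support.card < (Φ z).support.card) : y = 0 := by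
    by_contra h0
    exact Nat.find_min hex (hzn ▸ hlt) ⟨y, hy, h0, rfl⟩
  obtain ⟨i₀, hi₀⟩ : ∃ i, Φ z i ≠ 0 := by
    by_contra! h
    exact hz0 (Φ.map_eq_zero_iff.1 (Finsupp.ext h))
  let e := (Φ z i₀)⁻¹
  let w := (1 ⊗ₜ e) * z
  have hwJ : w ∈ J := J.mul_mem_left _ _ hzJ
  have hw1 : Φ w i₀ = 1 := by rw [hΦl, inv_mul_cancel₀ hi₀]
  have hcomm (x : E) : (1 ⊗ₜ x) * w = w * (1 ⊗ₜ x) := by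
    rw [← sub_eq_zero]
    refine hmin _ (J.sub_mem (J.mul_mem_left _ _ hwJ) (J.mul_mem_right _ _ hwJ))
      (Finset.card_lt_card (Finset.ssubset_iff_of_subset ?_ |>.2 ⟨i₀, ?_, ?_⟩))
    · intro i hi
      rw [Finsupp.mem_support_iff] at hi ⊢
      contrapose! hi
      simp [hΦl, hΦr, w, hi]
    · simpa using hi₀
    · simp [hΦl, hΦr, hw1]
  obtain ⟨l, hl⟩ := Algebra.IsCentral.exists_eq_tmul_one hcomm
  have hl0 : l ≠ 0 := by
    rintro rfl
    rw [hl] at hw1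
    simp at hw1
  refine top_le_iff.1 fun y _ ↦ ?_
  have : y = y * (l⁻¹ ⊗ₜ 1) * w := by
    rw [hl, mul_assoc, Algebra.TensorProduct.tmul_mul_tmul, inv_mul_cancel₀ hl0, one_mul,
      ← Algebra.TensorProduct.one_def, mul_one]
  rw [this]
  exact J.mul_mem_left _ _ hwJ

/-- A division algebra which is central and finite-dimensional over a separably closed field is
trivial. -/
theorem Algebra.IsCentral.algebraMap_bijective_of_isSepClosed {L E : Type*} [Field L]
    [IsSepClosed L] [DivisionRing E] [Algebra L E] [FiniteDimensional L E]
    [Algebra.IsCentral L E] : Function.Bijective (algebraMap L E) := by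
  refine ⟨(algebraMap L E).injective, ?_⟩
  by_contra hs
  have hne : (⊥ : Subalgebra L E) ≠ ⊤ := fun h ↦ hs fun x ↦
    Algebra.mem_bot.1 (h ▸ Algebra.mem_top : x ∈ (⊥ : Subalgebra L E))
  obtain ⟨x, hx, hsep⟩ := JacobsonNoether.exists_separable_and_not_isCentral' hne
  refine hx ?_
  have hirr : Irreducible (minpoly L x) := minpoly.irreducible hsep.isIntegral
  have hdeg := IsSepClosed.degree_eq_one_of_irreducible L hirr hsep
  exact Algebra.mem_bot.2 (minpoly.mem_range_of_degree_eq_one L x hdeg)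

lemma Algebra.IsCentral.of_matrix {K E n : Type*} [Field K] [Ring E] [Algebra K E] [Fintype n]
    [DecidableEq n] [Nonempty n] [Algebra.IsCentral K (Matrix n n E)] :
    Algebra.IsCentral K E where
  out z hz := by
    have h : Matrix.scalar n z ∈ Subalgebra.center K (Matrix n n E) := by
      rw [Matrix.subalgebraCenter_eq_scalarAlgHom_map]
      exact ⟨z, hz, rfl⟩
    obtain ⟨c, hc⟩ := Algebra.IsCentral.mem_center_iff K |>.1 h
    obtain ⟨i⟩ := ‹Nonempty n›
    refine Algebra.mem_bot.2 ⟨c, ?_⟩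
    simpa [Matrix.algebraMap_matrix_apply] using (congrFun (congrFun hc i) i).symm

/-- A separably closed field splits every finite-dimensional central division algebra. -/
theorem exists_tensorProduct_algEquiv_matrix_of_isSepClosed (K L E : Type*) [Field K] [Field L]
    [Algebra K L] [IsSepClosed L] [DivisionRing E] [Algebra K E] [FiniteDimensional K E]
    [Algebra.IsCentral K E] :
    ∃ (n : ℕ) (_ : NeZero n), Nonempty (L ⊗[K] E ≃ₐ[L] Matrix (Fin n) (Fin n) L) := by
  have : IsSimpleRing (L ⊗[K] E) := IsSimpleRing.tensorProduct_of_isCentral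
  have := IsArtinianRing.of_finite L (L ⊗[K] E)
  obtain ⟨n, hn, D, _, _, _, ⟨e⟩⟩ :=
    IsSimpleRing.exists_algEquiv_matrix_divisionRing_finite L (L ⊗[K] E)
  have : Algebra.IsCentral L (Matrix (Fin n) (Fin n) D) := Algebra.IsCentral.of_algEquiv L _ _ e
  have : Algebra.IsCentral L D := Algebra.IsCentral.of_matrix (n := Fin n)
  exact ⟨n, hn, ⟨e.trans (.mapMatrix (.symm (.ofBijective (Algebra.ofId L D)
    Algebra.IsCentral.algebraMap_bijective_of_isSepClosed)))⟩⟩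

/-- Algebra endomorphisms of a matrix algebra over a field preserve determinants. -/
lemma Matrix.det_map_algHom {L n : Type*} [Field L] [Fintype n] [DecidableEq n]
    (f : Matrix n n L →ₐ[L] Matrix n n L) (M : Matrix n n L) : (f M).det = M.det := by
  rcases isEmpty_or_nonempty n with _ | _
  · rw [det_isEmpty, det_isEmpty]
  have hinj : Function.Injective f := f.toRingHom.injective
  have hbij : Function.Bijective f :=
    ⟨hinj, LinearMap.injective_iff_surjective (f := f.toLinearMap) |>.1 hinj⟩
  let g : Module.End L (n → L) ≃ₐ[L] Module.End L (n → L) :=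
    (toLinAlgEquiv'.symm.trans (.ofBijective f hbij)).trans toLinAlgEquiv'
  obtain ⟨T, hT⟩ := g.eq_linearEquivConjAlgEquiv
  have h1 : toLin' (f M) = T.conj (toLin' M) := by
    have := DFunLike.congr_fun hT (toLin' M)
    rw [LinearEquiv.conjAlgEquiv_apply] at this
    rw [LinearEquiv.conj_apply, ← LinearMap.comp_assoc] at *
    rw [← this]
    change _ = toLin' (f (LinearMap.toMatrix' (toLin' M)))
    rw [LinearMap.toMatrix'_toLin']
  rw [← LinearMap.det_toLin', h1, LinearEquiv.conj_apply, LinearMap.comp_assoc,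
    LinearMap.det_conj, LinearMap.det_toLin']

open Algebra.TensorProduct in
/-- The reduced norm of an element of a central algebra lies in the base field. -/
lemma exists_algebraMap_eq_det {K L E n : Type*} [Field K] [Field L]
    [Algebra K L] [IsGalois K L] [Ring E] [Algebra K E] [Fintype n] [DecidableEq n]
    (φ : L ⊗[K] E ≃ₐ[L] Matrix n n L) (x : E) :
    ∃ y : K, algebraMap K L y = (φ (1 ⊗ₜ x)).det := by
  rw [← Set.mem_range, InfiniteGalois.mem_range_algebraMap_iff_fixed]
  intro σ
  let f : E →ₐ[K] Matrix n n L :=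
    (σ : L →ₐ[K] L).mapMatrix.comp ((φ.toAlgHom.restrictScalars K).comp includeRight)
  have hf (l : L) (y : E) : Commute (Algebra.ofId L (Matrix n n L) l) (f y) :=
    Algebra.commutes l _
  let ψ : L ⊗[K] E →ₐ[L] Matrix n n L := lift (Algebra.ofId L _) f hf
  have h := Matrix.det_map_algHom (ψ.comp φ.symm.toAlgHom) (φ (1 ⊗ₜ x))
  have h2 : (ψ.comp φ.symm.toAlgHom) (φ (1 ⊗ₜ x)) = (φ (1 ⊗ₜ x)).map σ := by
    simp only [ψ, AlgHom.comp_apply]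
    have h3 : φ.symm.toAlgHom (φ (1 ⊗ₜ x)) = 1 ⊗ₜ x := φ.symm_apply_apply _
    rw [h3, lift_tmul, map_one, one_mul]
    rfl
  rw [h2] at h
  exact (AlgEquiv.map_det σ _).trans h

open Algebra.TensorProduct MvPolynomial in
/-- The reduced norm of a central division algebra `E`, in the coordinates of a finite family `b` of
elements of `E`: a polynomial of degree at most `n`, where `n ^ 2` is the dimension of `E`, without
nontrivial zeros outside the linear relations of `b`. -/
theorem exists_finrank_eq_mul_self_and_forall_exists_mvPolynomial (K E : Type*) [Field K]
    [DivisionRing E] [Algebra K E] [FiniteDimensional K E] [Algebra.IsCentral K E] :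
    ∃ n : ℕ, 0 < n ∧ Module.finrank K E = n * n ∧ ∀ {σ : Type*} [Fintype σ] (b : σ → E),
      ∃ G : MvPolynomial σ K, G.totalDegree ≤ n ∧ eval 0 G = 0 ∧
        ∀ q : σ → K, eval q G = 0 → ∑ i, q i • b i = 0 := by
  let L := SeparableClosure K
  obtain ⟨n, hn, ⟨φ⟩⟩ := exists_tensorProduct_algEquiv_matrix_of_isSepClosed K L E
  refine ⟨n, NeZero.pos n, ?_, fun {σ} _ b ↦ ?_⟩
  · rw [← Module.finrank_baseChange (R := L), φ.toLinearEquiv.finrank_eq, Module.finrank_matrix]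
    simp
  · let M : Matrix (Fin n) (Fin n) (MvPolynomial σ L) :=
      .of fun r c ↦ ∑ i, C (φ (1 ⊗ₜ b i) r c) * X i
    have hM (q : σ → K) : eval (fun i ↦ algebraMap K L (q i)) M.det =
        (φ (1 ⊗ₜ ∑ i, q i • b i)).det := by
      rw [RingHom.map_det]
      congr 1
      ext r c
      simp_rw [TensorProduct.tmul_sum, map_sum, TensorProduct.tmul_smul,
        ← algebraMap_smul L (q _), map_smul]
      simp [M, Matrix.sum_apply, mul_comm]
      simp_rw [Algebra.smul_def]
    have hMdeg : M.det.totalDegree ≤ n := by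
      rw [Matrix.det_apply]
      refine totalDegree_finsetSum_le fun s _ ↦ ?_
      refine (totalDegree_smul_le _ _).trans ((totalDegree_finsetProd _ _).trans ?_)
      refine (Finset.sum_le_card_nsmul _ _ 1 fun r _ ↦ ?_).trans (by simp)
      refine totalDegree_finsetSum_le fun i _ ↦ (totalDegree_mul _ _).trans ?_
      simp
    obtain ⟨l, hl⟩ := (Algebra.linearMap K L).exists_leftInverse_of_injective
      (LinearMap.ker_eq_bot.2 (algebraMap K L).injective)
    obtain ⟨G, hG, hGe⟩ := exists_eval_eq_linearMap_eval l M.det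
    refine ⟨G, hG.trans hMdeg, ?_, fun q hq ↦ ?_⟩
    · rw [hGe, hM]
      simp [Matrix.det_zero]
    · rw [hGe, hM] at hq
      obtain ⟨y, hy⟩ := exists_algebraMap_eq_det φ (∑ i, q i • b i)
      have hy0 : y = 0 := by
        rw [← hy] at hq
        exact (LinearMap.congr_fun hl y).symm.trans hq
      by_contra h0
      have hu : IsUnit (φ (1 ⊗ₜ ∑ i, q i • b i)) :=
        ((isUnit_iff_ne_zero.2 h0).map (includeRight : E →ₐ[K] L ⊗[K] E)).map φ
      rw [Matrix.isUnit_iff_isUnit_det, ← hy, hy0, map_zero] at hu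
      exact not_isUnit_zero hu

/-- Central division algebras over the function field of a curve over an algebraically closed field
are trivial. -/
theorem Algebra.IsCentral.algebraMap_bijective_of_ratFunc (k : Type*) {K E : Type*} [Field k]
    [IsAlgClosed k] [Field K] [Algebra (RatFunc k) K] [FiniteDimensional (RatFunc k) K]
    [DivisionRing E] [Algebra K E] [FiniteDimensional K E] [Algebra.IsCentral K E] :
    Function.Bijective (algebraMap K E) := by
  obtain ⟨n, hn, hfin, hG⟩ := exists_finrank_eq_mul_self_and_forall_exists_mvPolynomial K E
  let u := Module.finBasis (RatFunc k) K
  let v := Module.finBasis K E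
  obtain ⟨G, hGdeg, hG0, hGz⟩ := hG fun a : Fin (Module.finrank (RatFunc k) K) ×
    Fin (Module.finrank K E) ↦ u a.1 • v a.2
  have hn1 : n = 1 := by
    by_contra h1
    obtain ⟨q, hq, hqG⟩ := MvPolynomial.exists_ne_zero_eval_eq_zero_of_ratFunc G hGdeg hG0 (by
      rw [Nat.card_prod, Nat.card_fin, Nat.card_fin, hfin]
      have : 0 < Module.finrank (RatFunc k) K := Module.finrank_pos
      exact Nat.mul_lt_mul_of_pos_left (by nlinarith [show 2 ≤ n by omega]) this)
    have h := hGz _ hqG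
    rw [Fintype.sum_prod_type_right] at h
    simp_rw [smul_smul, ← Finset.sum_smul, ← Algebra.smul_def] at h
    refine hq (funext fun ⟨i, j⟩ ↦ ?_)
    exact Fintype.linearIndependent_iff.1 u.linearIndependent _
      (Fintype.linearIndependent_iff.1 v.linearIndependent _ h j) i
  rw [hn1, mul_one] at hfin
  exact Algebra.finrank_eq_one_iff_bijective_algebraMap.1 hfin

end CentralDivisionAlgebra

/-- Let `K` be the function field of an algebraic curve over an algebraically
closed field `k` (i.e. a finite field extension of the rational function field `k(t)`).
Then every finite-dimensional central simple `K`-algebra is isomorphic to a matrix algebra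
`Mat_t(K)` for some `t ≥ 1` (the Brauer group of `K` is trivial). -/
theorem statement2 {k : Type*} [Field k] [IsAlgClosed k]
    (K : Type*) [Field K] [Algebra (RatFunc k) K] [FiniteDimensional (RatFunc k) K]
    (D : Type*) [Ring D] [Algebra K D] [FiniteDimensional K D]
    [IsSimpleRing D] [Algebra.IsCentral K D] :
    ∃ t : ℕ, 0 < t ∧ Nonempty (D ≃ₐ[K] Matrix (Fin t) (Fin t) K) := by
  have := IsArtinianRing.of_finite K D
  obtain ⟨n, hn, E, _, _, _, ⟨e⟩⟩ := IsSimpleRing.exists_algEquiv_matrix_divisionRing_finite K D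
  have : Algebra.IsCentral K (Matrix (Fin n) (Fin n) E) := Algebra.IsCentral.of_algEquiv K _ _ e
  have : Algebra.IsCentral K E := Algebra.IsCentral.of_matrix (n := Fin n)
  exact ⟨n, NeZero.pos n, ⟨e.trans (.mapMatrix (.symm (.ofBijective (Algebra.ofId K E)
    (Algebra.IsCentral.algebraMap_bijective_of_ratFunc k))))⟩⟩
end

section
/- Let k be an algebraically closed field, R = k⟦w⟧ the formal power series ring, and K = k((w)) its field of fractions. Let H ⊆ Mat_p(K) be an R-order in the matrix algebra Mat_p(K) (an R-subalgebra finitely generated as an R-module whose K-linear span is all of Mat_p(K)) which is left hereditary (every left ideal of H is projective as a left H-module). Then there exist a tuple p⃗ = (p₁,…,p_r) of positive integers with p₁+⋯+p_r = p and an invertible matrix S ∈ GL_p(K) such that H = S · H(R, p⃗) · S⁻¹. Moreover p⃗ is unique up to cyclic permutation: if also H = S′ · H(R, q⃗) · S′⁻¹ for some S′ ∈ GL_p(K) and tuple q⃗ of positive integers summing to p, then q⃗ is obtained from p⃗ by a cyclic permutation. -/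
set_option synthInstance.maxHeartbeats 1000000
set_option maxHeartbeats 1000000

/-- The block-index function `β : {1,…,p} → {1,…,r}` associated to a tuple
`p⃗ = (p₁,…,p_r)`: `β i = j` iff `p₁ + ⋯ + p_{j-1} ≤ i < p₁ + ⋯ + p_j` (0-indexed). -/
def IsBlockIndex {r p : ℕ} (pvec : Fin r → ℕ) (β : Fin p → Fin r) : Prop :=
  ∀ i : Fin p,
    (∑ kk ∈ Finset.Iio (β i), pvec kk) ≤ (i : ℕ) ∧
      (i : ℕ) < ∑ kk ∈ Finset.Iic (β i), pvec kk

/-- The standard order `H(R, p⃗) ⊆ Mat_p(K)`: matrices all of whose entries lie in the image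
of `R` in `K`, and whose entry `M i j` lies in the image of the ideal `m` whenever
`β i < β j`. -/
def stdOrderSet (R K : Type*) [CommRing R] [CommRing K] [Algebra R K]
    (m : Ideal R) {p r : ℕ} (β : Fin p → Fin r) : Set (Matrix (Fin p) (Fin p) K) :=
  {M | ∀ i j : Fin p,
    M i j ∈ Set.range (algebraMap R K) ∧
      (β i < β j → M i j ∈ (algebraMap R K) '' (m : Set R))}


section DVR

variable {R K : Type*} [CommRing R] [IsDomain R] [IsDiscreteValuationRing R] [Field K]
  [Algebra R K] [IsFractionRing R K] {ϖ : R}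

/-- The fractional ideal `ϖ ^ n R` of the fraction field `K`. -/
def fracPow (K : Type*) {R : Type*} [CommRing R] [Field K] [Algebra R K] (ϖ : R) (n : ℤ) :
    Submodule R K :=
  Submodule.span R {(algebraMap R K ϖ) ^ n}

omit [IsDomain R] [IsDiscreteValuationRing R] [IsFractionRing R K] in
theorem mem_fracPow {n : ℤ} {c : K} :
    c ∈ fracPow K ϖ n ↔ ∃ a : R, algebraMap R K a * (algebraMap R K ϖ) ^ n = c := by
  simp only [fracPow, Submodule.mem_span_singleton, Algebra.smul_def]

omit [IsDomain R] [IsDiscreteValuationRing R] [IsFractionRing R K] in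
theorem mem_fracPow_zero {c : K} :
    c ∈ fracPow K ϖ 0 ↔ c ∈ Set.range (algebraMap R K) := by
  simp [mem_fracPow]

omit [IsDomain R] [IsDiscreteValuationRing R] in
theorem algebraMap_irreducible_ne_zero (hϖ : Irreducible ϖ) : algebraMap R K ϖ ≠ 0 := by
  simpa using hϖ.ne_zero

omit [IsFractionRing R K] in
theorem fracPow_one (hϖ : Irreducible ϖ) {c : K} :
    c ∈ fracPow K ϖ 1 ↔ c ∈ algebraMap R K '' (IsLocalRing.maximalIdeal R : Set R) := by
  rw [mem_fracPow, hϖ.maximalIdeal_eq]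
  constructor
  · rintro ⟨a, rfl⟩
    exact ⟨a * ϖ, Ideal.mem_span_singleton'.2 ⟨a, rfl⟩, by simp⟩
  · rintro ⟨b, hb, rfl⟩
    obtain ⟨a, rfl⟩ := Ideal.mem_span_singleton'.1 hb
    exact ⟨a, by simp⟩

omit [IsDomain R] [IsDiscreteValuationRing R] in
theorem mul_mem_fracPow (hϖ : Irreducible ϖ) {m n : ℤ} {a b : K} (ha : a ∈ fracPow K ϖ m)
    (hb : b ∈ fracPow K ϖ n) : a * b ∈ fracPow K ϖ (m + n) := by
  obtain ⟨x, rfl⟩ := mem_fracPow.1 ha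
  obtain ⟨y, rfl⟩ := mem_fracPow.1 hb
  refine mem_fracPow.2 ⟨x * y, ?_⟩
  rw [map_mul, zpow_add₀ (algebraMap_irreducible_ne_zero hϖ)]
  ring

omit [IsDiscreteValuationRing R] in
theorem zpow_mem_fracPow (hϖ : Irreducible ϖ) {m n : ℤ} :
    (algebraMap R K ϖ) ^ m ∈ fracPow K ϖ n ↔ n ≤ m := by
  have h0 : algebraMap R K ϖ ≠ 0 := algebraMap_irreducible_ne_zero hϖ
  rw [mem_fracPow]
  constructor
  · rintro ⟨a, ha⟩
    by_contra! hlt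
    obtain ⟨d, rfl⟩ : ∃ d : ℕ, n = m + (d + 1) := ⟨(n - m - 1).toNat, by omega⟩
    rw [zpow_add₀ h0, mul_left_comm, mul_eq_left₀ (zpow_ne_zero _ h0)] at ha
    have h1 : a * ϖ ^ (d + 1) = 1 := by
      apply IsFractionRing.injective R K
      rw [map_mul, map_pow, map_one, ← ha]
      norm_cast
    exact hϖ.not_isUnit (isUnit_of_dvd_one ⟨a * ϖ ^ d, by rw [← h1]; ring⟩)
  · intro h
    obtain ⟨d, rfl⟩ := Int.le.dest h
    exact ⟨ϖ ^ d, by rw [zpow_add₀ h0, map_pow, zpow_natCast, mul_comm]⟩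

omit [IsDiscreteValuationRing R] in
theorem fracPow_antitone (hϖ : Irreducible ϖ) {m n : ℤ} (h : m ≤ n) :
    fracPow K ϖ n ≤ fracPow K ϖ m :=
  (Submodule.span_singleton_le_iff_mem _ _).2 ((zpow_mem_fracPow hϖ).2 h)

theorem exists_eq_unit_mul_zpow (hϖ : Irreducible ϖ) {c : K} (hc : c ≠ 0) :
    ∃ (n : ℤ) (u : Rˣ), c = algebraMap R K u * (algebraMap R K ϖ) ^ n := by
  obtain ⟨n, u, h⟩ := IsDiscreteValuationRing.exists_units_eq_smul_zpow_of_irreducible hϖ hc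
  exact ⟨n, u, by rw [h, Units.smul_def, Algebra.smul_def]⟩

omit [IsDomain R] [IsDiscreteValuationRing R] [IsFractionRing R K] in
theorem unit_mul_mem_iff {M : Type*} [AddCommGroup M] [Module R M] [Module K M]
    [IsScalarTower R K M] (L : Submodule R M) (u : Rˣ) (c : K) (x : M) :
    (algebraMap R K u * c) • x ∈ L ↔ c • x ∈ L := by
  rw [mul_smul, algebraMap_smul]
  exact L.smul_mem_iff_of_isUnit u.isUnit

theorem exists_div_mem_range {ι : Type*} (s : Finset ι) (f : ι → K)
    (h : ∑ i ∈ s, f i ≠ 0) :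
    ∃ i ∈ s, f i ≠ 0 ∧ (∑ i ∈ s, f i) / f i ∈ Set.range (algebraMap R K) := by
  by_contra! hcon
  set d := ∑ i ∈ s, f i with hd
  have key : ∀ i ∈ s, ∃ a ∈ IsLocalRing.maximalIdeal R, algebraMap R K a = f i / d := by
    intro i hi
    by_cases hfi : f i = 0
    · exact ⟨0, zero_mem _, by simp [hfi]⟩
    have hn := hcon i hi hfi
    rcases ValuationRing.isInteger_or_isInteger R (f i / d) with ⟨a, ha⟩ | ⟨a, ha⟩
    · refine ⟨a, fun hu => hn ?_, ha⟩
      obtain ⟨u, rfl⟩ := hu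
      refine ⟨(u⁻¹ : Rˣ), ?_⟩
      rw [← inv_div, ← ha]
      refine eq_inv_of_mul_eq_one_left ?_
      rw [← map_mul, Units.inv_mul, map_one]
    · exact absurd ⟨a, by rw [ha, inv_div]⟩ hn
  choose! a ham ha using key
  have h1 : ∑ i ∈ s, a i = 1 := by
    apply IsFractionRing.injective R K
    rw [map_sum, map_one, Finset.sum_congr rfl ha, ← Finset.sum_div, ← hd, div_self h]
  have : (1 : R) ∈ IsLocalRing.maximalIdeal R := h1 ▸ Ideal.sum_mem _ ham
  exact (Ideal.ne_top_iff_one _).1 (IsLocalRing.maximalIdeal.isMaximal R).ne_top this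

end DVR

section Monomial

variable {R K : Type*} [CommRing R] [Field K] {ι : Type*} [Fintype ι] [DecidableEq ι]

/-- The monomial matrix with entry `g j` at position `(τ j, j)`. -/
def monomialMatrix (g : ι → K) (τ : Equiv.Perm ι) : Matrix ι ι K :=
  Matrix.of fun i j => if i = τ j then g j else 0

theorem monomialMatrix_inv_mul (g : ι → K) (hg : ∀ i, g i ≠ 0) (τ : Equiv.Perm ι) :
    (Matrix.of fun i j => if j = τ i then (g i)⁻¹ else 0) * monomialMatrix g τ = 1 := by
  ext i j
  by_cases h : i = j
  · subst h
    simp [monomialMatrix, Matrix.mul_apply, hg]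
  · simp [monomialMatrix, Matrix.mul_apply, h, Ne.symm h]

/-- The monomial matrix with nonzero coefficients `g`, as an invertible matrix. -/
def monomialUnit (g : ι → K) (hg : ∀ i, g i ≠ 0) (τ : Equiv.Perm ι) : (Matrix ι ι K)ˣ where
  val := monomialMatrix g τ
  inv := Matrix.of fun i j => if j = τ i then (g i)⁻¹ else 0
  val_inv := mul_eq_one_comm.1 (monomialMatrix_inv_mul g hg τ)
  inv_val := monomialMatrix_inv_mul g hg τ

theorem monomialUnit_conj_apply (g : ι → K) (hg : ∀ i, g i ≠ 0) (τ : Equiv.Perm ι)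
    (M : Matrix ι ι K) (i j : ι) :
    ((monomialUnit g hg τ : Matrix ι ι K) * M * ((monomialUnit g hg τ)⁻¹ : (Matrix ι ι K)ˣ))
      (τ i) (τ j) = g i * M i j * (g j)⁻¹ := by
  simp [monomialUnit, monomialMatrix, Matrix.mul_apply]

theorem det_monomialMatrix (g : ι → K) (τ : Equiv.Perm ι) :
    (monomialMatrix g τ).det = ((Equiv.Perm.sign τ : ℤ) : K) * ∏ i, g i := by
  have : monomialMatrix g τ = Matrix.submatrix (Matrix.diagonal g) (τ⁻¹ : Equiv.Perm ι) id := by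
    ext i j
    simp [monomialMatrix, Matrix.diagonal_apply]
    split_ifs with h1 h2 h2 <;> simp_all [Equiv.symm_apply_eq]
  rw [this, Matrix.det_permute, Matrix.det_diagonal, Equiv.Perm.sign_inv]

theorem exists_mul_aeval_eq_one (M : Matrix ι ι R) (hM : IsUnit M.det) :
    ∃ q : Polynomial R, M * Polynomial.aeval M q = 1 := by
  have hc : IsUnit (M.charpoly.coeff 0) := by
    rw [Matrix.det_eq_sign_charpoly_coeff] at hM
    exact isUnit_of_mul_isUnit_right hM
  obtain ⟨u, hu⟩ := hc
  refine ⟨Polynomial.C (-(u⁻¹ : Rˣ) : R) * M.charpoly.divX, ?_⟩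
  have h := M.aeval_self_charpoly
  rw [← Polynomial.divX_mul_X_add M.charpoly, ← hu, mul_comm _ Polynomial.X] at h
  simp only [map_add, map_mul, Polynomial.aeval_X, Polynomial.aeval_C] at h
  have h2 : M * Polynomial.aeval M M.charpoly.divX = -(algebraMap R _ (u : R)) := by
    rw [eq_neg_iff_add_eq_zero, ← h]
  rw [map_mul, Polynomial.aeval_C, Algebra.left_comm, h2, mul_neg, ← map_mul, ← map_neg]
  simp

theorem inv_mem_of_det [Algebra R K] (A : Subalgebra R (Matrix ι ι K))
    (h : (Matrix ι ι K)ˣ) (hA : (h : Matrix ι ι K) ∈ A)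
    (hint : ∀ i j, (h : Matrix ι ι K) i j ∈ Set.range (algebraMap R K))
    (hinj : Function.Injective (algebraMap R K))
    (hdet : (h : Matrix ι ι K).det⁻¹ ∈ Set.range (algebraMap R K)) :
    ((h⁻¹ : (Matrix ι ι K)ˣ) : Matrix ι ι K) ∈ A := by
  choose M hM using hint
  have hM' : (algebraMap R K).mapMatrix (Matrix.of M) = h := by
    ext i j
    simp [hM]
  have hu : IsUnit (Matrix.of M).det := by
    obtain ⟨e, he⟩ := hdet
    refine IsUnit.of_mul_eq_one e (hinj ?_)
    rw [map_mul, RingHom.map_det, hM', he, map_one, mul_inv_cancel₀]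
    exact ((Matrix.isUnit_iff_isUnit_det _).1 h.isUnit).ne_zero
  obtain ⟨q, hq⟩ := exists_mul_aeval_eq_one _ hu
  have hq' : (h : Matrix ι ι K) * Polynomial.aeval (h : Matrix ι ι K) q = 1 := by
    let φ : Matrix ι ι R →ₐ[R] Matrix ι ι K := (Algebra.ofId R K).mapMatrix
    have hφ : φ (Matrix.of M) = h := hM'
    rw [← hφ, Polynomial.aeval_algHom_apply, ← map_mul, hq, map_one]
  rw [Units.inv_eq_of_mul_eq_one_right hq']
  exact Algebra.adjoin_le (Set.singleton_subset_iff.2 hA)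
    (Polynomial.aeval_mem_adjoin_singleton _ _)

end Monomial

section Order

variable {R K : Type*} [CommRing R] [IsDomain R] [IsDiscreteValuationRing R] [Field K]
  [Algebra R K] [IsFractionRing R K] {ϖ : R} {ι : Type*}

/-- The matrices whose `(i, j)` entry lies in `ϖ ^ m i j R`. -/
def exponentSet (K : Type*) {R : Type*} [CommRing R] [Field K] [Algebra R K] {ι : Type*} (ϖ : R)
    (m : ι → ι → ℤ) : Set (Matrix ι ι K) :=
  {M | ∀ i j, M i j ∈ fracPow K ϖ (m i j)}

omit [IsFractionRing R K] in
theorem stdOrderSet_eq_exponentSet (hϖ : Irreducible ϖ) {p r : ℕ} (β : Fin p → Fin r) :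
    stdOrderSet R K (IsLocalRing.maximalIdeal R) β =
      exponentSet K ϖ fun i j => if β i < β j then 1 else 0 := by
  ext M
  refine forall₂_congr fun i j => ?_
  by_cases h : β i < β j
  · simp only [h, forall_const, if_true, fracPow_one hϖ]
    exact ⟨fun h => h.2, fun h => ⟨Set.image_subset_range _ _ h, h⟩⟩
  · simp only [h, false_imp_iff, and_true, if_false, mem_fracPow_zero]

/-- The matrices whose `(i, j)` entry lies in `ϖ ^ m i j R`, as a subalgebra, for `m` vanishing
on the diagonal and satisfying the triangle inequality. -/
def exponentSubalgebra (K : Type*) {R : Type*} [CommRing R] [IsDomain R] [Field K] [Algebra R K]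
    [IsFractionRing R K] [Fintype ι] [DecidableEq ι] {ϖ : R} (hϖ : Irreducible ϖ)
    {m : ι → ι → ℤ} (h0 : ∀ i, m i i = 0) (htri : ∀ i j l, m i l ≤ m i j + m j l) :
    Subalgebra R (Matrix ι ι K) where
  carrier := exponentSet K ϖ m
  add_mem' ha hb i j := add_mem (ha i j) (hb i j)
  mul_mem' {a b} ha hb i l := by
    rw [Matrix.mul_apply]
    exact sum_mem fun j _ =>
      fracPow_antitone hϖ (htri i j l) (mul_mem_fracPow hϖ (ha i j) (hb j l))
  algebraMap_mem' c i j := by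
    by_cases h : i = j
    · subst h
      rw [h0, mem_fracPow_zero]
      exact ⟨c, by simp [Matrix.algebraMap_matrix_apply]⟩
    · simp [Matrix.algebraMap_matrix_apply, h]

theorem exists_perm_of_conj [Fintype ι] [DecidableEq ι] (hϖ : Irreducible ϖ) {m m' : ι → ι → ℤ}
    (h0 : ∀ i, m i i = 0) (htri : ∀ i j l, m i l ≤ m i j + m j l) (hnonneg : ∀ i j, 0 ≤ m i j)
    (h0' : ∀ i, m' i i = 0) (u : (Matrix ι ι K)ˣ)
    (hu : ∀ M, M ∈ exponentSet K ϖ m' ↔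
      (u : Matrix ι ι K) * M * (u⁻¹ : (Matrix ι ι K)ˣ) ∈ exponentSet K ϖ m) :
    ∃ (τ : Equiv.Perm ι) (x : ι → ℤ), ∀ i j, m (τ i) (τ j) = m' i j + x i - x j := by
  have hw : algebraMap R K ϖ ≠ 0 := algebraMap_irreducible_ne_zero hϖ
  let A := exponentSubalgebra K hϖ h0 htri
  have hA : ∀ M, M ∈ A ↔ M ∈ exponentSet K ϖ m := fun M => Iff.rfl
  have hsingle : ∀ (n : ι → ι → ℤ) (i j : ι) (c : K),
      Matrix.single i j c ∈ exponentSet K ϖ n ↔ c ∈ fracPow K ϖ (n i j) := by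
    intro n i j c
    constructor
    · intro h
      simpa using h i j
    · intro h a b
      rw [Matrix.single_apply]
      split_ifs with hab
      · rwa [← hab.1, ← hab.2]
      · exact zero_mem _
  have hdetu : (u : Matrix ι ι K).det ≠ 0 :=
    ((Matrix.isUnit_iff_isUnit_det _).1 u.isUnit).ne_zero
  obtain ⟨τ, -, hτ, hdiv⟩ := exists_div_mem_range (R := R) Finset.univ
    (fun σ : Equiv.Perm ι => ((Equiv.Perm.sign σ : ℤ) : K) * ∏ i, (u : Matrix ι ι K) (σ i) i)
    (by rwa [← Matrix.det_apply'])
  rw [← Matrix.det_apply'] at hdiv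
  have hg : ∀ j, (u : Matrix ι ι K) (τ j) j ≠ 0 := fun j =>
    Finset.prod_ne_zero_iff.1 (right_ne_zero_of_mul hτ) j (Finset.mem_univ j)
  set g : ι → K := fun j => (u : Matrix ι ι K) (τ j) j with hgdef
  let X := monomialUnit g hg τ
  have hX : (X : Matrix ι ι K) = ∑ j, Matrix.single (τ j) (τ j) (1 : K) *
      ((u : Matrix ι ι K) * Matrix.single j j 1) := by
    ext a b
    rw [Matrix.sum_apply, Finset.sum_eq_single b]
    · by_cases hab : a = τ b
      · subst hab
        simp [X, monomialUnit, monomialMatrix, hgdef]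
      · simp [X, monomialUnit, monomialMatrix, hab, Matrix.single_mul_apply_of_ne]
    · intro j _ hj
      rw [← mul_assoc]
      exact Matrix.mul_single_apply_of_ne _ _ _ _ _ hj.symm _
    · simp
  have hXu : ((X * u⁻¹ : (Matrix ι ι K)ˣ) : Matrix ι ι K) ∈ A := by
    rw [Units.val_mul, hX, Finset.sum_mul]
    refine sum_mem fun j _ => ?_
    rw [mul_assoc]
    refine mul_mem ((hsingle _ _ _ _).2 ?_) ((hu _).1 ((hsingle _ _ _ _).2 ?_))
    · rw [h0, mem_fracPow_zero]
      exact ⟨1, map_one _⟩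
    · rw [h0', mem_fracPow_zero]
      exact ⟨1, map_one _⟩
  have hXu' : (((X * u⁻¹)⁻¹ : (Matrix ι ι K)ˣ) : Matrix ι ι K) ∈ A := by
    refine inv_mem_of_det A _ hXu (fun i j => ?_) (IsFractionRing.injective R K) ?_
    · rw [← mem_fracPow_zero (ϖ := ϖ)]
      exact fracPow_antitone hϖ (hnonneg i j) (hXu i j)
    · rw [Units.val_mul, Matrix.det_mul]
      have h1 : (X : Matrix ι ι K).det = _ := det_monomialMatrix g τ
      have h2 : ((u⁻¹ : (Matrix ι ι K)ˣ) : Matrix ι ι K).det = (u : Matrix ι ι K).det⁻¹ := by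
        refine eq_inv_of_mul_eq_one_left ?_
        rw [← Matrix.det_mul, Units.inv_mul, Matrix.det_one]
      rwa [h1, h2, ← div_eq_mul_inv, inv_div]
  have hXM : ∀ M, M ∈ exponentSet K ϖ m' ↔
      (X : Matrix ι ι K) * M * (X⁻¹ : (Matrix ι ι K)ˣ) ∈ exponentSet K ϖ m := by
    intro M
    rw [hu]
    constructor
    · intro h
      have := mul_mem (mul_mem hXu ((hA _).2 h)) hXu'
      rw [hA] at this
      convert this using 1
      simp [mul_assoc]
    · intro h
      have := mul_mem (mul_mem hXu' ((hA _).2 h)) hXu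
      rw [hA] at this
      convert this using 1
      simp [mul_assoc]
  obtain ⟨x, v, hx⟩ : ∃ (x : ι → ℤ) (v : ι → Rˣ),
      ∀ j, g j = algebraMap R K (v j) * (algebraMap R K ϖ) ^ x j := by
    choose x v hx using fun j => exists_eq_unit_mul_zpow hϖ (hg j)
    exact ⟨x, v, hx⟩
  refine ⟨τ, x, fun i j => ?_⟩
  have key : ∀ n : ℤ, m' i j ≤ n ↔ m (τ i) (τ j) ≤ x i + n - x j := by
    intro n
    have hconj : (X : Matrix ι ι K) * Matrix.single i j ((algebraMap R K ϖ) ^ n) *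
        (X⁻¹ : (Matrix ι ι K)ˣ) = Matrix.single (τ i) (τ j)
          (g i * (algebraMap R K ϖ) ^ n * (g j)⁻¹) := by
      ext a b
      obtain ⟨a, rfl⟩ := τ.surjective a
      obtain ⟨b, rfl⟩ := τ.surjective b
      rw [monomialUnit_conj_apply]
      simp only [Matrix.single_apply, EmbeddingLike.apply_eq_iff_eq]
      split_ifs with h
      · rw [h.1, h.2]
      · simp
    have hval : g i * (algebraMap R K ϖ) ^ n * (g j)⁻¹ =
        algebraMap R K (v i * (v j)⁻¹ : Rˣ) * (algebraMap R K ϖ) ^ (x i + n - x j) := by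
      have hvj : algebraMap R K (v j) ≠ 0 := by simp
      have hvj' : algebraMap R K ((v j)⁻¹ : Rˣ) = (algebraMap R K (v j))⁻¹ := by
        refine eq_inv_of_mul_eq_one_left ?_
        rw [← map_mul, Units.inv_mul, map_one]
      rw [hx i, hx j, Units.val_mul, map_mul, hvj', zpow_sub₀ hw, zpow_add₀ hw]
      field_simp
    rw [← zpow_mem_fracPow (K := K) hϖ, ← hsingle m', hXM, hconj, hsingle, hval,
      ← zpow_mem_fracPow (K := K) hϖ]
    simpa using unit_mul_mem_iff (fracPow K ϖ (m (τ i) (τ j))) (v i * (v j)⁻¹)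
      ((algebraMap R K ϖ) ^ (x i + n - x j)) (1 : K)
  have h1 := (key (m' i j)).1 le_rfl
  have h2 := (key (m (τ i) (τ j) - x i + x j)).2 (by omega)
  omega

end Order

section BlockIndex

theorem IsBlockIndex.card_fiber {p r : ℕ} {pvec : Fin r → ℕ} {β : Fin p → Fin r}
    (hβ : IsBlockIndex pvec β) (hsum : ∑ j, pvec j = p) (a : Fin r) :
    (Finset.univ.filter fun i => β i = a).card = pvec a := by
  have hIic : ∀ b : Fin r, ∑ l ∈ Finset.Iic b, pvec l = ∑ l ∈ Finset.Iio b, pvec l + pvec b := by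
    intro b
    rw [← Finset.Iio_insert, Finset.sum_insert (by simp), add_comm]
  have hle : ∀ b c : Fin r, b < c → ∑ l ∈ Finset.Iic b, pvec l ≤ ∑ l ∈ Finset.Iio c, pvec l :=
    fun b c hbc => Finset.sum_le_sum_of_subset fun x hx =>
      Finset.mem_Iio.2 ((Finset.mem_Iic.1 hx).trans_lt hbc)
  have htop : ∑ l ∈ Finset.Iic a, pvec l ≤ p := by
    rw [← hsum]
    exact Finset.sum_le_sum_of_subset (Finset.subset_univ _)
  have hiff : ∀ i : Fin p, β i = a ↔
      (i : ℕ) ∈ Finset.Ico (∑ l ∈ Finset.Iio a, pvec l) (∑ l ∈ Finset.Iic a, pvec l) := by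
    intro i
    rw [Finset.mem_Ico]
    constructor
    · rintro rfl
      exact hβ i
    · rintro ⟨h1, h2⟩
      obtain ⟨h3, h4⟩ := hβ i
      rcases lt_trichotomy (β i) a with h | h | h
      · have := hle _ _ h
        omega
      · exact h
      · have := hle _ _ h
        omega
  have hmap : (Finset.univ.filter fun i => β i = a).map Fin.valEmbedding =
      Finset.Ico (∑ l ∈ Finset.Iio a, pvec l) (∑ l ∈ Finset.Iic a, pvec l) := by
    ext n
    simp only [Finset.mem_map, Finset.mem_filter, Finset.mem_univ, true_and, hiff,
      Fin.valEmbedding_apply]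
    constructor
    · rintro ⟨i, hi, rfl⟩
      exact hi
    · intro hn
      exact ⟨⟨n, (Finset.mem_Ico.1 hn).2.trans_le htop⟩, hn, rfl⟩
  rw [← Finset.card_map, hmap, Nat.card_Ico, hIic]
  omega

theorem IsBlockIndex.surjective {p r : ℕ} {pvec : Fin r → ℕ} {β : Fin p → Fin r}
    (hβ : IsBlockIndex pvec β) (hsum : ∑ j, pvec j = p) (hpos : ∀ j, 0 < pvec j) :
    Function.Surjective β := by
  intro a
  have h := hpos a
  rw [← hβ.card_fiber hsum, Finset.card_pos] at h
  obtain ⟨i, hi⟩ := h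
  exact ⟨i, (Finset.mem_filter.1 hi).2⟩

theorem exists_isBlockIndex_of_monotone {p : ℕ} (g : Fin p → ℕ) (hg : Monotone g) :
    ∃ (r : ℕ) (pvec : Fin r → ℕ), (∀ j, 0 < pvec j) ∧ (∑ j, pvec j = p) ∧
      ∃ β : Fin p → Fin r, IsBlockIndex pvec β ∧ ∀ i j, β i < β j ↔ g i < g j := by
  set s := Finset.univ.image g with hs
  let e := s.orderIsoOfFin rfl
  let β : Fin p → Fin s.card := fun i => e.symm ⟨g i, by simp [hs]⟩
  have hlt : ∀ i j, β i < β j ↔ g i < g j := fun i j => by simp [β]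
  have hsum : ∀ t : Finset (Fin s.card),
      ∑ j ∈ t, (Finset.univ.filter fun i => β i = j).card =
        (Finset.univ.filter fun i => β i ∈ t).card := by
    intro t
    rw [Finset.card_eq_sum_card_fiberwise (f := β) (t := t) (by intro i hi; simpa using hi)]
    refine Finset.sum_congr rfl fun j hj => ?_
    congr 1
    ext i
    simp only [Finset.mem_filter, Finset.mem_univ, true_and]
    constructor
    · rintro rfl
      exact ⟨hj, rfl⟩
    · exact And.right
  refine ⟨s.card, fun j => (Finset.univ.filter fun i => β i = j).card, fun j => ?_, ?_, β,
    fun i => ⟨?_, ?_⟩, hlt⟩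
  · have hj := (e j).2
    simp only [hs, Finset.mem_image, Finset.mem_univ, true_and] at hj
    obtain ⟨i, hi⟩ := hj
    refine Finset.card_pos.2 ⟨i, ?_⟩
    simp [β, hi]
  · rw [hsum]
    simp
  · rw [hsum]
    calc _ ≤ (Finset.Iio i).card := Finset.card_le_card fun j hj => by
            simp only [Finset.mem_filter, Finset.mem_univ, true_and, Finset.mem_Iio, hlt] at hj ⊢
            exact hg.reflect_lt hj
      _ = i := Fin.card_Iio i
  · rw [hsum]
    calc (i : ℕ) < (Finset.Iic i).card := by rw [Fin.card_Iic]; omega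
      _ ≤ _ := Finset.card_le_card fun j hj => by
            simp only [Finset.mem_filter, Finset.mem_univ, true_and, Finset.mem_Iic] at hj ⊢
            exact not_lt.1 fun h => (hg hj).not_gt ((hlt _ _).1 h)

theorem exists_cyclic_shift {p r r' : ℕ} {β : Fin p → Fin r} {β' : Fin p → Fin r'}
    (hβ : Function.Surjective β) (hβ' : Function.Surjective β') (τ : Equiv.Perm (Fin p))
    (x : Fin p → ℤ)
    (h : ∀ i j, (if β (τ i) < β (τ j) then 1 else 0 : ℤ) =
      (if β' i < β' j then 1 else 0) + x i - x j) :
    r' = r ∧ ∃ c : ℕ, ∀ i, (β (τ i) : ℕ) = (β' i + c) % r := by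
  have heq : ∀ i j, β' i = β' j → β (τ i) = β (τ j) ∧ x i = x j := by
    intro i j hij
    have h1 := h i j
    have h2 := h j i
    rw [hij] at h1 h2
    rcases lt_trichotomy (β (τ i)) (β (τ j)) with hlt | hlt | hlt
    · simp only [hlt, hlt.not_gt, lt_irrefl, if_true, if_false] at h1 h2
      omega
    · simp only [hlt, lt_irrefl, if_false] at h1
      exact ⟨hlt, by omega⟩
    · simp only [hlt, hlt.not_gt, lt_irrefl, if_true, if_false] at h1 h2
      omega
  have hlt : ∀ i j, β' i < β' j →
      (β (τ i) < β (τ j) ∧ x i = x j) ∨ (β (τ j) < β (τ i) ∧ x j = x i + 1) := by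
    intro i j hij
    have h1 := h i j
    have h2 := h j i
    rcases lt_trichotomy (β (τ i)) (β (τ j)) with hlt | hlt | hlt
    · simp only [hij, hlt, hlt.not_gt, hij.not_gt, if_true, if_false] at h1 h2
      exact Or.inl ⟨hlt, by omega⟩
    · simp only [hij, hij.not_gt, hlt, lt_irrefl, if_true, if_false] at h1 h2
      omega
    · simp only [hij, hlt, hlt.not_gt, hij.not_gt, if_true, if_false] at h1 h2
      exact Or.inr ⟨hlt, by omega⟩
  choose s hs using hβ'
  have hbij : Function.Bijective fun a => β (τ (s a)) := by
    constructor
    · intro a b hab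
      by_contra hne
      rcases lt_or_gt_of_ne hne with hl | hl
      · have := hlt (s a) (s b) (by rwa [hs, hs])
        simp only at hab
        simp [hab] at this
      · have := hlt (s b) (s a) (by rwa [hs, hs])
        simp only at hab
        simp [hab] at this
    · intro b
      obtain ⟨i, hi⟩ := hβ b
      exact ⟨β' (τ.symm i), by
        dsimp only
        rw [(heq _ (τ.symm i) (hs _)).1, Equiv.apply_symm_apply, hi]⟩
  have hr : r' = r := by simpa using Fintype.card_of_bijective hbij
  subst hr
  refine ⟨rfl, ?_⟩
  rcases Nat.eq_zero_or_pos r' with h0 | hpos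
  · subst h0
    exact ⟨0, fun i => (β' i).elim0⟩
  set F : Fin r' → ℤ := fun a => (β (τ (s a)) : ℕ) + r' * x (s a) with hF
  have hmono : ∀ a b : Fin r', a < b → F a < F b ∧ F b < F a + r' := by
    intro a b hab
    have hb := (β (τ (s b))).isLt
    have ha := (β (τ (s a))).isLt
    simp only [hF]
    rcases hlt (s a) (s b) (by rwa [hs, hs]) with ⟨h1, h2⟩ | ⟨h1, h2⟩
    · rw [Fin.lt_def] at h1
      rw [h2]
      constructor <;> omega
    · rw [Fin.lt_def] at h1
      rw [h2, mul_add, mul_one]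
      constructor <;> omega
  have hgrow : ∀ (d : ℕ) (a b : Fin r'), (b : ℕ) = a + d → F a + d ≤ F b := by
    intro d
    induction d with
    | zero =>
      intro a b hab
      rw [show b = a from Fin.ext (by omega)]
      simp
    | succ d ih =>
      intro a b hab
      have h1 := ih a ⟨a + d, by omega⟩ rfl
      have h2 := (hmono ⟨a + d, by omega⟩ b (by rw [Fin.lt_def]; simp; omega)).1
      push_cast
      omega
  have hlin : ∀ a : Fin r', F a = F ⟨0, hpos⟩ + (a : ℕ) := by
    intro a
    have h1 := hgrow a ⟨0, hpos⟩ a (by simp)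
    have h2 := hgrow (r' - 1 - a) a ⟨r' - 1, by omega⟩ (by simp; omega)
    have h3 : F ⟨r' - 1, by omega⟩ ≤ F ⟨0, hpos⟩ + (r' - 1) := by
      rcases Nat.eq_or_lt_of_le hpos with h1r | h1r
      · simp [← h1r]
      · have := (hmono ⟨0, hpos⟩ ⟨r' - 1, by omega⟩ (by rw [Fin.lt_def]; simp; omega)).2
        omega
    have := a.isLt
    omega
  refine ⟨β (τ (s ⟨0, hpos⟩)), fun i => ?_⟩
  have h1 := hlin (β' i)
  rw [(heq i (s (β' i)) (hs _).symm).1]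
  set b := β (τ (s (β' i))) with hb
  simp only [hF, ← hb] at h1
  have h2 : ((β' i : ℕ) + (β (τ (s ⟨0, hpos⟩)) : ℕ) : ℤ) =
      (b : ℕ) + r' * (x (s (β' i)) - x (s ⟨0, hpos⟩)) := by
    rw [mul_sub]
    omega
  have h3 : (((β' i : ℕ) + (β (τ (s ⟨0, hpos⟩)) : ℕ) : ℕ) : ℤ) % r' = (b : ℕ) := by
    push_cast
    rw [h2, Int.add_mul_emod_self_left]
    exact_mod_cast Nat.mod_eq_of_lt b.isLt
  exact_mod_cast h3.symm

end BlockIndex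

section Hereditary

open Matrix

variable {R K : Type*} [CommRing R] [IsDomain R] [IsDiscreteValuationRing R] [Field K]
  [Algebra R K] [IsFractionRing R K] {ϖ : R} {ι : Type*} [Fintype ι] [DecidableEq ι]
  {H : Subalgebra R (Matrix ι ι K)}

omit [IsDiscreteValuationRing R] in
theorem exists_smul_mem_of_span_eq_top
    (hspan : Submodule.span K (H : Set (Matrix ι ι K)) = ⊤) (M : Matrix ι ι K) :
    ∃ c : R, c ≠ 0 ∧ c • M ∈ H := by
  have hM : M ∈ Submodule.span K (H : Set (Matrix ι ι K)) := hspan ▸ Submodule.mem_top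
  induction hM using Submodule.span_induction with
  | mem x hx => exact ⟨1, one_ne_zero, by rwa [one_smul]⟩
  | zero => exact ⟨1, one_ne_zero, by simp [zero_mem]⟩
  | add x y _ _ hx hy =>
    obtain ⟨a, ha, hax⟩ := hx
    obtain ⟨b, hb, hby⟩ := hy
    refine ⟨a * b, mul_ne_zero ha hb, ?_⟩
    rw [smul_add]
    refine add_mem ?_ ?_
    · rw [mul_comm, mul_smul]
      exact H.smul_mem hax b
    · rw [mul_smul]
      exact H.smul_mem hby a
  | smul c x _ hx =>
    obtain ⟨a, ha, hax⟩ := hx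
    obtain ⟨n, s, hs, rfl⟩ := IsFractionRing.div_surjective (A := R) c
    have hs0 : s ≠ 0 := nonZeroDivisors.ne_zero hs
    refine ⟨a * s, mul_ne_zero ha hs0, ?_⟩
    have : (a * s) • (algebraMap R K n / algebraMap R K s) • x = n • a • x := by
      have h0 : algebraMap R K s ≠ 0 := by simpa using hs0
      ext i j
      simp only [Matrix.smul_apply, smul_eq_mul]
      simp only [Algebra.smul_def, map_mul]
      field_simp
    rw [this]
    exact H.smul_mem hax n

omit [IsDiscreteValuationRing R] in
theorem exists_common_smul_mem {α : Type*} [Finite α]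
    (hspan : Submodule.span K (H : Set (Matrix ι ι K)) = ⊤) (M : α → Matrix ι ι K) :
    ∃ c : R, c ≠ 0 ∧ ∀ a, c • M a ∈ H := by
  classical
  have := Fintype.ofFinite α
  choose c hc hM using fun a => exists_smul_mem_of_span_eq_top hspan (M a)
  refine ⟨∏ a, c a, Finset.prod_ne_zero_iff.2 fun a _ => hc a, fun a => ?_⟩
  rw [← Finset.prod_erase_mul _ _ (Finset.mem_univ a), mul_smul]
  exact H.smul_mem (hM a) _

omit [IsDiscreteValuationRing R] in
/-- If every left ideal of `H` is projective, the map `h ↦ h q` from a left ideal `N` to column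
vectors admits a section of the form `x ↦ x aᵀ`. -/
theorem exists_splitting (hspan : Submodule.span K (H : Set (Matrix ι ι K)) = ⊤)
    (hher : ∀ I : Ideal H, Module.Projective H I) (N : Ideal H) (q : ι → K) (i₀ : ι)
    {d : R} (hd : d ≠ 0)
    (hq : ∃ h ∈ N, (h : Matrix ι ι K) *ᵥ q = Pi.single i₀ (algebraMap R K d)) :
    ∃ a : ι → K, a ⬝ᵥ q = 1 ∧
      ∀ h ∈ N, ∃ h' ∈ N, (h' : Matrix ι ι K) = vecMulVec ((h : Matrix ι ι K) *ᵥ q) a := by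
  have hd' : algebraMap R K d ≠ 0 := by simpa using hd
  obtain ⟨c, hc, hce⟩ := exists_smul_mem_of_span_eq_top hspan (vecMulVec q (Pi.single i₀ 1))
  have hc' : algebraMap R K c ≠ 0 := by simpa using hc
  obtain ⟨h₀, hh₀, hq⟩ := hq
  let e : H := ⟨_, hce⟩
  let f : N →ₗ[H] H := (LinearMap.toSpanSingleton H H e) ∘ₗ N.subtype
  have hf : ∀ x : N, ((f x : H) : Matrix ι ι K) =
      c • vecMulVec (((x : H) : Matrix ι ι K) *ᵥ q) (Pi.single i₀ 1) := by
    intro x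
    change ((x : H) : Matrix ι ι K) * (c • vecMulVec q (Pi.single i₀ 1)) = _
    rw [mul_smul_comm, mul_vecMulVec]
  have hproj : Module.Projective H (LinearMap.range f) := hher _
  obtain ⟨s, hs⟩ := Module.projective_lifting_property f.rangeRestrict LinearMap.id
    f.surjective_rangeRestrict
  have hs' : ∀ x, f (s x) = x := fun x => congrArg Subtype.val (LinearMap.congr_fun hs x)
  let b : LinearMap.range f := f.rangeRestrict ⟨h₀, hh₀⟩
  have hb : ((b : H) : Matrix ι ι K) =
      c • vecMulVec (Pi.single i₀ (algebraMap R K d)) (Pi.single i₀ 1) := by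
    rw [← hq]
    exact hf ⟨h₀, hh₀⟩
  have hxb : ∀ h : N, ((f.rangeRestrict h : LinearMap.range f) : H) • b =
      algebraMap R H (c * d) • f.rangeRestrict h := by
    intro h
    apply Subtype.ext
    apply Subtype.ext
    change ((f h : H) : Matrix ι ι K) * ((b : H) : Matrix ι ι K) =
      algebraMap R (Matrix ι ι K) (c * d) * ((f h : H) : Matrix ι ι K)
    rw [hf, hb, ← Algebra.smul_def]
    rw [smul_mul_assoc, mul_smul_comm, vecMulVec_mul_vecMulVec]
    ext i j
    simp only [Matrix.smul_apply, vecMulVec_apply, Pi.smul_apply, dotProduct_single,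
      Pi.single_eq_same, smul_eq_mul]
    simp only [one_mul, Algebra.smul_def, map_mul]
    ring
  set t : Matrix ι ι K := (((s b : N) : H) : Matrix ι ι K) with ht
  have key : ∀ h : N, (((s (f.rangeRestrict h) : N) : H) : Matrix ι ι K) =
      vecMulVec (((h : H) : Matrix ι ι K) *ᵥ q) ((algebraMap R K d)⁻¹ • t i₀) := by
    intro h
    have h1 := congrArg s (hxb h)
    rw [map_smul, map_smul] at h1
    have h2 : ((f h : H) : Matrix ι ι K) * t = algebraMap R (Matrix ι ι K) (c * d) *
        (((s (f.rangeRestrict h) : N) : H) : Matrix ι ι K) :=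
      congrArg (fun z : N => ((z : H) : Matrix ι ι K)) h1
    rw [hf, ← Algebra.smul_def, smul_mul_assoc, vecMulVec_mul] at h2
    ext i j
    have h3 := congrFun (congrFun h2 i) j
    simp only [Matrix.smul_apply, vecMulVec_apply, single_one_vecMul, Matrix.row_apply] at h3
    simp only [Algebra.smul_def, map_mul, mul_assoc] at h3
    simp only [vecMulVec_apply, Pi.smul_apply, smul_eq_mul]
    have h4 := mul_left_cancel₀ hc' h3
    field_simp
    rw [h4, mul_comm]
  generalize (algebraMap R K d)⁻¹ • t i₀ = a at key
  refine ⟨a, ?_, fun h hN => ⟨_, (s (f.rangeRestrict ⟨h, hN⟩)).2,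
    key ⟨h, hN⟩⟩⟩
  have h1 := congrArg (fun z : H => (z : Matrix ι ι K) i₀ i₀) (hs' b)
  simp only [hf, hb] at h1
  rw [key ⟨h₀, hh₀⟩] at h1
  simp only [hq, Matrix.smul_apply, vecMulVec_mulVec, vecMulVec_apply] at h1
  simp only [Algebra.smul_def] at h1
  simpa [hc', hd', hq] using h1

/-- An `H`-stable `R`-lattice in the space of column vectors. -/
structure IsStableLattice (H : Subalgebra R (Matrix ι ι K)) (L : Submodule R (ι → K)) : Prop where
  mulVec_mem : ∀ h ∈ H, ∀ x ∈ L, h *ᵥ x ∈ L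
  exists_single_mem : ∃ d : R, d ≠ 0 ∧ ∀ i, Pi.single i (algebraMap R K d) ∈ L
  exists_smul_integral :
    ∃ d : R, d ≠ 0 ∧ ∀ x ∈ L, ∀ i, algebraMap R K d * x i ∈ Set.range (algebraMap R K)
  exists_smul_vecMulVec_mem :
    ∃ d : R, d ≠ 0 ∧ ∀ x ∈ L, ∀ j, d • vecMulVec x (Pi.single j 1) ∈ H

theorem IsStableLattice.smul_le_or_smul_le {L M : Submodule R (ι → K)}
    (hspan : Submodule.span K (H : Set (Matrix ι ι K)) = ⊤)
    (hher : ∀ I : Ideal H, Module.Projective H I)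
    (hL : IsStableLattice H L) (hM : IsStableLattice H M) {i j : ι} (hij : i ≠ j) {t : K}
    (ht : t ≠ 0) : (∀ x ∈ L, t • x ∈ M) ∨ ∀ x ∈ M, t⁻¹ • x ∈ L := by
  obtain ⟨d₁, hd₁, hL₁⟩ := hL.exists_smul_vecMulVec_mem
  obtain ⟨d₂, hd₂, hM₂⟩ := hM.exists_smul_vecMulVec_mem
  obtain ⟨d₃, hd₃, hM₃⟩ := hM.exists_single_mem
  set d := d₁ * d₂ with hd
  have hd0 : d ≠ 0 := mul_ne_zero hd₁ hd₂
  have hL' : ∀ x ∈ L, ∀ l, d • vecMulVec x (Pi.single l 1) ∈ H := fun x hx l => by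
    rw [hd, mul_comm, mul_smul]
    exact H.smul_mem (hL₁ x hx l) _
  have hM' : ∀ x ∈ M, ∀ l, d • vecMulVec x (Pi.single l 1) ∈ H := fun x hx l => by
    rw [hd, mul_smul]
    exact H.smul_mem (hM₂ x hx l) _
  let N : Ideal H :=
    { carrier := {h | (∃ x ∈ L, (h : Matrix ι ι K).col i = d • x) ∧
        ∃ x ∈ M, (h : Matrix ι ι K).col j = d • x}
      add_mem' := by
        rintro a b ⟨⟨x, hx, hax⟩, y, hy, hay⟩ ⟨⟨x', hx', hbx⟩, y', hy', hby⟩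
        refine ⟨⟨x + x', add_mem hx hx', ?_⟩, y + y', add_mem hy hy', ?_⟩
        · rw [smul_add, ← hax, ← hbx]
          rfl
        · rw [smul_add, ← hay, ← hby]
          rfl
      zero_mem' := ⟨⟨0, zero_mem _, by rw [smul_zero]; rfl⟩, 0, zero_mem _, by rw [smul_zero]; rfl⟩
      smul_mem' := by
        rintro a b ⟨⟨x, hx, hbx⟩, y, hy, hby⟩
        refine ⟨⟨a *ᵥ x, hL.mulVec_mem _ a.2 x hx, ?_⟩, a *ᵥ y, hM.mulVec_mem _ a.2 y hy, ?_⟩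
        · rw [← mulVec_smul, ← hbx]
          rfl
        · rw [← mulVec_smul, ← hby]
          rfl }
  have hNL : ∀ x (hx : x ∈ L), (⟨_, hL' x hx i⟩ : H) ∈ N := by
    intro x hx
    refine ⟨⟨x, hx, ?_⟩, 0, zero_mem _, ?_⟩
    · ext l
      simp [vecMulVec_apply]
    · ext l
      simp [vecMulVec_apply, hij.symm]
  have hNM : ∀ x (hx : x ∈ M), (⟨_, hM' x hx j⟩ : H) ∈ N := by
    intro x hx
    refine ⟨⟨0, zero_mem _, ?_⟩, x, hx, ?_⟩
    · ext l
      simp [vecMulVec_apply, hij]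
    · ext l
      simp [vecMulVec_apply]
  have hqL : ∀ x : ι → K, (d • vecMulVec x (Pi.single i 1)) *ᵥ (Pi.single i t + Pi.single j 1) =
      d • t • x := by
    intro x
    rw [smul_mulVec, vecMulVec_mulVec]
    ext l
    simp [hij, Algebra.smul_def]
  have hqM : ∀ x : ι → K, (d • vecMulVec x (Pi.single j 1)) *ᵥ (Pi.single i t + Pi.single j 1) =
      d • x := by
    intro x
    rw [smul_mulVec, vecMulVec_mulVec]
    ext l
    simp [hij.symm, Algebra.smul_def]
  obtain ⟨a, haq, ha⟩ := exists_splitting hspan hher N (Pi.single i t + Pi.single j 1) j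
    (mul_ne_zero hd0 hd₃) ⟨_, hNM _ (hM₃ j), by
      rw [hqM]
      ext l
      simp [Pi.single_apply, Algebra.smul_def]⟩
  have hcancel : ∀ {x y : ι → K}, d • x = d • y → x = y := fun h => smul_right_injective _ hd0 h
  have hLa : ∀ x ∈ L, (a j * t) • x ∈ M := by
    intro x hx
    obtain ⟨h', hh', hh⟩ := ha _ (hNL x hx)
    obtain ⟨-, y, hy, hhy⟩ := hh'
    simp only [hh, hqL] at hhy
    convert hy
    apply hcancel
    rw [← hhy]
    ext l
    simp [vecMulVec_apply, Algebra.smul_def]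
    ring
  have hMa : ∀ x ∈ M, a i • x ∈ L := by
    intro x hx
    obtain ⟨h', hh', hh⟩ := ha _ (hNM x hx)
    obtain ⟨⟨y, hy, hhy⟩, -⟩ := hh'
    simp only [hh, hqM] at hhy
    convert hy
    apply hcancel
    rw [← hhy]
    ext l
    simp [vecMulVec_apply, Algebra.smul_def]
    ring
  have hsum : ∑ l : Bool, (if l then a i * t else a j) = 1 := by
    simpa [dotProduct_add] using haq
  obtain ⟨l, -, hl0, r, hr⟩ := exists_div_mem_range (R := R) Finset.univ
    (fun l : Bool => if l then a i * t else a j) (by rw [hsum]; exact one_ne_zero)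
  rw [hsum] at hr
  cases l with
  | false =>
    left
    intro x hx
    simp only [Bool.false_eq_true, if_false] at hl0 hr
    have := M.smul_mem r (hLa x hx)
    rwa [← algebraMap_smul K, hr, smul_smul, ← mul_assoc, one_div_mul_cancel hl0, one_mul] at this
  | true =>
    right
    intro x hx
    simp only [if_true] at hl0 hr
    have := L.smul_mem r (hMa x hx)
    rw [← algebraMap_smul K, hr, smul_smul] at this
    convert this using 2
    have := left_ne_zero_of_mul hl0
    field_simp

theorem IsStableLattice.exists_exponent [Nonempty ι] {L M : Submodule R (ι → K)}
    (hϖ : Irreducible ϖ) (hL : IsStableLattice H L) (hM : IsStableLattice H M) :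
    ∃ m : ℤ, ∀ c : K, (∀ x ∈ L, c • x ∈ M) ↔ c ∈ fracPow K ϖ m := by
  obtain ⟨i⟩ := ‹Nonempty ι›
  have hw : algebraMap R K ϖ ≠ 0 := algebraMap_irreducible_ne_zero hϖ
  obtain ⟨a, ha, hLa⟩ := hL.exists_smul_integral
  obtain ⟨b, hb, hMb⟩ := hM.exists_single_mem
  obtain ⟨a', ha', hMa⟩ := hM.exists_smul_integral
  obtain ⟨b', hb', hLb⟩ := hL.exists_single_mem
  have hiff : ∀ (u : Rˣ) (c : K),
      (∀ x ∈ L, (algebraMap R K u * c) • x ∈ M) ↔ ∀ x ∈ L, c • x ∈ M := fun u c =>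
    forall₂_congr fun x _ => unit_mul_mem_iff M u c x
  have hab : algebraMap R K (a * b) ≠ 0 := by simpa using ⟨ha, hb⟩
  have hab' : algebraMap R K (a' * b') ≠ 0 := by simpa using ⟨ha', hb'⟩
  obtain ⟨n, u, hn⟩ := exists_eq_unit_mul_zpow hϖ hab
  obtain ⟨n', u', hn'⟩ := exists_eq_unit_mul_zpow hϖ hab'
  obtain ⟨m, hm, hmin⟩ := Int.exists_least_of_bdd
    (P := fun z : ℤ => ∀ x ∈ L, (algebraMap R K ϖ ^ z) • x ∈ M)
    ⟨-n', fun z hz => by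
      obtain ⟨y, hy⟩ := hMa _ (hz _ (hLb i)) i
      have h1 : algebraMap R K y = algebraMap R K u' * algebraMap R K ϖ ^ (n' + z) := by
        rw [zpow_add₀ hw, ← mul_assoc, ← hn', hy]
        simp
        ring
      have h2 : algebraMap R K ϖ ^ (n' + z) ∈ fracPow K ϖ 0 := by
        have h3 := (unit_mul_mem_iff (fracPow K ϖ 0) u' (algebraMap R K ϖ ^ (n' + z)) (1 : K)).1
        simp only [smul_eq_mul, mul_one, ← h1] at h3
        exact h3 (mem_fracPow_zero.2 ⟨y, rfl⟩)
      rw [zpow_mem_fracPow hϖ] at h2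
      omega⟩
    ⟨n, by
      rw [← hiff u, ← hn]
      intro x hx
      have : algebraMap R K (a * b) • x = ∑ l, (algebraMap R K a * x l) •
          Pi.single (M := fun _ => K) l (algebraMap R K b) := by
        ext l
        simp [Finset.sum_apply, Pi.single_apply]
        ring
      rw [this]
      refine sum_mem fun l _ => ?_
      obtain ⟨y, hy⟩ := hLa x hx l
      rw [← hy, algebraMap_smul]
      exact M.smul_mem y (hMb l)⟩
  refine ⟨m, fun c => ?_⟩
  constructor
  · intro hc
    rcases eq_or_ne c 0 with rfl | hc0
    · exact zero_mem _
    obtain ⟨z, v, rfl⟩ := exists_eq_unit_mul_zpow hϖ hc0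
    exact mem_fracPow.2 (by
      obtain ⟨y, hy⟩ := mem_fracPow.1
        ((zpow_mem_fracPow (K := K) hϖ).2 (hmin z ((hiff v _).1 hc)))
      exact ⟨v * y, by rw [map_mul, mul_assoc, hy]⟩)
  · intro hc x hx
    obtain ⟨y, rfl⟩ := mem_fracPow.1 hc
    rw [mul_smul, algebraMap_smul]
    exact M.smul_mem y (hm x hx)

end Hereditary

section Columns

open Matrix

variable {R K : Type*} [CommRing R] [IsDomain R] [IsDiscreteValuationRing R] [Field K]
  [Algebra R K] [IsFractionRing R K] {ϖ : R} {p : ℕ}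
  {H : Subalgebra R (Matrix (Fin p) (Fin p) K)}

/-- The left ideal of those elements of `H` whose columns to the right of `j` vanish. -/
def colIdeal (H : Subalgebra R (Matrix (Fin p) (Fin p) K)) (j : Fin p) : Ideal H where
  carrier := {h | ∀ l, j < l → (h : Matrix (Fin p) (Fin p) K).col l = 0}
  add_mem' {a b} ha hb l hl := by
    change (a : Matrix (Fin p) (Fin p) K).col l + (b : Matrix (Fin p) (Fin p) K).col l = 0
    rw [ha l hl, hb l hl, add_zero]
  zero_mem' _ _ := rfl
  smul_mem' a b hb l hl := by
    change (a : Matrix (Fin p) (Fin p) K) *ᵥ (b : Matrix (Fin p) (Fin p) K).col l = 0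
    rw [hb l hl, mulVec_zero]

/-- The lattice of `j`-th columns of the elements of `colIdeal H j`. -/
def colLattice (H : Subalgebra R (Matrix (Fin p) (Fin p) K)) (j : Fin p) :
    Submodule R (Fin p → K) where
  carrier := {x | ∃ h ∈ colIdeal H j, (h : Matrix (Fin p) (Fin p) K).col j = x}
  add_mem' := by
    rintro _ _ ⟨a, ha, rfl⟩ ⟨b, hb, rfl⟩
    exact ⟨a + b, add_mem ha hb, rfl⟩
  zero_mem' := ⟨0, zero_mem _, rfl⟩
  smul_mem' := by
    rintro c _ ⟨a, ha, rfl⟩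
    refine ⟨c • a, ?_, rfl⟩
    rw [← algebraMap_smul H c a]
    exact (colIdeal H j).smul_mem _ ha

theorem exists_smul_integral (hfin : Module.Finite R H) :
    ∃ d : R, d ≠ 0 ∧ ∀ h ∈ H, ∀ i j,
      algebraMap R K d * h i j ∈ Set.range (algebraMap R K) := by
  classical
  obtain ⟨s, hs⟩ := hfin.fg_top
  obtain ⟨b, hb⟩ := IsLocalization.exist_integer_multiples_of_finset (nonZeroDivisors R)
    ((s ×ˢ (Finset.univ : Finset (Fin p × Fin p))).image
      fun z => (z.1 : Matrix (Fin p) (Fin p) K) z.2.1 z.2.2)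
  refine ⟨b, nonZeroDivisors.ne_zero b.2, fun h hh i j => ?_⟩
  have hmem : (⟨h, hh⟩ : H) ∈ Submodule.span R (s : Set H) := hs ▸ Submodule.mem_top
  change algebraMap R K b * ((⟨h, hh⟩ : H) : Matrix (Fin p) (Fin p) K) i j ∈ _
  generalize (⟨h, hh⟩ : H) = g at hmem
  induction hmem using Submodule.span_induction with
  | mem x hx =>
    obtain ⟨y, hy⟩ := hb (x.1 i j) (Finset.mem_image.2 ⟨(x, i, j), by simpa using hx, rfl⟩)
    exact ⟨y, by rw [hy, Algebra.smul_def]⟩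
  | zero => exact ⟨0, by simp⟩
  | add x y _ _ hx hy =>
    obtain ⟨u, hu⟩ := hx
    obtain ⟨v, hv⟩ := hy
    exact ⟨u + v, by simp [hu, hv, mul_add]⟩
  | smul c x _ hx =>
    obtain ⟨u, hu⟩ := hx
    refine ⟨c * u, ?_⟩
    rw [map_mul, hu, ← Algebra.smul_def, ← mul_smul_comm]
    rfl

theorem isStableLattice_colLattice (hspan : Submodule.span K (H : Set (Matrix (Fin p) (Fin p) K)) = ⊤)
    (hfin : Module.Finite R H) (j : Fin p) : IsStableLattice H (colLattice H j) where
  mulVec_mem := by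
    rintro h hh _ ⟨g, hg, rfl⟩
    exact ⟨⟨h, hh⟩ * g, (colIdeal H j).smul_mem _ hg, rfl⟩
  exists_single_mem := by
    obtain ⟨d, hd, h⟩ := exists_common_smul_mem hspan fun i : Fin p => Matrix.single i j (1 : K)
    refine ⟨d, hd, fun i => ⟨⟨_, h i⟩, fun l hl => ?_, ?_⟩⟩
    · ext a
      simp [hl.ne]
    · ext a
      simp only [Matrix.col_apply, Matrix.smul_apply]
      simp [Algebra.smul_def, Matrix.single_apply, Pi.single_apply, eq_comm]
  exists_smul_integral := by
    obtain ⟨d, hd, h⟩ := exists_smul_integral hfin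
    refine ⟨d, hd, ?_⟩
    rintro _ ⟨g, -, rfl⟩ i
    exact h _ g.2 i j
  exists_smul_vecMulVec_mem := by
    obtain ⟨d, hd, h⟩ := exists_common_smul_mem hspan fun i : Fin p => Matrix.single j i (1 : K)
    refine ⟨d, hd, ?_⟩
    rintro _ ⟨g, -, rfl⟩ i
    convert mul_mem g.2 (h i) using 1
    rw [mul_smul_comm, single_eq_single_vecMulVec_single, mul_vecMulVec, mulVec_single_one]

theorem exists_lattice_decomposition (hspan : Submodule.span K (H : Set (Matrix (Fin p) (Fin p) K)) = ⊤)
    (hfin : Module.Finite R H) (hher : ∀ I : Ideal H, Module.Projective H I) :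
    ∃ (L : Fin p → Submodule R (Fin p → K)) (B : (Matrix (Fin p) (Fin p) K)ˣ),
      (∀ j, IsStableLattice H (L j)) ∧
        ∀ X, X ∈ H ↔ ∀ j, (X * (B⁻¹ : (Matrix (Fin p) (Fin p) K)ˣ)).col j ∈ L j := by
  have hL := isStableLattice_colLattice hspan hfin
  have hsplit : ∀ j, ∃ a : Fin p → K, a j = 1 ∧ (∀ l, j < l → a l = 0) ∧
      ∀ x ∈ colLattice H j, vecMulVec x a ∈ H := by
    intro j
    obtain ⟨d, hd, hsingle⟩ := (hL j).exists_single_mem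
    obtain ⟨h₀, hh₀, hcol⟩ := hsingle j
    obtain ⟨a, ha1, ha⟩ := exists_splitting hspan hher (colIdeal H j) (Pi.single j 1) j hd
      ⟨h₀, hh₀, by rw [mulVec_single_one, hcol]⟩
    refine ⟨a, by simpa using ha1, fun l hl => ?_, ?_⟩
    · obtain ⟨h', hh', h⟩ := ha h₀ hh₀
      have h1 := congrFun (hh' l hl) j
      rw [h, mulVec_single_one, hcol] at h1
      simpa [vecMulVec_apply, hd] using h1
    · rintro _ ⟨g, hg, rfl⟩
      obtain ⟨h', -, h⟩ := ha g hg
      rw [mulVec_single_one] at h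
      exact h ▸ h'.2
  choose a ha1 ha0 ha using hsplit
  have hdet : (Matrix.of a).det = 1 := by
    rw [Matrix.det_of_isLowerTriangular]
    · simp [ha1]
    · intro i j hij
      exact ha0 i j hij
  obtain ⟨B, hB⟩ := (Matrix.isUnit_iff_isUnit_det (Matrix.of a)).2 (hdet ▸ isUnit_one)
  refine ⟨colLattice H, B, hL, fun X => ⟨fun hX => ?_, fun hX => ?_⟩⟩
  · have key : ∀ (n : ℕ), ∀ X ∈ H, (∀ l : Fin p, n ≤ l → X.col l = 0) →
        ∃ Y : Matrix (Fin p) (Fin p) K, (∀ j, Y.col j ∈ colLattice H j) ∧ X = Y * B := by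
      intro n
      induction n with
      | zero =>
        intro X _ h0
        refine ⟨0, fun j => zero_mem _, ?_⟩
        ext i j
        simpa using congrFun (h0 j (Nat.zero_le _)) i
      | succ n ih =>
        intro X hX h0
        rcases le_or_gt p n with hpn | hnp
        · exact ih X hX fun l hl => absurd l.isLt (by omega)
        set j : Fin p := ⟨n, hnp⟩ with hj
        have hx : X.col j ∈ colLattice H j := ⟨⟨X, hX⟩, fun l hl => h0 l hl, rfl⟩
        obtain ⟨Y, hY, hXY⟩ := ih (X - vecMulVec (X.col j) (a j))
          (sub_mem hX (ha j _ hx)) fun l hl => by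
            ext i
            rcases eq_or_ne l j with rfl | hlj
            · simp [vecMulVec_apply, ha1]
            · have hlt : j < l := lt_of_le_of_ne hl hlj.symm
              simpa [vecMulVec_apply, ha0 j l hlt] using congrFun (h0 l hlt) i
        refine ⟨Y + vecMulVec (X.col j) (Pi.single j 1), fun l => ?_, ?_⟩
        · refine add_mem (hY l) ?_
          rcases eq_or_ne l j with rfl | hlj
          · convert hx using 1
            ext i
            simp [vecMulVec_apply]
          · convert zero_mem (colLattice H l) using 1
            ext i
            simp [vecMulVec_apply, hlj]
        · rw [add_mul, ← hXY, vecMulVec_mul, single_one_vecMul, hB]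
          simp
    obtain ⟨Y, hY, rfl⟩ := key p X hX fun l hl => absurd l.isLt (by omega)
    simpa [mul_assoc] using hY
  · have : X = ∑ j, vecMulVec ((X * (B⁻¹ : (Matrix (Fin p) (Fin p) K)ˣ)).col j) (a j) := by
      conv_lhs => rw [← Units.inv_mul_cancel_right X B, hB]
      ext i l
      simp [Matrix.mul_apply, Matrix.sum_apply, vecMulVec_apply]
    rw [this]
    exact sum_mem fun j _ => ha j _ (hX j)

theorem exists_conj_exponentSet (hϖ : Irreducible ϖ)
    (hspan : Submodule.span K (H : Set (Matrix (Fin p) (Fin p) K)) = ⊤)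
    (hfin : Module.Finite R H) (hher : ∀ I : Ideal H, Module.Projective H I) :
    ∃ m : Fin p → Fin p → ℤ, (∀ i, m i i = 0) ∧ (∀ i j l, m i l ≤ m i j + m j l) ∧
      (∀ i j, m i j + m j i ≤ 1) ∧ ∃ B : (Matrix (Fin p) (Fin p) K)ˣ, ∀ X, X ∈ H ↔
        (B : Matrix (Fin p) (Fin p) K) * X * (B⁻¹ : (Matrix (Fin p) (Fin p) K)ˣ) ∈
          exponentSet K ϖ m := by
  obtain ⟨L, B, hL, hH⟩ := exists_lattice_decomposition hspan hfin hher
  have hw : algebraMap R K ϖ ≠ 0 := algebraMap_irreducible_ne_zero hϖ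
  have hex : ∀ i j, ∃ m : ℤ, ∀ c : K, (∀ x ∈ L i, c • x ∈ L j) ↔ c ∈ fracPow K ϖ m := by
    intro i j
    have : Nonempty (Fin p) := ⟨i⟩
    exact (hL i).exists_exponent hϖ (hL j)
  choose m hm using hex
  have hz : ∀ i j (z : ℤ), (∀ x ∈ L i, algebraMap R K ϖ ^ z • x ∈ L j) ↔ m i j ≤ z :=
    fun i j z => (hm i j _).trans (zpow_mem_fracPow hϖ)
  have htri : ∀ i j l, m i l ≤ m i j + m j l := by
    intro i j l
    rw [← hz]
    intro x hx
    rw [add_comm, zpow_add₀ hw, mul_smul]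
    exact (hz j l _).2 le_rfl _ ((hz i j _).2 le_rfl x hx)
  have h0 : ∀ i, m i i = 0 := by
    intro i
    have h1 : m i i ≤ 0 := by
      rw [← hz]
      intro x hx
      simpa using hx
    have := htri i i i
    omega
  refine ⟨m, h0, htri, fun i j => ?_, B, fun X => ⟨fun hX i j => ?_, fun hX => ?_⟩⟩
  · rcases eq_or_ne i j with rfl | hij
    · simp [h0]
    rcases (hL i).smul_le_or_smul_le hspan hher (hL j) hij
      (zpow_ne_zero (m i j - 1) hw) with h | h
    · have := (hz i j _).1 h
      omega
    · simp only [← _root_.zpow_neg] at h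
      have := (hz j i _).1 h
      omega
  · rw [← hm]
    intro x hx
    have h1 : vecMulVec x (Pi.single i 1) * (B : Matrix (Fin p) (Fin p) K) ∈ H := by
      rw [hH]
      intro l
      rw [Units.mul_inv_cancel_right]
      rcases eq_or_ne l i with rfl | hli
      · convert hx using 1
        ext a
        simp [vecMulVec_apply]
      · convert zero_mem (L l) using 1
        ext a
        simp [vecMulVec_apply, hli]
    convert (hH _).1 (mul_mem h1 hX) j using 1
    have h2 : vecMulVec x (Pi.single i 1) * B.val * X * B⁻¹.val =
        vecMulVec x ((B.val * X * B⁻¹.val).row i) := by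
      rw [← single_one_vecMul, ← vecMulVec_mul]
      simp only [mul_assoc]
    rw [h2]
    ext a
    exact mul_comm _ _
  · rw [hH]
    intro j
    have h1 := (hH 1).1 (one_mem H)
    have h2 : (X * (B⁻¹ : (Matrix (Fin p) (Fin p) K)ˣ)).col j =
        ∑ i, ((B : Matrix (Fin p) (Fin p) K) * X * (B⁻¹ : (Matrix (Fin p) (Fin p) K)ˣ)) i j •
          (1 * ((B⁻¹ : (Matrix (Fin p) (Fin p) K)ˣ) : Matrix (Fin p) (Fin p) K)).col i := by
      conv_lhs => rw [← Units.inv_mul_cancel_left B (X * _), ← mul_assoc B.val]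
      ext a
      simp only [Matrix.col_apply, one_mul, Finset.sum_apply, Pi.smul_apply, smul_eq_mul]
      rw [Matrix.mul_apply]
      exact Finset.sum_congr rfl fun i _ => mul_comm _ _
    rw [h2]
    exact sum_mem fun i _ => (hm i j _).2 (hX i j) _ (h1 i)

end Columns

section Normalization

variable {ι : Type*}

theorem exists_normalization [Fintype ι] {m : ι → ι → ℤ} (h0 : ∀ i, m i i = 0)
    (htri : ∀ i j l, m i l ≤ m i j + m j l) (hle : ∀ i j, m i j + m j i ≤ 1) :
    ∃ (x : ι → ℤ) (g : ι → ℕ), ∀ i j, m i j = (if g i < g j then 1 else 0) - x i + x j := by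
  classical
  rcases isEmpty_or_nonempty ι with h | ⟨⟨o⟩⟩
  · exact ⟨0, 0, fun i => h.elim i⟩
  let n : ι → ι → ℤ := fun i j => m i j + m o i - m o j
  have hn0 : ∀ i j, 0 ≤ n i j := fun i j => by linarith [htri o i j]
  have hnle : ∀ i j, n i j + n j i ≤ 1 := fun i j => by linarith [hle i j]
  have hntri : ∀ i j l, n i l ≤ n i j + n j l := fun i j l => by linarith [htri i j l]
  let g : ι → ℕ := fun i => (Finset.univ.filter fun l => n l i = 1).card
  refine ⟨m o, g, fun i j => ?_⟩
  have hij := hn0 i j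
  have hji := hn0 j i
  have hs := hnle i j
  suffices n i j = if g i < g j then 1 else 0 by
    rw [← this]
    ring
  rcases (show n i j = 0 ∨ n i j = 1 by omega) with h | h
  · rw [if_neg, h]
    refine not_lt.2 (Finset.card_le_card fun l hl => ?_)
    simp only [Finset.mem_filter, Finset.mem_univ, true_and] at hl ⊢
    have h1 := hntri l i j
    have h2 := hnle l i
    have h3 := hn0 i l
    omega
  · rw [if_pos, h]
    refine Finset.card_lt_card (Finset.ssubset_iff_of_subset (fun l hl => ?_) |>.2 ⟨i, ?_, ?_⟩)
    · simp only [Finset.mem_filter, Finset.mem_univ, true_and] at hl ⊢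
      have h1 := hntri l j i
      have h2 := hnle l j
      have h3 := hn0 j l
      omega
    · simpa using h
    · simp [n, h0]

variable {R K : Type*} [CommRing R] [IsDomain R] [IsDiscreteValuationRing R] [Field K]
  [Algebra R K] [IsFractionRing R K] {ϖ : R}

omit [IsDomain R] [IsDiscreteValuationRing R] in
theorem zpow_conj_mem_fracPow (hϖ : Irreducible ϖ) {n x y : ℤ} {c : K} :
    algebraMap R K ϖ ^ x * c * (algebraMap R K ϖ ^ y)⁻¹ ∈ fracPow K ϖ (n + x - y) ↔
      c ∈ fracPow K ϖ n := by
  have hw : algebraMap R K ϖ ≠ 0 := algebraMap_irreducible_ne_zero hϖ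
  rw [mem_fracPow, mem_fracPow]
  refine exists_congr fun a => ?_
  rw [zpow_sub₀ hw, zpow_add₀ hw]
  have hx := zpow_ne_zero x hw
  have hy := zpow_ne_zero y hw
  field_simp

theorem exists_conj_stdOrderSet (hϖ : Irreducible ϖ) {p : ℕ} {m : Fin p → Fin p → ℤ}
    (h0 : ∀ i, m i i = 0) (htri : ∀ i j l, m i l ≤ m i j + m j l)
    (hle : ∀ i j, m i j + m j i ≤ 1) :
    ∃ (r : ℕ) (pvec : Fin r → ℕ), (∀ j, 0 < pvec j) ∧ (∑ j, pvec j = p) ∧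
      ∃ β : Fin p → Fin r, IsBlockIndex pvec β ∧ ∃ S : (Matrix (Fin p) (Fin p) K)ˣ,
        ∀ M, M ∈ stdOrderSet R K (IsLocalRing.maximalIdeal R) β ↔
          (S : Matrix (Fin p) (Fin p) K) * M * (S⁻¹ : (Matrix (Fin p) (Fin p) K)ˣ) ∈
            exponentSet K ϖ m := by
  obtain ⟨x, g, hg⟩ := exists_normalization h0 htri hle
  obtain ⟨r, pvec, hpos, hsum, β, hβ, hlt⟩ :=
    exists_isBlockIndex_of_monotone (g ∘ Tuple.sort g) (Tuple.monotone_sort g)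
  refine ⟨r, pvec, hpos, hsum, β, hβ, monomialUnit
    (fun i => algebraMap R K ϖ ^ (-x (Tuple.sort g i)))
    (fun i => zpow_ne_zero _ (algebraMap_irreducible_ne_zero hϖ)) (Tuple.sort g), fun M => ?_⟩
  rw [stdOrderSet_eq_exponentSet hϖ]
  have hperm : ∀ A : Matrix (Fin p) (Fin p) K, A ∈ exponentSet K ϖ m ↔
      ∀ i j, A (Tuple.sort g i) (Tuple.sort g j) ∈
        fracPow K ϖ (m (Tuple.sort g i) (Tuple.sort g j)) := fun A =>
    ⟨fun h i j => h _ _, fun h i j => by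
      simpa using h ((Tuple.sort g).symm i) ((Tuple.sort g).symm j)⟩
  rw [hperm]
  refine forall₂_congr fun i j => ?_
  rw [monomialUnit_conj_apply, ← zpow_conj_mem_fracPow hϖ (x := -x (Tuple.sort g i))
    (y := -x (Tuple.sort g j)), hg]
  simp only [hlt, Function.comp_apply, sub_neg_eq_add, ← sub_eq_add_neg]

theorem exists_cyclic_shift_of_conj {p r r' : ℕ} {pvec : Fin r → ℕ} {pvec' : Fin r' → ℕ}
    (hpos : ∀ j, 0 < pvec j) (hpos' : ∀ j, 0 < pvec' j) (hsum : ∑ j, pvec j = p)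
    (hsum' : ∑ j, pvec' j = p) {β : Fin p → Fin r} {β' : Fin p → Fin r'}
    (hβ : IsBlockIndex pvec β) (hβ' : IsBlockIndex pvec' β') (u : (Matrix (Fin p) (Fin p) K)ˣ)
    (hu : ∀ M, M ∈ stdOrderSet R K (IsLocalRing.maximalIdeal R) β' ↔
      (u : Matrix (Fin p) (Fin p) K) * M * (u⁻¹ : (Matrix (Fin p) (Fin p) K)ˣ) ∈
        stdOrderSet R K (IsLocalRing.maximalIdeal R) β) :
    ∃ (h : r' = r) (c : ℕ), ∀ j : Fin r',
      pvec' j = pvec ⟨((j : ℕ) + c) % r, Nat.mod_lt _ (h ▸ j.pos)⟩ := by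
  obtain ⟨ϖ, hϖ⟩ := IsDiscreteValuationRing.exists_irreducible R
  simp only [stdOrderSet_eq_exponentSet hϖ] at hu
  obtain ⟨τ, x, hτ⟩ := exists_perm_of_conj hϖ (by simp) (fun i j l => by split_ifs <;> omega)
    (fun i j => by split_ifs <;> simp) (by simp) u hu
  obtain ⟨rfl, c, hc⟩ := exists_cyclic_shift (hβ.surjective hsum hpos)
    (hβ'.surjective hsum' hpos') τ x hτ
  refine ⟨rfl, c, fun j => ?_⟩
  rw [← hβ.card_fiber hsum, ← hβ'.card_fiber hsum']
  refine Finset.card_bij (fun i _ => τ i) (fun i hi => ?_) (fun a _ b _ h => τ.injective h)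
    fun i hi => ⟨τ.symm i, ?_, τ.apply_symm_apply i⟩
  · simp only [Finset.mem_filter, Finset.mem_univ, true_and] at hi ⊢
    exact Fin.ext (by rw [hc, hi])
  · simp only [Finset.mem_filter, Finset.mem_univ, true_and] at hi ⊢
    have h1 := hc (τ.symm i)
    rw [τ.apply_symm_apply, hi] at h1
    have h2 : (j : ℕ) ≡ β' (τ.symm i) [MOD r'] := Nat.ModEq.add_right_cancel' c h1
    exact Fin.ext (Nat.ModEq.eq_of_lt_of_lt h2 j.isLt (β' (τ.symm i)).isLt).symm

end Normalization

theorem mem_image_conj_iff {M : Type*} [Monoid M] (S : Mˣ) (Q : Set M) (a : M) :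
    a ∈ (fun x => (S : M) * x * (S⁻¹ : Mˣ)) '' Q ↔ (S⁻¹ : Mˣ) * a * (S : M) ∈ Q := by
  constructor
  · rintro ⟨x, hx, rfl⟩
    simpa [mul_assoc] using hx
  · intro h
    exact ⟨_, h, by simp [mul_assoc]⟩

/-- Over `R = k⟦w⟧` (`k` algebraically closed) with fraction field
`K = k((w))`, every hereditary `R`-order `H` in `Mat_p(K)` is conjugate to a standard
order `H(R, p⃗)` by some `S ∈ GL_p(K)`, and the tuple `p⃗` is unique up to cyclic
permutation. -/
theorem statement4 {k : Type*} [Field k] [IsAlgClosed k] {p : ℕ}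
    (H : Subalgebra (PowerSeries k) (Matrix (Fin p) (Fin p) (LaurentSeries k)))
    (hfin : Module.Finite (PowerSeries k) H)
    (hspan : Submodule.span (LaurentSeries k)
        (H : Set (Matrix (Fin p) (Fin p) (LaurentSeries k))) = ⊤)
    (hher : ∀ I : Ideal H, Module.Projective H I) :
    ∃ (r : ℕ) (pvec : Fin r → ℕ), (∀ j, 0 < pvec j) ∧ (∑ j, pvec j = p) ∧
      ∃ (β : Fin p → Fin r), IsBlockIndex pvec β ∧
        (∃ S : (Matrix (Fin p) (Fin p) (LaurentSeries k))ˣ,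
          (H : Set (Matrix (Fin p) (Fin p) (LaurentSeries k))) =
            (fun M => (S : Matrix (Fin p) (Fin p) (LaurentSeries k)) * M *
                ((S⁻¹ : _ˣ) : Matrix (Fin p) (Fin p) (LaurentSeries k))) ''
              stdOrderSet (PowerSeries k) (LaurentSeries k)
                (IsLocalRing.maximalIdeal (PowerSeries k)) β) ∧
        -- uniqueness of `p⃗` up to cyclic permutation
        ∀ (r' : ℕ) (pvec' : Fin r' → ℕ), (∀ j, 0 < pvec' j) → (∑ j, pvec' j = p) →
          ∀ (β' : Fin p → Fin r'), IsBlockIndex pvec' β' →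
          ∀ S' : (Matrix (Fin p) (Fin p) (LaurentSeries k))ˣ,
            (H : Set (Matrix (Fin p) (Fin p) (LaurentSeries k))) =
              (fun M => (S' : Matrix (Fin p) (Fin p) (LaurentSeries k)) * M *
                  ((S'⁻¹ : _ˣ) : Matrix (Fin p) (Fin p) (LaurentSeries k))) ''
                stdOrderSet (PowerSeries k) (LaurentSeries k)
                  (IsLocalRing.maximalIdeal (PowerSeries k)) β' →
            ∃ (h : r' = r) (c : ℕ), ∀ j : Fin r',
              pvec' j = pvec ⟨((j : ℕ) + c) % r, Nat.mod_lt _ (h ▸ j.pos)⟩ := by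
  obtain ⟨ϖ, hϖ⟩ := IsDiscreteValuationRing.exists_irreducible (PowerSeries k)
  obtain ⟨m, h0, htri, hle, B, hB⟩ := exists_conj_exponentSet hϖ hspan hfin hher
  obtain ⟨r, pvec, hpos, hsum, β, hβ, S, hS⟩ :=
    exists_conj_stdOrderSet (K := LaurentSeries k) hϖ h0 htri hle
  have hH : (H : Set (Matrix (Fin p) (Fin p) (LaurentSeries k))) =
      (fun M => ((B⁻¹ * S : (Matrix (Fin p) (Fin p) (LaurentSeries k))ˣ) :
          Matrix (Fin p) (Fin p) (LaurentSeries k)) * M *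
        (((B⁻¹ * S)⁻¹ : (Matrix (Fin p) (Fin p) (LaurentSeries k))ˣ) :
          Matrix (Fin p) (Fin p) (LaurentSeries k))) ''
        stdOrderSet (PowerSeries k) (LaurentSeries k)
          (IsLocalRing.maximalIdeal (PowerSeries k)) β := by
    ext A
    rw [mem_image_conj_iff, hS, SetLike.mem_coe, hB]
    simp [mul_assoc]
  refine ⟨r, pvec, hpos, hsum, β, hβ, ⟨B⁻¹ * S, hH⟩, ?_⟩
  intro r' pvec' hpos' hsum' β' hβ' S' hS'
  refine exists_cyclic_shift_of_conj (R := PowerSeries k) (K := LaurentSeries k) hpos hpos' hsum hsum' hβ hβ'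
    ((B⁻¹ * S)⁻¹ * S') fun M => ?_
  generalize B⁻¹ * S = T at hH
  have h1 := Set.ext_iff.1 (hS'.symm.trans hH) (S'.val * M * S'⁻¹.val)
  rw [mem_image_conj_iff, mem_image_conj_iff] at h1
  simpa [mul_assoc] using h1
end

section
/- Let k be an algebraically closed field and R = k⟦w⟧ the formal power series ring with field of fractions K = k((w)). Let H be an R-algebra that is finitely generated and torsion-free as an R-module, such that K ⊗_R H is a semisimple ring and H is left hereditary (every left ideal of H is projective as a left H-module). Then there exist s ≥ 1 and tuples p⃗₁,…,p⃗_s of positive integers together with a ring isomorphism H ≅ H(R, p⃗₁) × ⋯ × H(R, p⃗_s), a product of standard orders over R. -/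
set_option synthInstance.maxHeartbeats 1000000
set_option maxHeartbeats 1000000

open scoped TensorProduct

theorem IsPrecomplete.of_finite {R M : Type*} [CommRing R] [AddCommGroup M] [Module R M]
    (I : Ideal R) [IsPrecomplete I R] [Module.Finite R M] : IsPrecomplete I M := by
  rw [← AdicCompletion.of_surjective_iff]
  intro z
  obtain ⟨u, rfl⟩ := AdicCompletion.ofTensorProduct_surjective_of_finite I M z
  induction u with
  | zero => exact ⟨0, by simp⟩
  | tmul a x =>
    obtain ⟨r, rfl⟩ := AdicCompletion.of_surjective I R a
    refine ⟨r • x, ?_⟩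
    rw [AdicCompletion.ofTensorProduct_tmul]
    ext n
    simp only [map_smul, AdicCompletion.smul_eval]
    rfl
  | add a b ha hb =>
    obtain ⟨x, hx⟩ := ha
    obtain ⟨y, hy⟩ := hb
    exact ⟨x + y, by rw [map_add, map_add, hx, hy]⟩

/-- A form of Fitting's lemma: in a domain that is finite over a complete Noetherian ring with
Artinian reduction, every element is a unit or topologically nilpotent. -/
theorem isUnit_or_pow_mem_map_of_isAdicComplete {R B : Type*} [CommRing R] [CommRing B] [IsDomain B]
    [Algebra R B] [IsNoetherianRing R] [Module.Finite R B] (I : Ideal R) [IsAdicComplete I R]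
    [IsArtinianRing (R ⧸ I)] (b : B) :
    IsUnit b ∨ ∃ n, b ^ n ∈ I.map (algebraMap R B) := by
  set J := I.map (algebraMap R B) with hJ
  have hhaus : IsHausdorff I B :=
    IsHausdorff.of_le_jacobson I B (IsAdicComplete.le_jacobson_bot I)
  have hprec : IsPrecomplete I B := IsPrecomplete.of_finite I
  have hc : IsAdicComplete J B :=
    { toIsHausdorff := IsHausdorff.map_algebraMap_iff.mpr hhaus
      toIsPrecomplete := IsPrecomplete.map_algebraMap_iff.mpr hprec }
  have hart : IsArtinianRing (B ⧸ J) := by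
    have : Module.Finite (R ⧸ I) (B ⧸ J) := Module.Finite.of_restrictScalars_finite R _ _
    exact IsArtinianRing.of_finite (R ⧸ I) (B ⧸ J)
  have hjac : J ≤ Ideal.jacobson ⊥ := IsAdicComplete.le_jacobson_bot J
  have hunit : ∀ x y : B, x - y ∈ J → IsUnit y → IsUnit x := by
    intro x y hxy hy
    obtain ⟨v, hv⟩ := hy.exists_right_inv
    have h2 := Ideal.mem_jacobson_bot.mp (hjac hxy) v
    rw [sub_mul, hv, sub_add_cancel] at h2
    exact isUnit_of_mul_isUnit_left h2
  obtain ⟨n, c, hn⟩ := IsArtinian.exists_pow_succ_smul_dvd (Ideal.Quotient.mk J b) (1 : B ⧸ J)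
  obtain ⟨c, rfl⟩ := Ideal.Quotient.mk_surjective c
  simp only [smul_eq_mul, mul_one] at hn
  have hm : ∀ m, Ideal.Quotient.mk J b ^ (n + m) * Ideal.Quotient.mk J c ^ m =
      Ideal.Quotient.mk J b ^ n := by
    intro m
    induction m with
    | zero => simp
    | succ m ih =>
      calc _ = Ideal.Quotient.mk J b ^ n.succ * Ideal.Quotient.mk J c *
            (Ideal.Quotient.mk J b ^ m * Ideal.Quotient.mk J c ^ m) := by
              rw [Nat.succ_eq_add_one]; ring
        _ = _ := by rw [hn, ← mul_assoc, ← pow_add, ih]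
  set u := b ^ n * c ^ n with hu
  have h1 : b ^ n * u - b ^ n ∈ J := by
    rw [← Ideal.Quotient.eq, map_mul, map_mul, map_pow, map_pow, ← mul_assoc, ← pow_add, hm n]
  have h2 : u ^ 2 - u ∈ J := by
    have : u ^ 2 - u = (b ^ n * u - b ^ n) * c ^ n := by rw [hu]; ring
    rw [this]
    exact J.mul_mem_right _ h1
  obtain ⟨a, ha, hau⟩ := HenselianRing.is_henselian (I := J) (Polynomial.X ^ 2 - Polynomial.X)
    (by monicity!) u (by simpa using h2) (by
      refine IsUnit.of_mul_eq_one (Ideal.Quotient.mk J (2 * u - 1)) ?_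
      simp only [Polynomial.derivative_sub, Polynomial.derivative_X_pow, Polynomial.derivative_X]
      rw [← map_mul, ← map_one (Ideal.Quotient.mk J), Ideal.Quotient.eq]
      have : (2 * u - 1) * (2 * u - 1) - 1 = 4 * (u ^ 2 - u) := by ring
      simpa [this] using J.mul_mem_left 4 h2)
  have ha' : a * (a - 1) = 0 := by
    have := ha
    simp only [Polynomial.IsRoot, Polynomial.eval_sub, Polynomial.eval_pow,
      Polynomial.eval_X] at this
    linear_combination this
  rcases mul_eq_zero.mp ha' with h0 | h0
  · right
    refine ⟨n, ?_⟩
    have hu' : u ∈ J := by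
      rw [h0, zero_sub] at hau
      exact neg_mem_iff.mp hau
    have := J.sub_mem (J.mul_mem_left (b ^ n) hu') h1
    simpa using this
  · left
    have h3 : IsUnit u := hunit u 1 (by
      rw [sub_eq_zero.mp h0] at hau
      exact neg_mem_iff.mp (by simpa using hau)) isUnit_one
    have h4 : IsUnit (b ^ n) := isUnit_of_mul_isUnit_left h3
    rcases Nat.eq_zero_or_pos n with rfl | hpos
    · simp only [pow_one, pow_zero] at hn
      have : b * c - 1 ∈ J := by
        rw [← Ideal.Quotient.eq]; simpa using hn
      exact isUnit_of_mul_isUnit_left (hunit _ _ this isUnit_one)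
    · exact (isUnit_pow_iff hpos.ne').mp h4

/-- A noncommutative version of `isUnit_or_pow_mem_map_of_isAdicComplete`. -/
theorem isUnit_or_pow_eq_smul {R S : Type*} [CommRing R] [Ring S] [Nontrivial S] [NoZeroDivisors S]
    [Algebra R S] [IsNoetherianRing R] [Module.Finite R S] (w : R)
    [IsAdicComplete (Ideal.span {w}) R] [IsArtinianRing (R ⧸ Ideal.span {w})] (x : S) :
    IsUnit x ∨ ∃ n y, x ^ n = w • y := by
  have : IsMulCommutative (Algebra.adjoin R {x}) := Algebra.isMulCommutative_adjoin R (by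
    rintro a rfl b rfl; rfl)
  have : IsDomain (Algebra.adjoin R {x}) := NoZeroDivisors.to_isDomain _
  have : Module.Finite R (Algebra.adjoin R {x}) :=
    Module.IsNoetherian.finite R (Subalgebra.toSubmodule (Algebra.adjoin R {x}))
  rcases isUnit_or_pow_mem_map_of_isAdicComplete (Ideal.span {w})
    (⟨x, Algebra.self_mem_adjoin_singleton R x⟩ : Algebra.adjoin R {x}) with h | ⟨n, hn⟩
  · left
    exact h.map (Algebra.adjoin R {x}).val
  · right
    rw [Ideal.map_span, Set.image_singleton, Ideal.mem_span_singleton] at hn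
    obtain ⟨y, hy⟩ := hn
    refine ⟨n, y, ?_⟩
    have := congrArg (Algebra.adjoin R {x}).val hy
    rw [map_mul, map_pow, AlgHom.commutes, ← Algebra.smul_def] at this
    exact this

theorem isUnit_one_sub_smul {R S : Type*} [CommRing R] [Ring S] [Nontrivial S] [NoZeroDivisors S]
    [Algebra R S] [IsNoetherianRing R] [Module.Finite R S] (w : R)
    [IsAdicComplete (Ideal.span {w}) R] [IsArtinianRing (R ⧸ Ideal.span {w})] (y : S) :
    IsUnit (1 - w • y) := by
  have h : (⊤ : Submodule R S) ≤ LinearMap.range (LinearMap.mulLeft R (1 - w • y)) := by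
    refine Submodule.le_of_le_smul_of_le_jacobson_bot Module.Finite.fg_top
      (IsAdicComplete.le_jacobson_bot (Ideal.span {w})) fun x _ => ?_
    rw [show x = (1 - w • y) * x + w • (y * x) by rw [sub_mul, one_mul, smul_mul_assoc]; abel]
    exact Submodule.add_mem_sup ⟨x, rfl⟩
      (Submodule.smul_mem_smul (Ideal.mem_span_singleton_self w) trivial)
  obtain ⟨z, hz⟩ := h (x := 1) trivial
  exact IsUnit.of_mul_eq_one z hz

theorem isUnit_or_isUnit_one_sub {R S : Type*} [CommRing R] [Ring S] [Nontrivial S]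
    [NoZeroDivisors S]
    [Algebra R S] [IsNoetherianRing R] [Module.Finite R S] (w : R)
    [IsAdicComplete (Ideal.span {w}) R] [IsArtinianRing (R ⧸ Ideal.span {w})] (x : S) :
    IsUnit x ∨ IsUnit (1 - x) := by
  refine (isUnit_or_pow_eq_smul w x).imp_right ?_
  rintro ⟨n, y, hy⟩
  have h1 := isUnit_one_sub_smul w y
  rw [← hy, ← mul_neg_geom_sum] at h1
  exact isUnit_of_mul_isUnit_left h1

theorem mem_span_singleton_pow_smul_top {R M : Type*} [CommRing R] [AddCommGroup M] [Module R M]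
    {w : R} {n : ℕ} {x : M} :
    x ∈ (Ideal.span {w} ^ n • ⊤ : Submodule R M) ↔ ∃ y, x = w ^ n • y := by
  rw [Ideal.span_singleton_pow, Submodule.ideal_span_singleton_smul,
    Submodule.mem_smul_pointwise_iff_exists]
  simp [eq_comm]

instance PowerSeries.isArtinianRing_quotient_span_X (k : Type*) [Field k] :
    IsArtinianRing (PowerSeries k ⧸ Ideal.span {(PowerSeries.X : PowerSeries k)}) := by
  have h : (Ideal.span {(PowerSeries.X : PowerSeries k)}).IsMaximal := by
    rw [← PowerSeries.maximalIdeal_eq_span_X]; infer_instance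
  let := Ideal.Quotient.field (Ideal.span {(PowerSeries.X : PowerSeries k)})
  infer_instance

/-- A commutative domain, finite over `k⟦X⟧`, whose elements all expand as power series in a
nonzero nonunit `t` with coefficients in `k`, is isomorphic to `k⟦X⟧`. -/
theorem exists_ringEquiv_powerSeries_of_expansion {k S : Type*} [Field k] [CommRing S] [IsDomain S]
    [Algebra (PowerSeries k) S] [Module.Finite (PowerSeries k) S] {t : S} (ht0 : t ≠ 0)
    (ht : ¬ IsUnit t)
    (hdec : ∀ x : S, ∃ (c : k) (z : S), x = algebraMap (PowerSeries k) S (PowerSeries.C c) + z * t)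
    {N : ℕ} {β : S} (hN : t ^ N = (PowerSeries.X : PowerSeries k) • β) :
    ∃ σ : S ≃+* PowerSeries k,
      ∀ c : k, σ (algebraMap (PowerSeries k) S (PowerSeries.C c)) = PowerSeries.C c := by
  set i : k →+* S := (algebraMap (PowerSeries k) S).comp PowerSeries.C with hi
  change ∀ x : S, ∃ (c : k) (z : S), x = i c + z * t at hdec
  choose c s hcs using hdec
  have huniq : ∀ {a b : k} {y z : S}, i a + y * t = i b + z * t → a = b ∧ y = z := by
    intro a b y z h
    have hab : a = b := by
      by_contra hne
      have h1 : i (a - b) = (z - y) * t := by rw [map_sub]; linear_combination h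
      have h2 : IsUnit (i (a - b)) := (IsUnit.mk0 _ (sub_ne_zero.mpr hne)).map i
      rw [h1] at h2
      exact ht (isUnit_of_mul_isUnit_right h2)
    subst hab
    exact ⟨rfl, mul_right_cancel₀ ht0 (add_left_cancel h)⟩
  have hi' : ∀ a, c (i a) = a ∧ s (i a) = 0 := fun a =>
    huniq (by rw [← hcs]; ring)
  have hadd : ∀ x y, c (x + y) = c x + c y ∧ s (x + y) = s x + s y := fun x y =>
    huniq (by rw [← hcs, map_add]; linear_combination hcs x + hcs y)
  have hmul : ∀ x y, c (x * y) = c x * c y ∧ s (x * y) = i (c x) * s y + s x * y := fun x y =>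
    huniq (by
      rw [← hcs, map_mul]
      linear_combination y * hcs x + i (c x) * hcs y)
  let Φ : S → PowerSeries k := fun x => PowerSeries.mk fun n => c (s^[n] x)
  have hΦ0 : ∀ x, PowerSeries.coeff 0 (Φ x) = c x := fun x => by simp [Φ]
  have hΦs : ∀ n x, PowerSeries.coeff (n + 1) (Φ x) = PowerSeries.coeff n (Φ (s x)) := fun n x => by
    simp [Φ, Function.iterate_succ_apply]
  have hΦeq : ∀ x, Φ x = PowerSeries.C (c x) + PowerSeries.X * Φ (s x) := by
    intro x
    ext n
    rcases n with _ | n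
    · simp [hΦ0]
    · simp [hΦs, PowerSeries.coeff_succ_X_mul]
  have hΦadd : ∀ x y, Φ (x + y) = Φ x + Φ y := by
    intro x y
    ext n
    induction n generalizing x y with
    | zero => simp only [map_add, hΦ0, (hadd x y).1]
    | succ n ih => simp only [map_add, hΦs, (hadd x y).2, ih]
  have hΦzero : Φ 0 = 0 := by simpa using hΦadd 0 0
  have hΦi : ∀ a, Φ (i a) = PowerSeries.C a := by
    intro a
    rw [hΦeq, (hi' a).1, (hi' a).2, hΦzero, mul_zero, add_zero]
  have hΦmul : ∀ x y, Φ (x * y) = Φ x * Φ y := by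
    intro x y
    ext n
    induction n generalizing x y with
    | zero => simp [PowerSeries.coeff_mul, hΦ0, (hmul x y).1]
    | succ n ih =>
      rw [hΦs, (hmul x y).2, hΦadd, map_add, ih, ih, hΦi, hΦeq x, add_mul, map_add, mul_assoc,
        PowerSeries.coeff_succ_X_mul, PowerSeries.coeff_C_mul, PowerSeries.coeff_C_mul, hΦs]
  let Ψ : S →+* PowerSeries k :=
    { toFun := Φ
      map_one' := by rw [← map_one i, hΦi, map_one]
      map_mul' := hΦmul
      map_zero' := hΦzero
      map_add' := hΦadd }
  have hΨi : ∀ a, Ψ (i a) = PowerSeries.C a := hΦi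
  have hΨt : Ψ t = PowerSeries.X := by
    have h1 : c t = 0 ∧ s t = 1 := huniq (by rw [← hcs]; simp)
    change Φ t = _
    rw [hΦeq, h1.1, h1.2, ← map_one i, hΦi]; simp
  have hwX : (PowerSeries.X : PowerSeries k) ∣ Ψ (algebraMap (PowerSeries k) S PowerSeries.X) := by
    rw [PowerSeries.X_dvd_iff, ← PowerSeries.coeff_zero_eq_constantCoeff_apply]
    change PowerSeries.coeff 0 (Φ _) = 0
    rw [hΦ0]
    by_contra hne
    have h1 := hcs (algebraMap (PowerSeries k) S PowerSeries.X)
    set a := c (algebraMap (PowerSeries k) S PowerSeries.X)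
    have h2 := isUnit_one_sub_smul (PowerSeries.X : PowerSeries k) (i a⁻¹)
    rw [Algebra.smul_def, h1, add_mul, ← map_mul, mul_inv_cancel₀ hne, map_one,
      sub_add_cancel_left, mul_right_comm, IsUnit.neg_iff] at h2
    exact ht (isUnit_of_mul_isUnit_right h2)
  have hN0 : 1 ≤ N := by
    by_contra h
    have h1 := isUnit_one_sub_smul (PowerSeries.X : PowerSeries k) β
    rw [← hN, Nat.eq_zero_of_not_pos h, pow_zero, sub_self] at h1
    exact not_isUnit_zero h1
  have hpow : ∀ m z, t ^ (N * m) * z = (PowerSeries.X : PowerSeries k) ^ m • (β ^ m * z) := by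
    intro m z
    rw [pow_mul, hN, smul_pow, smul_mul_assoc]
  have hhaus : IsHausdorff (Ideal.span {(PowerSeries.X : PowerSeries k)}) S :=
    IsHausdorff.of_le_jacobson _ S (IsAdicComplete.le_jacobson_bot _)
  have hprec : IsPrecomplete (Ideal.span {(PowerSeries.X : PowerSeries k)}) S :=
    IsPrecomplete.of_finite _
  have hinj : Function.Injective Ψ := by
    rw [injective_iff_map_eq_zero]
    intro x hx
    refine hhaus.haus x fun m => ?_
    rw [SModEq.zero, mem_span_singleton_pow_smul_top]
    have h1 : ∀ n, x = t ^ n * s^[n] x := by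
      intro n
      induction n with
      | zero => simp
      | succ n ih =>
        have h2 : c (s^[n] x) = 0 := by
          have := congrArg (PowerSeries.coeff n) hx
          simpa [Ψ, Φ] using this
        have h3 := hcs (s^[n] x)
        rw [h2, map_zero, zero_add, ← Function.iterate_succ_apply' s] at h3
        rw [h3] at ih
        linear_combination ih
    exact ⟨_, (h1 (N * m)).trans (hpow m _)⟩
  have hsurj : Function.Surjective Ψ := by
    intro f
    let q : ℕ → S := fun n => ∑ j ∈ Finset.range n, i (PowerSeries.coeff j f) * t ^ j
    have hq : ∀ n d, ∃ z, q (n + d) = q n + t ^ n * z := by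
      intro n d
      refine ⟨∑ j ∈ Finset.range d, i (PowerSeries.coeff (n + j) f) * t ^ j, ?_⟩
      simp only [q]
      rw [Finset.sum_range_add, Finset.mul_sum]
      congr 1
      refine Finset.sum_congr rfl fun j _ => ?_
      rw [pow_add]; ring
    obtain ⟨L, hL⟩ := hprec.prec (f := fun m => q (N * m)) (by
      intro m n hmn
      obtain ⟨d, rfl⟩ := Nat.exists_eq_add_of_le hmn
      obtain ⟨z, hz⟩ := hq (N * m) (N * d)
      rw [SModEq.sub_mem, mem_span_singleton_pow_smul_top]
      refine ⟨β ^ m * -z, ?_⟩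
      rw [← hpow, mul_add, hz]; ring)
    refine ⟨L, ?_⟩
    ext n
    have h1 := hL (n + 1)
    rw [SModEq.sub_mem, mem_span_singleton_pow_smul_top] at h1
    obtain ⟨y, hy⟩ := h1
    have hlt : n < N * (n + 1) := lt_of_lt_of_le n.lt_succ_self (Nat.le_mul_of_pos_left _ hN0)
    have h2 : PowerSeries.coeff n (Ψ (q (N * (n + 1)))) = PowerSeries.coeff n f := by
      simp only [q, map_sum, map_mul, hΨi, map_pow, hΨt, PowerSeries.coeff_C_mul,
        PowerSeries.coeff_X_pow]
      simp [hlt]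
    have h3 : PowerSeries.coeff n (Ψ (q (N * (n + 1)) - L)) = 0 := by
      rw [hy, Algebra.smul_def, map_mul, map_pow, map_pow]
      exact PowerSeries.X_pow_dvd_iff.mp ((pow_dvd_pow_of_dvd hwX _).mul_right _) n n.lt_succ_self
    rw [map_sub, map_sub, h2, sub_eq_zero] at h3
    exact h3.symm
  exact ⟨RingEquiv.ofBijective Ψ ⟨hinj, hsurj⟩, hΨi⟩

/-- Over an algebraically closed residue field, each element of a finite domain is a nonunit up to
a constant. -/
theorem exists_not_isUnit_sub_C {k S : Type*} [Field k] [IsAlgClosed k] [Ring S] [Nontrivial S]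
    [NoZeroDivisors S] [Algebra (PowerSeries k) S] [Module.Finite (PowerSeries k) S] (x : S) :
    ∃ c : k, ¬ IsUnit (x - algebraMap (PowerSeries k) S (PowerSeries.C c)) := by
  by_contra! hx
  obtain ⟨p, hp, hpx⟩ := Algebra.IsIntegral.isIntegral (R := PowerSeries k) x
  set q : Polynomial k := p.map PowerSeries.constantCoeff with hq
  have hu : ∀ s : Multiset k, IsUnit (Polynomial.aeval x
      ((s.map fun c => (Polynomial.X - Polynomial.C c)).prod.map
        (PowerSeries.C : k →+* PowerSeries k))) := by
    intro s
    induction s using Multiset.induction with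
    | empty => simp
    | cons a s ih =>
      rw [Multiset.map_cons, Multiset.prod_cons, Polynomial.map_mul, map_mul]
      refine IsUnit.mul ?_ ih
      simpa using hx a
  have hq1 : q.Monic := hp.map _
  have h1 := hu q.roots
  rw [← (IsAlgClosed.splits q).eq_prod_roots_of_monic hq1] at h1
  have h2 : Polynomial.C (PowerSeries.X : PowerSeries k) ∣ p - q.map PowerSeries.C := by
    rw [Polynomial.C_dvd_iff_dvd_coeff]
    intro n
    rw [PowerSeries.X_dvd_iff]
    simp [hq]
  obtain ⟨g, hg⟩ := h2
  have h3 : Polynomial.aeval x (q.map (PowerSeries.C : k →+* PowerSeries k)) =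
      (PowerSeries.X : PowerSeries k) • -Polynomial.aeval x g := by
    have h4 := congrArg (Polynomial.aeval x) hg
    have h5 : Polynomial.aeval x p = 0 := hpx
    rw [map_sub, h5, zero_sub, map_mul, Polynomial.aeval_C, ← Algebra.smul_def] at h4
    rw [smul_neg, ← h4, neg_neg]
  rw [h3] at h1
  obtain ⟨z, hz⟩ := h1.exists_right_inv
  have h6 := isUnit_one_sub_smul (PowerSeries.X : PowerSeries k) (-Polynomial.aeval x g * z)
  rw [← smul_mul_assoc, hz, sub_self] at h6
  exact not_isUnit_zero h6

/-- A noncommutative domain, finite and torsion-free over `k⟦X⟧` with `k` algebraically closed,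
whose left ideals form a chain is isomorphic to `k⟦X⟧`. -/
theorem exists_ringEquiv_powerSeries_of_chain {k S : Type*} [Field k] [IsAlgClosed k] [Ring S]
    [Nontrivial S] [NoZeroDivisors S] [Algebra (PowerSeries k) S] [Module.Finite (PowerSeries k) S]
    (hinj : Function.Injective (algebraMap (PowerSeries k) S))
    (hchain : ∀ x y : S, (∃ z, x = z * y) ∨ ∃ z, y = z * x) :
    ∃ σ : S ≃+* PowerSeries k,
      ∀ c : k, σ (algebraMap (PowerSeries k) S (PowerSeries.C c)) = PowerSeries.C c := by
  have hnoeth : IsNoetherianRing S := IsNoetherianRing.of_finite (PowerSeries k) S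
  obtain ⟨_, ⟨t, ht, rfl⟩, hmax⟩ := set_has_maximal_iff_noetherian.mpr hnoeth
    {I : Ideal S | ∃ t : S, ¬ IsUnit t ∧ Ideal.span {t} = I} ⟨_, 0, not_isUnit_zero, rfl⟩
  have hdvd : ∀ y : S, ¬ IsUnit y → ∃ z, y = z * t := by
    intro y hy
    rcases hchain y t with h | ⟨z, hz⟩
    · exact h
    · have hle : Ideal.span {t} ≤ Ideal.span {y} := by
        rw [Ideal.span_singleton_le_iff_mem, Ideal.mem_span_singleton']
        exact ⟨z, hz.symm⟩
      have heq := eq_of_le_of_not_lt hle (hmax _ ⟨y, hy, rfl⟩)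
      have hmem : y ∈ Ideal.span {t} := heq ▸ Ideal.mem_span_singleton_self y
      obtain ⟨z, hz⟩ := Ideal.mem_span_singleton'.mp hmem
      exact ⟨z, hz.symm⟩
  have hX : ¬ IsUnit (algebraMap (PowerSeries k) S PowerSeries.X) := by
    intro h
    obtain ⟨z, hz⟩ := h.exists_right_inv
    have h6 := isUnit_one_sub_smul (PowerSeries.X : PowerSeries k) z
    rw [Algebra.smul_def, hz, sub_self] at h6
    exact not_isUnit_zero h6
  have ht0 : t ≠ 0 := by
    rintro rfl
    obtain ⟨z, hz⟩ := hdvd _ hX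
    rw [mul_zero, map_eq_zero_iff _ hinj] at hz
    exact PowerSeries.X_ne_zero hz
  have hdec : ∀ x : S, ∃ (c : k) (z : S),
      x = algebraMap (PowerSeries k) S (PowerSeries.C c) + z * t := by
    intro x
    obtain ⟨c, hc⟩ := exists_not_isUnit_sub_C (k := k) x
    obtain ⟨z, hz⟩ := hdvd _ hc
    exact ⟨c, z, by rw [← hz]; abel⟩
  obtain ⟨N, β, hN⟩ := (isUnit_or_pow_eq_smul (PowerSeries.X : PowerSeries k) t).resolve_left ht
  have hexp : ∀ (n : ℕ) (x : S), ∃ a ∈ Algebra.adjoin (PowerSeries k) {t}, ∃ z,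
      x = a + z * t ^ n := by
    intro n x
    induction n with
    | zero => exact ⟨0, zero_mem _, x, by simp⟩
    | succ n ih =>
      obtain ⟨a, ha, z, hz⟩ := ih
      obtain ⟨c, y, hy⟩ := hdec z
      refine ⟨a + algebraMap _ S (PowerSeries.C c) * t ^ n, add_mem ha (mul_mem
        (Subalgebra.algebraMap_mem _ _) (pow_mem (Algebra.self_mem_adjoin_singleton _ t) n)), y, ?_⟩
      rw [hz, hy, pow_succ', add_mul, mul_assoc, add_assoc]
  have htop : (⊤ : Submodule (PowerSeries k) S) ≤
      Subalgebra.toSubmodule (Algebra.adjoin (PowerSeries k) {t}) := by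
    refine Submodule.le_of_le_smul_of_le_jacobson_bot Module.Finite.fg_top
      (IsAdicComplete.le_jacobson_bot (Ideal.span {(PowerSeries.X : PowerSeries k)})) fun x _ => ?_
    obtain ⟨a, ha, z, hz⟩ := hexp N x
    rw [hz, hN, mul_smul_comm]
    exact Submodule.add_mem_sup ha
      (Submodule.smul_mem_smul (Ideal.mem_span_singleton_self _) trivial)
  have hcomm : ∀ x y : S, x * y = y * x := by
    have : IsMulCommutative (Algebra.adjoin (PowerSeries k) {t}) :=
      Algebra.isMulCommutative_adjoin _ (by rintro a rfl b rfl; rfl)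
    intro x y
    exact congrArg Subtype.val (mul_comm
      (⟨x, htop trivial⟩ : Algebra.adjoin (PowerSeries k) {t}) ⟨y, htop trivial⟩)
  let : CommRing S := { ‹Ring S› with mul_comm := hcomm }
  have : IsDomain S := NoZeroDivisors.to_isDomain S
  exact exists_ringEquiv_powerSeries_of_expansion ht0 ht hdec hN

/-- A pure left ideal of an order in a semisimple algebra is the left annihilator of an element. -/
theorem exists_mem_iff_mul_eq_zero_of_pure {R K H : Type*} [CommRing R] [IsDomain R] [Field K]
    [Algebra R K] [IsFractionRing R K] [Ring H] [Algebra R H] [Module.Flat R H]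
    [IsSemisimpleRing (K ⊗[R] H)] (I : Ideal H)
    (hI : ∀ (r : R) (x : H), r ≠ 0 → r • x ∈ I → x ∈ I) :
    ∃ h : H, ∀ x, x ∈ I ↔ x * h = 0 := by
  let j : H →ₐ[R] K ⊗[R] H := Algebra.TensorProduct.includeRight
  have hj : Function.Injective j :=
    Algebra.TensorProduct.includeRight_injective (IsFractionRing.injective R K)
  have hden : ∀ a : K ⊗[R] H, ∃ r : R, r ≠ 0 ∧ ∃ h : H, r • a = j h := by
    intro a
    obtain ⟨⟨h, r⟩, hr⟩ := IsLocalizedModule.surj (nonZeroDivisors R) (TensorProduct.mk R K H 1) a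
    exact ⟨r, nonZeroDivisors.ne_zero r.2, h, hr⟩
  have hcancel : ∀ (r : R) (a : K ⊗[R] H), r ≠ 0 → r • a = 0 → a = 0 := by
    intro r a hr h
    have h1 : (algebraMap R K r)⁻¹ • (algebraMap R K r • a) = 0 := by
      rw [algebraMap_smul, h, smul_zero]
    rwa [inv_smul_smul₀ (by simpa using hr)] at h1
  obtain ⟨e, he, hJ⟩ := IsSemisimpleRing.ideal_eq_span_idempotent (Ideal.span (j '' I))
  obtain ⟨r, hr, h, hrh⟩ := hden (1 - e)
  have hspan : ∀ a ∈ Ideal.span (j '' I), ∃ s : R, s ≠ 0 ∧ ∃ y ∈ I, s • a = j y := by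
    intro a ha
    induction ha using Submodule.span_induction with
    | mem a ha =>
      obtain ⟨y, hy, rfl⟩ := ha
      exact ⟨1, one_ne_zero, y, hy, one_smul _ _⟩
    | zero => exact ⟨1, one_ne_zero, 0, I.zero_mem, by simp⟩
    | add a b _ _ iha ihb =>
      obtain ⟨s, hs, y, hy, hsy⟩ := iha
      obtain ⟨s', hs', y', hy', hsy'⟩ := ihb
      refine ⟨s * s', mul_ne_zero hs hs', s' • y + s • y',
        I.add_mem (Submodule.smul_of_tower_mem I s' hy) (Submodule.smul_of_tower_mem I s hy'), ?_⟩
      rw [smul_add, map_add, map_smul, map_smul, ← hsy, ← hsy', smul_smul, smul_smul, mul_comm s' s]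
    | smul b a _ iha =>
      obtain ⟨s, hs, y, hy, hsy⟩ := iha
      obtain ⟨s', hs', z, hz⟩ := hden b
      refine ⟨s' * s, mul_ne_zero hs' hs, z * y, I.mul_mem_left z hy, ?_⟩
      rw [map_mul, ← hsy, ← hz, smul_eq_mul, smul_mul_smul_comm]
  refine ⟨h, fun x => ⟨fun hx => hj ?_, fun hx => ?_⟩⟩
  · have h1 : j x ∈ Ideal.span (j '' I) := Ideal.subset_span ⟨x, hx, rfl⟩
    rw [hJ, Ideal.mem_span_singleton'] at h1
    obtain ⟨a, ha⟩ := h1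
    rw [map_mul, ← hrh, mul_smul_comm, ← ha, mul_assoc, mul_sub, mul_one, he.eq, sub_self, mul_zero,
      smul_zero, map_zero]
  · have h1 : j x * (1 - e) = 0 := by
      refine hcancel r _ hr ?_
      rw [← mul_smul_comm, hrh, ← map_mul, hx, map_zero]
    have h2 : j x ∈ Ideal.span (j '' I) := by
      rw [hJ, Ideal.mem_span_singleton']
      refine ⟨j x, ?_⟩
      rw [mul_sub, mul_one, sub_eq_zero] at h1
      exact h1.symm
    obtain ⟨s, hs, y, hy, hsy⟩ := hspan _ h2
    refine hI s x hs ?_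
    rw [← map_smul] at hsy
    rwa [hj hsy]

/-- In a left hereditary ring, left annihilators of elements are generated by idempotents. -/
theorem exists_isIdempotentElem_of_annihilator {H : Type*} [Ring H]
    (hher : ∀ I : Ideal H, Module.Projective H I) (h : H) :
    ∃ f : H, IsIdempotentElem f ∧ ∀ x, x * h = 0 ↔ x * f = x := by
  have := hher (LinearMap.range (LinearMap.toSpanSingleton H H h))
  obtain ⟨s, hs⟩ := Module.projective_lifting_property
    (LinearMap.toSpanSingleton H H h).rangeRestrict LinearMap.id
    (LinearMap.surjective_rangeRestrict _)
  set g := s ((LinearMap.toSpanSingleton H H h).rangeRestrict 1) with hg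
  have hgh : g * h = h := by
    have h1 := congrArg Subtype.val
      (LinearMap.congr_fun hs ((LinearMap.toSpanSingleton H H h).rangeRestrict 1))
    simpa using h1
  have hx : ∀ x, x * h = 0 → x * (1 - g) = x := by
    intro x hx
    have h1 : x * g = 0 := by
      rw [hg, ← smul_eq_mul, ← map_smul, ← map_smul]
      have h2 : (LinearMap.toSpanSingleton H H h).rangeRestrict (x • 1) = 0 := by
        ext; simpa using hx
      rw [h2, map_zero]
    rw [mul_sub, mul_one, h1, sub_zero]
  have h0 : (1 - g) * h = 0 := by rw [sub_mul, one_mul, hgh, sub_self]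
  exact ⟨1 - g, hx _ h0, fun x => ⟨hx x, fun h2 => by rw [← h2, mul_assoc, h0, mul_zero]⟩⟩

/-- An idempotent is primitive if it is nonzero and its only sub-idempotents are `0` and itself. -/
structure IsPrimitiveIdempotent {H : Type*} [Ring H] (e : H) : Prop where
  idem : IsIdempotentElem e
  ne_zero : e ≠ 0
  eq_or : ∀ f, IsIdempotentElem f → e * f = f → f * e = f → f = 0 ∨ f = e

/-- Hypotheses on an order used throughout: it is torsion-free over `R`, left hereditary,
and its pure left ideals are generated by idempotents. -/
structure IsHereditaryOrder (R H : Type*) [CommRing R] [Ring H] [Algebra R H] : Prop where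
  smul_eq_zero : ∀ (r : R) (x : H), r • x = 0 → r = 0 ∨ x = 0
  projective : ∀ I : Ideal H, Module.Projective H I
  exists_idem : ∀ I : Ideal H, (∀ (r : R) (x : H), r ≠ 0 → r • x ∈ I → x ∈ I) →
    ∃ f : H, IsIdempotentElem f ∧ ∀ x, x ∈ I ↔ x * f = x

theorem IsHereditaryOrder.of_isSemisimpleRing {R K H : Type*} [CommRing R] [IsDomain R] [Field K]
    [Algebra R K] [IsFractionRing R K] [Ring H] [Algebra R H] [Module.Flat R H]
    (htf : NoZeroSMulDivisors R H) [IsSemisimpleRing (K ⊗[R] H)]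
    (hher : ∀ I : Ideal H, Module.Projective H I) : IsHereditaryOrder R H where
  smul_eq_zero _ _ h := htf.eq_zero_or_eq_zero_of_smul_eq_zero h
  projective := hher
  exists_idem I hI := by
    obtain ⟨h, hh⟩ := exists_mem_iff_mul_eq_zero_of_pure (K := K) I hI
    obtain ⟨f, hf, hfh⟩ := exists_isIdempotentElem_of_annihilator hher h
    exact ⟨f, hf, fun x => (hh x).trans (hfh x)⟩

namespace IsPrimitiveIdempotent

variable {R H : Type*} [CommRing R] [IsDomain R] [Ring H] [Algebra R H] {e : H}

theorem exists_smul_mem (he : IsPrimitiveIdempotent e) (hH : IsHereditaryOrder R H) {N : Ideal H}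
    (hN : ∀ x ∈ N, x * e = x) (hN0 : N ≠ ⊥) : ∃ r : R, r ≠ 0 ∧ r • e ∈ N := by
  let N' : Ideal H :=
    { carrier := {x | ∃ r : R, r ≠ 0 ∧ r • x ∈ N}
      zero_mem' := ⟨1, one_ne_zero, by simp⟩
      add_mem' := by
        rintro x y ⟨r, hr, hx⟩ ⟨s, hs, hy⟩
        refine ⟨r * s, mul_ne_zero hr hs, ?_⟩
        rw [smul_add, mul_smul r s y, mul_comm r s, mul_smul s r x]
        exact N.add_mem (Submodule.smul_of_tower_mem N s hx) (Submodule.smul_of_tower_mem N r hy)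
      smul_mem' := by
        rintro a x ⟨r, hr, hx⟩
        exact ⟨r, hr, by rw [smul_comm]; exact N.smul_mem a hx⟩ }
  obtain ⟨f, hf, hN'⟩ := hH.exists_idem N' (by
    rintro r x hr ⟨s, hs, hx⟩
    exact ⟨s * r, mul_ne_zero hs hr, by rwa [mul_smul]⟩)
  have hfe : f * e = f := by
    obtain ⟨r, hr, hx⟩ : f ∈ N' := (hN' f).mpr hf
    have h1 := hN _ hx
    rw [smul_mul_assoc, ← sub_eq_zero, ← smul_sub] at h1
    exact sub_eq_zero.mp ((hH.smul_eq_zero _ _ h1).resolve_left hr)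
  have hff : f * (e * f) = f := by rw [← mul_assoc, hfe, hf.eq]
  rcases he.eq_or (e * f) (by rw [IsIdempotentElem, mul_assoc, hff])
    (by rw [← mul_assoc, he.idem.eq]) (by rw [mul_assoc, hfe]) with h | h
  · rw [h, mul_zero] at hff
    exfalso
    apply hN0
    rw [eq_bot_iff]
    intro x hx
    have h1 := (hN' x).mp ⟨1, one_ne_zero, by rwa [one_smul]⟩
    rw [← hff, mul_zero] at h1
    exact h1.symm
  · exact (hN' e).mpr (by rw [← h, mul_assoc, hf.eq])

theorem eq_zero_of_mul_eq_zero (he : IsPrimitiveIdempotent e) (hH : IsHereditaryOrder R H)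
    {x y : H} (hx : e * x = x) (hx0 : x ≠ 0) (hy : y * e = y) (hyx : y * x = 0) : y = 0 := by
  by_contra hy0
  obtain ⟨r, hr, hre⟩ := he.exists_smul_mem hH (N := Ideal.span {y}) (by
    intro z hz
    obtain ⟨a, rfl⟩ := Ideal.mem_span_singleton'.mp hz
    rw [mul_assoc, hy]) (by simpa using hy0)
  obtain ⟨z, hz⟩ := Ideal.mem_span_singleton'.mp hre
  have h1 : r • x = 0 := by rw [← hx, ← smul_mul_assoc, ← hz, mul_assoc, hyx, mul_zero]
  exact hx0 ((hH.smul_eq_zero _ _ h1).resolve_left hr)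

theorem le_or_le [IsNoetherianRing R] [Module.Finite R H] (w : R)
    [IsAdicComplete (Ideal.span {w}) R] [IsArtinianRing (R ⧸ Ideal.span {w})]
    (he : IsPrimitiveIdempotent e) (hH : IsHereditaryOrder R H) {N₁ N₂ : Ideal H}
    (hN₁ : ∀ x ∈ N₁, x * e = x) (hN₂ : ∀ x ∈ N₂, x * e = x) : N₁ ≤ N₂ ∨ N₂ ≤ N₁ := by
  rcases eq_or_ne (N₁ ⊔ N₂) ⊥ with hbot | hbot
  · left
    rw [(sup_eq_bot_iff.mp hbot).1]
    exact bot_le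
  set N := N₁ ⊔ N₂ with hN
  have hNe : ∀ x ∈ N, x * e = x := by
    intro x hx
    obtain ⟨a, ha, b, hb, rfl⟩ := Submodule.mem_sup.mp hx
    rw [add_mul, hN₁ a ha, hN₂ b hb]
  have hinj : ∀ f : Module.End H N, f ≠ 0 → ∀ n : N, f n = 0 → n = 0 := by
    intro f hf n hfn
    by_contra hn
    apply hf
    obtain ⟨r, hr, hre⟩ := he.exists_smul_mem hH (N := Ideal.span {(n : H)}) (by
      intro z hz
      obtain ⟨a, rfl⟩ := Ideal.mem_span_singleton'.mp hz
      rw [mul_assoc, hNe _ n.2]) (by simpa using hn)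
    obtain ⟨z, hz⟩ := Ideal.mem_span_singleton'.mp hre
    ext m
    have h1 : r • m = ((m : H) * z) • n := by
      ext
      rw [Submodule.coe_smul_of_tower, Submodule.coe_smul, smul_eq_mul, mul_assoc, hz,
        mul_smul_comm, hNe _ m.2]
    have h2 : r • (f m : H) = 0 := by
      rw [← Submodule.coe_smul_of_tower, ← LinearMap.map_smul_of_tower, h1, map_smul, hfn, smul_zero,
        Submodule.coe_zero]
    exact (hH.smul_eq_zero _ _ h2).resolve_left hr
  have : IsNoetherian R H := isNoetherian_of_isNoetherianRing_of_finite R H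
  have : Module.Finite R N := Module.IsNoetherian.finite R (N.restrictScalars R)
  have : Module.Finite R (Module.End H N) :=
    Module.Finite.of_injective (LinearMap.restrictScalarsₗ R H N N R)
      (LinearMap.restrictScalars_injective R)
  have : Nontrivial N := Submodule.nontrivial_iff_ne_bot.mpr hbot
  have : NoZeroDivisors (Module.End H N) := ⟨by
    intro f g hfg
    by_contra! h
    apply h.2
    ext n
    rw [hinj f h.1 (g n) (LinearMap.congr_fun hfg n)]
    rfl⟩
  have := hH.projective N
  let π : N₁ × N₂ →ₗ[H] N := (Submodule.inclusion le_sup_left).coprod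
    (Submodule.inclusion le_sup_right)
  obtain ⟨s, hs⟩ := Module.projective_lifting_property π LinearMap.id (by
    rintro ⟨x, hx⟩
    obtain ⟨a, ha, b, hb, rfl⟩ := Submodule.mem_sup.mp hx
    exact ⟨(⟨a, ha⟩, ⟨b, hb⟩), rfl⟩)
  let f : Module.End H N := Submodule.inclusion le_sup_left ∘ₗ LinearMap.fst H N₁ N₂ ∘ₗ s
  have h1f : ∀ n, ((1 - f) n : H) = (s n).2 := by
    intro n
    have h1 : π (s n) = n := LinearMap.congr_fun hs n
    have h2 := congrArg Subtype.val h1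
    have h3 : ((s n).1 : H) + (s n).2 = n := h2
    change (n : H) - (s n).1 = _
    rw [← h3]; abel
  rcases isUnit_or_isUnit_one_sub w f with h | h
  · right
    intro x hx
    obtain ⟨n, hn⟩ := ((Module.End.isUnit_iff f).mp h).2 ⟨x, le_sup_right (a := N₁) hx⟩
    have h4 := congrArg Subtype.val hn
    rw [← (show ((f n : N) : H) = x from h4)]
    exact (s n).1.2
  · left
    intro x hx
    obtain ⟨n, hn⟩ := ((Module.End.isUnit_iff _).mp h).2 ⟨x, le_sup_left (b := N₂) hx⟩
    have h4 := congrArg Subtype.val hn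
    rw [← (show (((1 - f) n : N) : H) = x from h4), h1f]
    exact (s n).2.2

end IsPrimitiveIdempotent

theorem OrthogonalIdempotents.linearIndependent {R H ι : Type*} [CommRing R] [Ring H] [Algebra R H]
    [Fintype ι] (hR : ∀ (r : R) (x : H), r • x = 0 → r = 0 ∨ x = 0) {e : ι → H}
    (he : OrthogonalIdempotents e) (hne : ∀ i, e i ≠ 0) : LinearIndependent R e := by
  classical
  rw [Fintype.linearIndependent_iff]
  intro c hc j
  have h1 := congrArg (· * e j) hc
  simp only [Finset.sum_mul, smul_mul_assoc, he.mul_eq, zero_mul, smul_ite, smul_zero,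
    Finset.sum_ite_eq', Finset.mem_univ, if_true] at h1
  exact (hR _ _ h1).resolve_right (hne j)

/-- Refining a complete orthogonal family by splitting one of its members. -/
theorem CompleteOrthogonalIdempotents.split {H ι : Type*} [Ring H] [Fintype ι] [DecidableEq ι]
    {e : ι → H} (he : CompleteOrthogonalIdempotents e) (i : ι) {f : H} (hf : IsIdempotentElem f)
    (h1 : e i * f = f) (h2 : f * e i = f) :
    CompleteOrthogonalIdempotents
      (fun o : Option ι => o.elim f (Function.update e i (e i - f))) := by
  have hj : ∀ j, j ≠ i → e j * f = 0 ∧ f * e j = 0 := by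
    intro j hj
    rw [← h1, ← mul_assoc, he.ortho hj, zero_mul, h1, ← h2, mul_assoc, he.ortho hj.symm, mul_zero]
    exact ⟨rfl, rfl⟩
  have hii := (he.idem i).eq
  refine ⟨⟨?_, ?_⟩, ?_⟩
  · rintro (_ | j)
    · exact hf
    · rcases eq_or_ne j i with rfl | hji
      · simp [IsIdempotentElem, sub_mul, mul_sub, h1, h2, hf.eq, hii]
      · simpa [hji] using he.idem j
  · rintro (_ | j) (_ | l) hjl
    · exact (hjl rfl).elim
    · rcases eq_or_ne l i with rfl | hl
      · simp [mul_sub, h2, hf.eq]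
      · simpa [hl] using (hj l hl).2
    · rcases eq_or_ne j i with rfl | hl
      · simp [sub_mul, h1, hf.eq]
      · simpa [hl] using (hj j hl).1
    · have hjl' : j ≠ l := fun h => hjl (congrArg some h)
      rcases eq_or_ne j i with rfl | hji
      · simp [hjl'.symm, sub_mul, he.ortho hjl', (hj l hjl'.symm).2]
      · rcases eq_or_ne l i with rfl | hl
        · simp [hji, mul_sub, he.ortho hjl', (hj j hji).1]
        · simpa [hji, hl] using he.ortho hjl'
  · rw [Fintype.sum_option]
    simp only [Option.elim_none, Option.elim_some]
    rw [Finset.sum_update_of_mem (Finset.mem_univ i), ← add_assoc, add_sub_cancel, ← he.complete,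
      ← Finset.sum_sdiff (Finset.subset_univ {i}), Finset.sum_singleton, add_comm]

theorem exists_completeOrthogonalIdempotents_primitive {R H : Type*} [CommRing R] [IsDomain R]
    [Ring H] [Algebra R H] [Module.Finite R H]
    (hR : ∀ (r : R) (x : H), r • x = 0 → r = 0 ∨ x = 0) :
    ∃ (n : ℕ) (e : Fin n → H), CompleteOrthogonalIdempotents e ∧
      ∀ i, IsPrimitiveIdempotent (e i) := by
  by_contra! hcon
  have key : ∀ n : ℕ, ∃ m ≥ n, ∃ e : Fin m → H, CompleteOrthogonalIdempotents e ∧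
      ∀ i, e i ≠ 0 := by
    intro n
    induction n with
    | zero =>
      rcases subsingleton_or_nontrivial H with hs | hs
      · exact ⟨0, le_rfl, fun _ => 0, ⟨⟨fun i => i.elim0, fun i => i.elim0⟩,
          Subsingleton.elim _ _⟩, fun i => i.elim0⟩
      · exact ⟨1, zero_le_one, fun _ => 1,
          CompleteOrthogonalIdempotents.unique_iff.mpr rfl, fun _ => one_ne_zero⟩
    | succ n ih =>
      obtain ⟨m, hm, e, he, hne⟩ := ih
      obtain ⟨i, hi⟩ := hcon m e he
      have : ∃ f, IsIdempotentElem f ∧ e i * f = f ∧ f * e i = f ∧ f ≠ 0 ∧ f ≠ e i := by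
        by_contra! h
        refine hi ⟨he.idem i, hne i, fun f hf h1 h2 => ?_⟩
        by_cases hf0 : f = 0
        · exact Or.inl hf0
        · exact Or.inr (h f hf h1 h2 hf0)
      obtain ⟨f, hf, h1, h2, hf0, hfe⟩ := this
      refine ⟨m + 1, Nat.succ_le_succ hm, _,
        (CompleteOrthogonalIdempotents.equiv (finSuccEquiv m)).mpr (he.split i hf h1 h2),
        fun j => ?_⟩
      generalize hj : finSuccEquiv m j = o
      simp only [Function.comp_apply, hj]
      rcases o with _ | l
      · exact hf0
      · rcases eq_or_ne l i with rfl | hl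
        · simpa [sub_eq_zero] using hfe.symm
        · simpa [hl] using hne l
  obtain ⟨m, hm, e, he, hne⟩ := key (Module.finrank R H + 1)
  have h1 := (he.toOrthogonalIdempotents.linearIndependent hR hne).fintype_card_le_finrank
  rw [Fintype.card_fin] at h1
  exact absurd (hm.trans h1) (by simp)

/-- The endomorphism ring of an indecomposable projective over a hereditary order over `k⟦X⟧` is a
power series ring. -/
theorem IsPrimitiveIdempotent.exists_powerSeries_hom {k H : Type*} [Field k] [IsAlgClosed k]
    [Ring H] [Algebra (PowerSeries k) H] [Module.Finite (PowerSeries k) H] {e : H}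
    (he : IsPrimitiveIdempotent e) (hH : IsHereditaryOrder (PowerSeries k) H) :
    ∃ τ : PowerSeries k →ₙ+* H, Function.Injective τ ∧ τ 1 = e ∧
      (∀ x, e * x = x → x * e = x → ∃ r, τ r = x) ∧
      ∀ c : k, τ (PowerSeries.C c) = (PowerSeries.C c : PowerSeries k) • e := by
  have hmem : ∀ {x : H}, x ∈ Subsemigroup.corner e ↔ e * x = x ∧ x * e = x :=
    fun {x} => Subsemigroup.mem_corner_iff he.idem
  have hval : ∀ x : he.idem.Corner, e * x.1 = x.1 ∧ x.1 * e = x.1 := fun x => hmem.mp x.2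
  let a : PowerSeries k →+* he.idem.Corner :=
    { toFun := fun r => ⟨r • e, hmem.mpr (by simp [he.idem.eq])⟩
      map_one' := Subtype.ext (one_smul _ e)
      map_mul' := fun r s => Subtype.ext (by
        change (r * s) • e = (r • e) * (s • e)
        rw [smul_mul_smul_comm, he.idem.eq])
      map_zero' := Subtype.ext (zero_smul _ e)
      map_add' := fun r s => Subtype.ext (add_smul r s e) }
  let : Algebra (PowerSeries k) he.idem.Corner := a.toAlgebra' fun r x => Subtype.ext (by
    change (r • e) * x.1 = x.1 * (r • e)
    rw [smul_mul_assoc, mul_smul_comm, (hval x).1, (hval x).2])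
  have : Nontrivial he.idem.Corner :=
    ⟨0, 1, fun h => he.ne_zero (congrArg Subtype.val h).symm⟩
  have : NoZeroDivisors he.idem.Corner := ⟨by
    intro x y hxy
    by_contra! h
    refine h.1 (Subtype.ext (he.eq_zero_of_mul_eq_zero hH (x := y.1) (hval y).1 ?_ (hval x).2
      (congrArg Subtype.val hxy)))
    exact fun h0 => h.2 (Subtype.ext h0)⟩
  have : IsNoetherian (PowerSeries k) H := isNoetherian_of_isNoetherianRing_of_finite _ H
  let l : he.idem.Corner →ₗ[PowerSeries k] H :=
    { toFun := fun x => x.1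
      map_add' := fun _ _ => rfl
      map_smul' := fun r x => by
        change (r • e) * x.1 = r • x.1
        rw [smul_mul_assoc, (hval x).1] }
  have : Module.Finite (PowerSeries k) he.idem.Corner :=
    Module.Finite.of_injective l Subtype.val_injective
  obtain ⟨σ, hσ⟩ := exists_ringEquiv_powerSeries_of_chain (k := k) (S := he.idem.Corner) (by
      rw [injective_iff_map_eq_zero]
      intro r hr
      exact (hH.smul_eq_zero r e (congrArg Subtype.val hr)).resolve_right he.ne_zero) (by
      intro x y
      have hle : ∀ x : he.idem.Corner, ∀ z ∈ Ideal.span {x.1}, z * e = z := by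
        intro x z hz
        obtain ⟨b, rfl⟩ := Ideal.mem_span_singleton'.mp hz
        rw [mul_assoc, (hval x).2]
      have hdvd : ∀ x y : he.idem.Corner, x.1 ∈ Ideal.span {y.1} → ∃ z, x = z * y := by
        intro x y h
        obtain ⟨b, hb⟩ := Ideal.mem_span_singleton'.mp h
        refine ⟨⟨e * b * e, hmem.mpr ⟨by simp only [← mul_assoc, he.idem.eq],
          by simp only [mul_assoc, he.idem.eq]⟩⟩, Subtype.ext ?_⟩
        change x.1 = e * b * e * y.1
        rw [mul_assoc, (hval y).1, mul_assoc, hb, (hval x).1]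
      refine (he.le_or_le PowerSeries.X hH (hle x) (hle y)).imp (fun h => ?_) (fun h => ?_)
      · exact hdvd x y (h (Ideal.mem_span_singleton_self _))
      · exact hdvd y x (h (Ideal.mem_span_singleton_self _)))
  refine ⟨{ toFun := fun r => (σ.symm r).1
            map_zero' := congrArg Subtype.val (map_zero σ.symm)
            map_add' := fun r s => congrArg Subtype.val (map_add σ.symm r s)
            map_mul' := fun r s => congrArg Subtype.val (map_mul σ.symm r s) }, ?_, ?_, ?_, ?_⟩
  · exact Subtype.val_injective.comp σ.symm.injective
  · exact congrArg Subtype.val (map_one σ.symm)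
  · intro x h1 h2
    exact ⟨σ ⟨x, hmem.mpr ⟨h1, h2⟩⟩, congrArg Subtype.val (σ.symm_apply_apply _)⟩
  · intro c
    exact congrArg Subtype.val ((σ.symm_apply_eq).mpr (hσ c).symm)

/-- The Peirce component `e H f` is nonzero. -/
def IsLinked {H : Type*} [Ring H] (e f : H) : Prop :=
  ∃ x, x ≠ 0 ∧ e * x = x ∧ x * f = x

namespace IsPrimitiveIdempotent

section

variable {R H : Type*} [CommRing R] [IsDomain R] [Ring H] [Algebra R H] {e f g : H}

theorem isLinked_symm (he : IsPrimitiveIdempotent e) (hf : IsPrimitiveIdempotent f)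
    (hH : IsHereditaryOrder R H) (h : IsLinked e f) : IsLinked f e := by
  obtain ⟨x, hx0, hex, hxf⟩ := h
  obtain ⟨r, hr, hrf⟩ := hf.exists_smul_mem hH (N := Ideal.span {x}) (by
    intro z hz
    obtain ⟨a, rfl⟩ := Ideal.mem_span_singleton'.mp hz
    rw [mul_assoc, hxf]) (by simpa using hx0)
  obtain ⟨z, hz⟩ := Ideal.mem_span_singleton'.mp hrf
  have h1 : f * z * e * x = r • f := by
    rw [mul_assoc, hex, mul_assoc, hz, mul_smul_comm, hf.idem.eq]
  refine ⟨f * z * e, fun h0 => ?_, by simp only [← mul_assoc, hf.idem.eq],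
    by rw [mul_assoc, he.idem.eq]⟩
  rw [h0, zero_mul] at h1
  exact hf.ne_zero ((hH.smul_eq_zero _ _ h1.symm).resolve_left hr)

theorem isLinked_trans (hf : IsPrimitiveIdempotent f) (hH : IsHereditaryOrder R H)
    (h₁ : IsLinked e f) (h₂ : IsLinked f g) : IsLinked e g := by
  obtain ⟨x, hx0, hex, hxf⟩ := h₁
  obtain ⟨y, hy0, hfy, hyg⟩ := h₂
  exact ⟨x * y, fun h => hx0 (hf.eq_zero_of_mul_eq_zero hH hfy hy0 hxf h),
    by rw [← mul_assoc, hex], by rw [mul_assoc, hyg]⟩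

/-- Peirce components are cyclic over the corner ring when the latter is a valuation ring
satisfying the ascending chain condition on principal ideals. -/
theorem exists_generator {A : Type*} [CommRing A] [IsDomain A] [ValuationRing A] [WfDvdMonoid A]
    (he : IsPrimitiveIdempotent e) (hf : IsPrimitiveIdempotent f)
    (hH : IsHereditaryOrder R H) (h : IsLinked e f) (τ : A →ₙ+* H)
    (hτ : ∀ x, f * x = x → x * f = x → ∃ r, τ r = x) :
    ∃ y, y ≠ 0 ∧ e * y = y ∧ y * f = y ∧ ∀ x, e * x = x → x * f = x → ∃ r, x = y * τ r := by
  obtain ⟨z, hz0, hfz, hze⟩ := he.isLinked_symm hf hH h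
  have hmul : ∀ x, e * x = x → z * x = 0 → x = 0 := by
    intro x hx hzx
    by_contra hx0
    exact hz0 (he.eq_zero_of_mul_eq_zero hH hx hx0 hze hzx)
  have hτz : ∀ x, x * f = x → ∃ r, τ r = z * x := fun x hx =>
    hτ _ (by rw [← mul_assoc, hfz]) (by rw [mul_assoc, hx])
  let S : Set A := {r | ∃ x, x ≠ 0 ∧ e * x = x ∧ x * f = x ∧ τ r = z * x}
  obtain ⟨r, ⟨y, hy0, hey, hyf, hry⟩, hmin⟩ := (wellFounded_dvdNotUnit (α := A)).has_min S (by
    obtain ⟨x, hx0, hex, hxf⟩ := h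
    obtain ⟨r, hr⟩ := hτz x hxf
    exact ⟨r, x, hx0, hex, hxf, hr⟩)
  refine ⟨y, hy0, hey, hyf, fun x hex hxf => ?_⟩
  rcases eq_or_ne x 0 with rfl | hx0
  · exact ⟨0, by simp⟩
  obtain ⟨s, hs⟩ := hτz x hxf
  have hdvd : r ∣ s := by
    by_contra hrs
    exact hmin s ⟨x, hx0, hex, hxf, hs⟩
      (dvdNotUnit_of_dvd_of_not_dvd ((ValuationRing.dvd_total r s).resolve_left hrs) hrs)
  obtain ⟨t, rfl⟩ := hdvd
  refine ⟨t, sub_eq_zero.mp (hmul _ (by rw [mul_sub, hex, ← mul_assoc, hey]) ?_)⟩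
  rw [mul_sub, ← hs, map_mul, hry, mul_assoc, sub_self]

end

/-- Membership of a multiple of one generator in the left ideal spanned by another. -/
theorem mul_mem_span_iff {k H : Type*} [Field k] [IsAlgClosed k] [Ring H]
    [Algebra (PowerSeries k) H] [Module.Finite (PowerSeries k) H] {f g y y' : H}
    (hf : f * f = f) (hg : IsPrimitiveIdempotent g) (hH : IsHereditaryOrder (PowerSeries k) H)
    {τ : PowerSeries k →ₙ+* H} (hinj : Function.Injective τ)
    (hτ1 : τ 1 = g)
    (hτC : ∀ c : k, τ (PowerSeries.C c) = (PowerSeries.C c : PowerSeries k) • g)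
    (hyg : y * g = y)
    (hy0' : y' ≠ 0) (hfy' : f * y' = y') (hyg' : y' * g = y')
    (hgen' : ∀ x, f * x = x → x * g = x → ∃ r, x = y' * τ r) (r : PowerSeries k) :
    y * τ r ∈ Ideal.span {y'} ↔ y ∈ Ideal.span {y'} ∨ PowerSeries.X ∣ r := by
  have hτg : ∀ s, τ s * g = τ s := fun s => by rw [← hτ1, ← map_mul, mul_one]
  have hgτ : ∀ s, g * τ s = τ s := fun s => by rw [← hτ1, ← map_mul, one_mul]
  have hspan : ∀ u : H, u * g = u → ∀ x ∈ Ideal.span {u}, x * g = x := by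
    intro u hu x hx
    obtain ⟨a, rfl⟩ := Ideal.mem_span_singleton'.mp hx
    rw [mul_assoc, hu]
  have hX : ∀ s, y * τ (PowerSeries.X * s) ∈ Ideal.span {y'} := by
    intro s
    rcases hg.le_or_le PowerSeries.X hH (hspan (y * τ (PowerSeries.X * s)) (by
      rw [mul_assoc, hτg])) (hspan y' hyg') with h | h
    · exact h (Ideal.mem_span_singleton_self _)
    · exfalso
      obtain ⟨z, hz⟩ := Ideal.mem_span_singleton'.mp (h (Ideal.mem_span_singleton_self _))
      obtain ⟨t, ht⟩ := hgen' (f * z * y) (by rw [← mul_assoc, ← mul_assoc, hf])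
        (by rw [mul_assoc, hyg])
      have h1 : y' * τ (t * (PowerSeries.X * s) - 1) = 0 := by
        rw [map_sub, map_mul, mul_sub, ← mul_assoc, ← ht, hτ1, hyg', mul_assoc, mul_assoc, hz,
          hfy', sub_self]
      have h2 : t * (PowerSeries.X * s) - 1 = 0 := by
        by_contra h0
        exact hy0' (hg.eq_zero_of_mul_eq_zero hH (hgτ _)
          (fun h3 => h0 (hinj (h3.trans (map_zero τ).symm))) hyg' h1)
      have h3 : IsUnit (PowerSeries.X : PowerSeries k) :=
        IsUnit.of_mul_eq_one (s * t) (by linear_combination h2)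
      exact PowerSeries.X_prime.not_isUnit h3
  have hC : ∀ c : k, y * τ (PowerSeries.C c) = (PowerSeries.C c : PowerSeries k) • y := by
    intro c
    rw [hτC, mul_smul_comm, hyg]
  have hdec : y * τ r = (PowerSeries.C (PowerSeries.constantCoeff r) : PowerSeries k) • y
      + y * τ (PowerSeries.X * PowerSeries.mk fun p => PowerSeries.coeff (p + 1) r) := by
    rw [← hC, ← mul_add, ← map_add, add_comm, ← PowerSeries.eq_X_mul_shift_add_const]
  rw [hdec, Submodule.add_mem_iff_left _ (hX _), PowerSeries.X_dvd_iff]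
  constructor
  · intro h
    rw [or_iff_not_imp_right]
    intro h0
    have h1 := Submodule.smul_of_tower_mem (Ideal.span {y'})
      (PowerSeries.C (PowerSeries.constantCoeff r)⁻¹ : PowerSeries k) h
    rwa [smul_smul, ← map_mul, inv_mul_cancel₀ h0, map_one, one_smul] at h1
  · rintro (h | h)
    · exact Submodule.smul_of_tower_mem _ _ h
    · rw [h, map_zero, zero_smul]
      exact zero_mem _

end IsPrimitiveIdempotent

theorem exists_section_of_equivalence {ι : Type*} {r : ι → ι → Prop} (hr : Equivalence r) :
    ∃ c : ι → ι, (∀ a, r a (c a)) ∧ ∀ a b, c a = c b ↔ r a b := by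
  let s : Setoid ι := ⟨r, hr⟩
  refine ⟨fun a => (Quotient.mk s a).out, fun a => hr.symm (Quotient.mk_out a), fun a b => ?_⟩
  rw [Quotient.out_inj]
  exact Quotient.eq (r := s)

/-- A finite family in a partial order which is a chain on every fibre of `c` admits a numerical
rank that detects the order on the fibres. -/
theorem exists_rank {ι κ α : Type*} [Fintype ι] [PartialOrder α] (c : ι → κ) (N : ι → α)
    (h : ∀ a b, c a = c b → N a ≤ N b ∨ N b ≤ N a) :
    ∃ ρ : ι → ℕ, ∀ a b, c a = c b → (ρ a < ρ b ↔ ¬ N a ≤ N b) := by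
  classical
  refine ⟨fun a => (Finset.univ.filter fun d => c d = c a ∧ N a < N d).card, fun a b hab => ?_⟩
  constructor
  · intro hlt hle
    refine hlt.not_ge (Finset.card_le_card fun d => ?_)
    simp only [Finset.mem_filter, Finset.mem_univ, true_and]
    exact fun hd => ⟨hd.1.trans hab.symm, hle.trans_lt hd.2⟩
  · intro hle
    have hlt : N b < N a := lt_of_le_not_ge ((h a b hab).resolve_left hle) hle
    refine Finset.card_lt_card ((Finset.ssubset_iff_of_subset fun d => ?_).mpr ⟨a, ?_, ?_⟩)
    · simp only [Finset.mem_filter, Finset.mem_univ, true_and]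
      exact fun hd => ⟨hd.1.trans hab, hlt.trans hd.2⟩
    · simpa using ⟨hab, hlt⟩
    · simp

/-- A hereditary order over `k⟦X⟧` is a ring of matrices over `k⟦X⟧` which is block diagonal with
respect to some partition of the indices, with each block given by divisibility conditions. -/
theorem IsHereditaryOrder.exists_matrix_hom {k H : Type*} [Field k] [IsAlgClosed k] [Ring H]
    [Algebra (PowerSeries k) H] [Module.Finite (PowerSeries k) H]
    (hH : IsHereditaryOrder (PowerSeries k) H) :
    ∃ (n : ℕ) (c : Fin n → Fin n) (ρ : Fin n → ℕ)
      (F : H →+* Matrix (Fin n) (Fin n) (PowerSeries k)), Function.Injective F ∧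
      ∀ M, M ∈ Set.range F ↔ ∀ a b, (c a ≠ c b → M a b = 0) ∧
        (c a = c b → ρ a < ρ b → PowerSeries.X ∣ M a b) := by
  obtain ⟨n, e, he, hp⟩ :=
    exists_completeOrthogonalIdempotents_primitive (R := PowerSeries k) (H := H) hH.smul_eq_zero
  obtain ⟨c, hc, hcc⟩ := exists_section_of_equivalence
    (r := fun a b => IsLinked (e a) (e b))
    ⟨fun a => ⟨e a, (hp a).ne_zero, (hp a).idem, (hp a).idem⟩,
      fun {a b} => (hp a).isLinked_symm (hp b) hH, fun {_ b _} => (hp b).isLinked_trans hH⟩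
  have hidem : ∀ a, e a * e a = e a := fun a => (hp a).idem
  choose τ hτinj hτ1 hτsurj hτC using fun a => (hp a).exists_powerSeries_hom hH
  choose y hy0 hey hye hgen using fun a =>
    (hp a).exists_generator (hp (c a)) hH (hc a) (τ (c a)) (hτsurj (c a))
  have hτl : ∀ a r, e a * τ a r = τ a r := fun a r => by rw [← hτ1, ← map_mul, one_mul]
  have hτr : ∀ a r, τ a r * e a = τ a r := fun a r => by rw [← hτ1, ← map_mul, mul_one]
  have hyτ : ∀ a r, y a * τ (c a) r = 0 → r = 0 := by
    intro a r h
    by_contra hr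
    exact hy0 a ((hp (c a)).eq_zero_of_mul_eq_zero hH (hτl _ _)
      (fun h0 => hr (hτinj _ (h0.trans (map_zero _).symm))) (hye a) h)
  have hyτinj : ∀ a r s, y a * τ (c a) r = y a * τ (c a) s → r = s := fun a r s h =>
    sub_eq_zero.mp (hyτ a _ (by rw [map_sub, mul_sub, h, sub_self]))
  have hzero : ∀ a b x, c a ≠ c b → e a * x * y b = 0 := by
    intro a b x hab
    by_contra h
    refine hab ((hcc _ _).mpr ((hp (c b)).isLinked_trans (f := e (c b)) hH ?_
      ((hp b).isLinked_symm (hp (c b)) hH (hc b))))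
    exact ⟨_, h, by rw [← mul_assoc, ← mul_assoc, hidem], by rw [mul_assoc, hye]⟩
  have hex : ∀ x a b, ∃ r, e a * x * y b = y a * τ (c a) r := by
    intro x a b
    by_cases hab : c a = c b
    · exact hgen a _ (by rw [← mul_assoc, ← mul_assoc, hidem]) (by rw [mul_assoc, hab, hye])
    · exact ⟨0, by rw [hzero a b x hab, map_zero, mul_zero]⟩
  choose F hF using hex
  have hFz : ∀ x a b, c a ≠ c b → F x a b = 0 := fun x a b hab =>
    hyτ a _ (by rw [← hF, hzero a b x hab])
  have hFeq : ∀ x a b r, e a * x * y b = y a * τ (c a) r → F x a b = r := fun x a b r h =>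
    hyτinj a _ _ ((hF x a b).symm.trans h)
  let F' : H →+* Matrix (Fin n) (Fin n) (PowerSeries k) :=
    { toFun := fun x => Matrix.of (F x)
      map_one' := by
        ext1 a b
        refine hFeq _ _ _ _ ?_
        rcases eq_or_ne a b with rfl | hab
        · rw [Matrix.one_apply_eq, hτ1, mul_one, hey, hye]
        · rw [Matrix.one_apply_ne hab, map_zero, mul_zero, mul_one, ← hey b, ← mul_assoc,
            he.ortho hab, zero_mul]
      map_zero' := by
        ext1 a b
        exact hFeq _ _ _ _ (by simp)
      map_add' := fun x x' => by
        ext1 a b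
        exact hFeq _ _ _ _ (by simp [mul_add, add_mul, hF])
      map_mul' := fun x x' => by
        ext1 a b
        refine hFeq _ _ _ _ ?_
        rw [Matrix.mul_apply, map_sum, Finset.mul_sum]
        calc e a * (x * x') * y b = e a * x * (∑ d, e d) * (x' * y b) := by
              rw [he.complete]; simp only [mul_assoc, one_mul]
          _ = ∑ d, e a * x * (e d * x' * y b) := by
              rw [Finset.mul_sum, Finset.sum_mul]; simp only [mul_assoc]
          _ = _ := Finset.sum_congr rfl fun d _ => ?_
        rw [hF, Matrix.of_apply, Matrix.of_apply, ← mul_assoc, hF]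
        by_cases had : c a = c d
        · rw [← had, mul_assoc, ← map_mul]
        · rw [hFz x a d had, zero_mul, map_zero, mul_zero, zero_mul] }
  obtain ⟨ρ, hρ⟩ := exists_rank c (fun a => Ideal.span {y a}) (fun a b hab => by
    have hspan : ∀ d, ∀ x ∈ Ideal.span {y d}, x * e (c d) = x := by
      intro d x hx
      obtain ⟨z, rfl⟩ := Ideal.mem_span_singleton'.mp hx
      rw [mul_assoc, hye]
    exact (hp (c a)).le_or_le PowerSeries.X hH (hspan a) (by rw [hab]; exact hspan b))
  have hρ' : ∀ a b, c a = c b → (ρ a < ρ b ↔ y a ∉ Ideal.span {y b}) := fun a b hab => by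
    rw [hρ a b hab, Ideal.span_singleton_le_iff_mem]
  have hmem : ∀ a b r, c a = c b →
      (y a * τ (c a) r ∈ Ideal.span {y b} ↔ y a ∈ Ideal.span {y b} ∨ PowerSeries.X ∣ r) := by
    intro a b r hab
    exact (hp (c a)).mul_mem_span_iff (hidem b) hH (hτinj _) (hτ1 _) (hτC _) (hye a) (hy0 b)
      (hey b) (by rw [hab, hye]) (by rw [hab]; exact hgen b) r
  refine ⟨n, c, ρ, F', ?_, fun M => ⟨?_, fun hM => ?_⟩⟩
  · rw [injective_iff_map_eq_zero]
    intro x hx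
    have h1 : ∀ a b, e a * x * e b = 0 := by
      intro a b
      refine (hp b).eq_zero_of_mul_eq_zero hH (hey b) (hy0 b) (by rw [mul_assoc, hidem]) ?_
      rw [mul_assoc, hey, hF, show F x a b = 0 from congrFun (congrFun hx a) b, map_zero, mul_zero]
    calc x = (∑ a, e a) * x * ∑ b, e b := by rw [he.complete, one_mul, mul_one]
      _ = 0 := by simp only [Finset.sum_mul, Finset.mul_sum, h1, Finset.sum_const_zero]
  · rintro ⟨x, rfl⟩ a b
    refine ⟨hFz x a b, fun hab hlt => ?_⟩
    have h1 : y a * τ (c a) (F x a b) ∈ Ideal.span {y b} := by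
      rw [← hF]
      exact Ideal.mul_mem_left _ _ (Ideal.mem_span_singleton_self _)
    exact ((hmem a b _ hab).mp h1).resolve_left ((hρ' a b hab).mp hlt)
  · have h1 : ∀ a b, ∃ x, e a * x = x ∧ x * e b = x ∧ x * y b = y a * τ (c a) (M a b) := by
      intro a b
      by_cases hab : c a = c b
      · have h2 : y a * τ (c a) (M a b) ∈ Ideal.span {y b} := by
          rw [hmem a b _ hab, or_iff_not_imp_left, ← hρ' a b hab]
          exact (hM a b).2 hab
        obtain ⟨z, hz⟩ := Ideal.mem_span_singleton'.mp h2
        refine ⟨e a * z * e b, by simp only [← mul_assoc, hidem], by rw [mul_assoc, hidem], ?_⟩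
        rw [mul_assoc, hey, mul_assoc, hz, ← mul_assoc, hey]
      · exact ⟨0, by simp [(hM a b).1 hab]⟩
    choose x hx1 hx2 hx3 using h1
    refine ⟨∑ i, ∑ j, x i j, ?_⟩
    ext1 a b
    refine hFeq _ _ _ _ ?_
    rw [← hx3, ← hey b]
    have h2 : e a * (∑ i, ∑ j, x i j) * e b = x a b := by
      have h3 : ∀ i j, e a * x i j * e b = if i = a then if j = b then x a b else 0 else 0 := by
        intro i j
        rcases eq_or_ne i a with rfl | hi
        · rw [hx1]
          rcases eq_or_ne j b with rfl | hj
          · simp [hx2]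
          · rw [← hx2, mul_assoc, he.ortho hj]; simp [hj]
        · rw [← hx1, ← mul_assoc, he.ortho hi.symm]; simp [hi]
      simp only [Finset.mul_sum, Finset.sum_mul, h3]
      simp
    rw [← mul_assoc, h2, ← mul_assoc, hx2]

theorem finSigmaFinEquiv_isBlockIndex {r : ℕ} (pvec : Fin r → ℕ) :
    IsBlockIndex pvec fun i : Fin (∑ j, pvec j) => (finSigmaFinEquiv.symm i).1 := by
  intro i
  obtain ⟨⟨j, t⟩, rfl⟩ := finSigmaFinEquiv.surjective i
  have h1 : ∑ l ∈ Finset.Iio j, pvec l = ∑ i : Fin j, pvec (Fin.castLE j.2.le i) := by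
    refine (Finset.sum_bij (fun (i : Fin j) _ => Fin.castLE j.2.le i) ?_ ?_ ?_ ?_).symm
    · intro i _
      simp [Fin.lt_def]
    · intro i _ i' _ h
      simpa using h
    · intro l hl
      exact ⟨⟨l, Fin.lt_def.mp (Finset.mem_Iio.mp hl)⟩, Finset.mem_univ _, rfl⟩
    · exact fun _ _ => rfl
  have h2 : ∑ l ∈ Finset.Iic j, pvec l = pvec j + ∑ l ∈ Finset.Iio j, pvec l := by
    rw [← Finset.Iio_insert, Finset.sum_insert (by simp)]
  simp only [Equiv.symm_apply_apply, finSigmaFinEquiv_apply, h2, h1]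
  have := t.2
  constructor <;> omega

/-- A finite set with a numerical rank can be enumerated in blocks of constant rank. -/
theorem exists_equiv_isBlockIndex {α : Type*} [Fintype α] (ρ : α → ℕ) :
    ∃ (r : ℕ) (pvec : Fin r → ℕ), (∀ j, 0 < pvec j) ∧
      ∃ β : Fin (∑ j, pvec j) → Fin r, IsBlockIndex pvec β ∧
        ∃ g : α ≃ Fin (∑ j, pvec j), ∀ a b, β (g a) < β (g b) ↔ ρ a < ρ b := by
  classical
  let s := Finset.univ.image ρ
  let f : α → Fin s.card := fun a =>
    (s.orderIsoOfFin rfl).symm ⟨ρ a, Finset.mem_image_of_mem ρ (Finset.mem_univ a)⟩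
  have hf : ∀ a b, f a < f b ↔ ρ a < ρ b := fun a b => by simp [f]
  refine ⟨s.card, fun j => Fintype.card {a // f a = j}, fun j => ?_,
    fun i => (finSigmaFinEquiv.symm i).1, finSigmaFinEquiv_isBlockIndex _,
    (Equiv.sigmaFiberEquiv f).symm.trans
      ((Equiv.sigmaCongrRight fun j => Fintype.equivFin {a // f a = j}).trans finSigmaFinEquiv),
    fun a b => ?_⟩
  · obtain ⟨a, -, ha⟩ := Finset.mem_image.mp (s.orderIsoOfFin rfl j).2
    exact Fintype.card_pos_iff.mpr ⟨⟨a, (OrderIso.symm_apply_eq _).mpr (Subtype.ext ha)⟩⟩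
  · rw [← hf]
    simp [Equiv.sigmaFiberEquiv]

/-- The matrices over `R` whose entries strictly above the block diagonal lie in `m`. -/
def blockSubalgebra {R ι κ : Type*} [CommRing R] [Fintype ι] [DecidableEq ι] [LinearOrder κ]
    (m : Ideal R) (β : ι → κ) : Subalgebra R (Matrix ι ι R) where
  carrier := {M | ∀ i j, β i < β j → M i j ∈ m}
  mul_mem' {M N} hM hN i j hij := by
    rw [Matrix.mul_apply]
    refine m.sum_mem fun l _ => ?_
    rcases lt_or_ge (β i) (β l) with h | h
    · exact m.mul_mem_right _ (hM i l h)
    · exact m.mul_mem_left _ (hN l j (h.trans_lt hij))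
  add_mem' hM hN i j hij := m.add_mem (hM i j hij) (hN i j hij)
  algebraMap_mem' r i j hij := by
    have : i ≠ j := fun h => by simp [h] at hij
    simp [Matrix.algebraMap_matrix_apply, this]

theorem coe_map_blockSubalgebra {R K : Type*} [CommRing R] [CommRing K] [Algebra R K]
    (m : Ideal R) {p r : ℕ} (β : Fin p → Fin r) :
    ((blockSubalgebra m β).map (Algebra.ofId R K).mapMatrix :
      Set (Matrix (Fin p) (Fin p) K)) = stdOrderSet R K m β := by
  ext M
  constructor
  · rintro ⟨N, hN, rfl⟩ i j
    exact ⟨⟨N i j, rfl⟩, fun hij => ⟨N i j, hN i j hij, rfl⟩⟩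
  · intro hM
    have : ∀ i j, ∃ x : R, (β i < β j → x ∈ m) ∧ algebraMap R K x = M i j := by
      intro i j
      by_cases hij : β i < β j
      · obtain ⟨x, hx, h⟩ := (hM i j).2 hij
        exact ⟨x, fun _ => hx, h⟩
      · obtain ⟨x, h⟩ := (hM i j).1
        exact ⟨x, fun h => (hij h).elim, h⟩
    choose N hN hNM using this
    exact ⟨Matrix.of N, hN, by ext1 i j; exact hNM i j⟩

/-- A ring of block diagonal matrices whose blocks are cut out by conditions on the entries above
the diagonal decomposes as a product over the blocks. -/
theorem exists_ringEquiv_pi_blockSubalgebra {R H ι κ : Type*} [CommRing R] [Ring H] [Fintype ι]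
    [DecidableEq ι] [DecidableEq κ] (m : Ideal R) (c : ι → κ) (ρ : ι → ℕ)
    (F : H →+* Matrix ι ι R) (hF : Function.Injective F)
    (hr : ∀ M, M ∈ Set.range F ↔ ∀ a b, (c a ≠ c b → M a b = 0) ∧
      (c a = c b → ρ a < ρ b → M a b ∈ m))
    {p r : κ → ℕ} (β : ∀ i, Fin (p i) → Fin (r i)) (g : ∀ i, {a // c a = i} ≃ Fin (p i))
    (hg : ∀ i a b, β i (g i a) < β i (g i b) ↔ ρ a.1 < ρ b.1) :
    Nonempty (H ≃+* ∀ i, blockSubalgebra m (β i)) := by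
  have hFr := fun x => (hr (F x)).mp ⟨x, rfl⟩
  let φ : H →+* ∀ i, blockSubalgebra m (β i) :=
    { toFun := fun x i => ⟨(F x).submatrix (fun u => ((g i).symm u).1) fun u => ((g i).symm u).1, by
        intro u v huv
        refine (hFr x _ _).2 (((g i).symm u).2.trans ((g i).symm v).2.symm) ?_
        rwa [← hg i, Equiv.apply_symm_apply, Equiv.apply_symm_apply]⟩
      map_one' := by
        ext1 i
        refine Subtype.ext ?_
        change (F 1).submatrix _ _ = 1
        rw [map_one]
        exact Matrix.submatrix_one _ (Subtype.val_injective.comp (g i).symm.injective)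
      map_zero' := by
        ext1 i
        refine Subtype.ext ?_
        change (F 0).submatrix _ _ = 0
        rw [map_zero]
        rfl
      map_add' := fun x y => by
        ext1 i
        refine Subtype.ext ?_
        change (F (x + y)).submatrix _ _ = (F x).submatrix _ _ + (F y).submatrix _ _
        rw [map_add]
        rfl
      map_mul' := fun x y => by
        ext1 i
        refine Subtype.ext ?_
        change (F (x * y)).submatrix _ _ = (F x).submatrix _ _ * (F y).submatrix _ _
        rw [map_mul]
        ext u v
        simp only [Matrix.submatrix_apply, Matrix.mul_apply]
        rw [(g i).symm.sum_comp fun d : {a // c a = i} =>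
          F x ((g i).symm u).1 d.1 * F y d.1 ((g i).symm v).1,
          ← Finset.sum_subtype (Finset.univ.filter fun a => c a = i) (by simp) fun d =>
          F x ((g i).symm u).1 d * F y d ((g i).symm v).1]
        refine (Finset.sum_subset (Finset.subset_univ _) fun d _ hd => ?_).symm
        rw [(hFr x _ d).1 fun h => hd (by simpa using h.symm.trans ((g i).symm u).2), zero_mul] }
  have hφ : ∀ x i (a b : {a // c a = i}), (φ x i).1 (g i a) (g i b) = F x a b := by
    intro x i a b
    change F x ((g i).symm _).1 ((g i).symm _).1 = _
    rw [Equiv.symm_apply_apply, Equiv.symm_apply_apply]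
  refine ⟨RingEquiv.ofBijective φ ⟨?_, fun N => ?_⟩⟩
  · intro x y hxy
    refine hF (Matrix.ext fun a b => ?_)
    by_cases hab : c a = c b
    · rw [← hφ x (c b) ⟨a, hab⟩ ⟨b, rfl⟩, hxy, hφ]
    · rw [(hFr x a b).1 hab, (hFr y a b).1 hab]
  · let M : Matrix ι ι R := Matrix.of fun a b =>
      if h : c a = c b then (N (c b)).1 (g _ ⟨a, h⟩) (g _ ⟨b, rfl⟩) else 0
    have hM : ∀ i (a b : {a // c a = i}), M a b = (N i).1 (g i a) (g i b) := by
      rintro i ⟨a, ha⟩ ⟨b, rfl⟩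
      simp [M, ha]
    obtain ⟨x, hx⟩ := (hr M).mpr fun a b => ⟨fun hab => by simp [M, hab], fun hab hlt => by
      rw [hM (c b) ⟨a, hab⟩ ⟨b, rfl⟩]
      exact (N (c b)).2 _ _ ((hg _ _ _).mpr hlt)⟩
    refine ⟨x, funext fun i => Subtype.ext (Matrix.ext fun u v => ?_)⟩
    rw [← (g i).apply_symm_apply u, ← (g i).apply_symm_apply v, hφ, hx, hM]

/-- Over `R = k⟦w⟧` (`k` algebraically closed) with fraction field
`K = k((w))`, every hereditary `R`-order `H` (an `R`-algebra, finitely generated and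
torsion-free as an `R`-module, with `K ⊗_R H` semisimple, all of whose left ideals are
projective) is isomorphic as a ring to a finite product of standard orders
`H(R, p⃗₁) × ⋯ × H(R, p⃗_s)`. -/
theorem statement5 {k : Type u} [Field k] [IsAlgClosed k]
    (H : Type v) [Ring H] [Algebra (PowerSeries k) H]
    (hfin : Module.Finite (PowerSeries k) H)
    (htf : NoZeroSMulDivisors (PowerSeries k) H)
    (hss : IsSemisimpleRing (LaurentSeries k ⊗[PowerSeries k] H))
    (hher : ∀ I : Ideal H, Module.Projective H I) :
    ∃ (s : ℕ), 0 < s ∧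
      ∃ (rr : Fin s → ℕ) (pvec : ∀ i, Fin (rr i) → ℕ),
        (∀ i j, 0 < pvec i j) ∧
        ∃ (β : ∀ i, Fin (∑ j, pvec i j) → Fin (rr i)),
          (∀ i, IsBlockIndex (pvec i) (β i)) ∧
          ∃ (Hsub : ∀ i, Subalgebra (PowerSeries k)
              (Matrix (Fin (∑ j, pvec i j)) (Fin (∑ j, pvec i j)) (LaurentSeries k))),
            (∀ i, (Hsub i : Set (Matrix (Fin (∑ j, pvec i j)) (Fin (∑ j, pvec i j))
                (LaurentSeries k))) =
              stdOrderSet (PowerSeries k) (LaurentSeries k)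
                (IsLocalRing.maximalIdeal (PowerSeries k)) (β i)) ∧
            Nonempty (H ≃+* ∀ i, Hsub i) := by
  have : Module.IsTorsionFree (PowerSeries k) H := inferInstance
  have : Module.Flat (PowerSeries k) H := inferInstance
  have hH : IsHereditaryOrder (PowerSeries k) H :=
    IsHereditaryOrder.of_isSemisimpleRing (K := LaurentSeries k) htf hher
  obtain ⟨n, c, ρ, F, hF, hr⟩ := hH.exists_matrix_hom
  choose rr pvec hpos β hβ g hg using fun i : Fin (n + 1) =>
    exists_equiv_isBlockIndex fun a : {a // (c a).castSucc = i} => ρ a.1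
  obtain ⟨σ⟩ := exists_ringEquiv_pi_blockSubalgebra (IsLocalRing.maximalIdeal (PowerSeries k))
    (fun a => (c a).castSucc) ρ F hF (by
      simpa [PowerSeries.maximalIdeal_eq_span_X, Ideal.mem_span_singleton] using hr) β g hg
  have hinj : ∀ i, Function.Injective
      ((Algebra.ofId (PowerSeries k) (LaurentSeries k)).mapMatrix (m := Fin (∑ j, pvec i j))) :=
    fun i => Matrix.map_injective (IsFractionRing.injective (PowerSeries k) (LaurentSeries k))
  exact ⟨n + 1, n.succ_pos, rr, pvec, hpos, β, hβ, fun i => (blockSubalgebra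
    (IsLocalRing.maximalIdeal (PowerSeries k)) (β i)).map (Algebra.ofId _ _).mapMatrix,
    fun i => coe_map_blockSubalgebra _ _, ⟨σ.trans (RingEquiv.piCongrRight fun i =>
      ((blockSubalgebra _ (β i)).equivMapOfInjective _ (hinj i)).toRingEquiv)⟩⟩
end
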